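/- arXiv:0707.2439 — 10 statements merged into one kernel-verified Lean document; each statement's English description precedes it below -/
import Mathlib

section
/- Let S be a monoid and X ⊆ S a generating set (i.e. ⟨X⟩ = S) consisting of completely regular elements. Then S is an inverse monoid whose set of idempotents E(S) equals the submonoid ⟨X⁰⟩ generated by X⁰ if and only if for all x, y ∈ X: (i) x⁰ y⁰ = y⁰ x⁰, and (ii) y⁻¹ x⁰ y ∈ ⟨X⁰⟩. -/
/-- A monoid is an inverse monoid if every element has an inverse (in the sense of
semigroup theory) and any two idempotents commute. -/
def IsInverseMonoid (S : Type*) [Monoid S] : Prop :=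
  (∀ a : S, ∃ b : S, a * b * a = a ∧ b * a * b = b) ∧
  (∀ e f : S, IsIdempotentElem e → IsIdempotentElem f → e * f = f * e)

section InversePairs

variable {S : Type*} [Monoid S]

/-- `a` and `b` are inverse to each other in the sense of semigroup theory. -/
def IsInversePair (a b : S) : Prop :=
  a * b * a = a ∧ b * a * b = b

/-- If the idempotents `d * c` and `x * y` commute, inverse pairs `(c, d)` and `(x, y)` multiply. -/
theorem IsInversePair.mul {c d x y : S} (hc : IsInversePair c d) (hx : IsInversePair x y)
    (hcomm : Commute (d * c) (x * y)) : IsInversePair (c * x) (y * d) := by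
  obtain ⟨hc₁, hc₂⟩ := hc
  obtain ⟨hx₁, hx₂⟩ := hx
  have h := hcomm.eq
  constructor
  · calc c * x * (y * d) * (c * x) = c * ((x * y) * (d * c)) * x := by simp only [mul_assoc]
      _ = (c * d * c) * (x * y * x) := by rw [← h]; simp only [mul_assoc]
      _ = c * x := by rw [hc₁, hx₁]
  · calc y * d * (c * x) * (y * d) = y * ((d * c) * (x * y)) * d := by simp only [mul_assoc]
      _ = (y * x * y) * (d * c * d) := by rw [h]; simp only [mul_assoc]
      _ = y * d := by rw [hc₂, hx₂]

/-- An idempotent `e` lies in every submonoid of idempotents containing `e * b` and `b * e`, where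
`b` is an inverse of `e`. -/
theorem IsInversePair.mem_of_isIdempotentElem {M : Submonoid S}
    (hM : ∀ m ∈ M, IsIdempotentElem m) {e b : S} (hb : IsInversePair e b)
    (he : IsIdempotentElem e) (h₁ : e * b ∈ M) (h₂ : b * e ∈ M) : e ∈ M := by
  have hbM : b ∈ M := by
    have h : b * e * (e * b) = b := by
      calc b * e * (e * b) = b * (e * e) * b := by simp only [mul_assoc]
        _ = b := by rw [he.eq, hb.2]
    exact h ▸ mul_mem h₂ h₁
  have h : e * b * (b * e) = e := by
    calc e * b * (b * e) = e * (b * b) * e := by simp only [mul_assoc]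
      _ = e := by rw [(hM b hbM).eq, hb.1]
  exact h ▸ mul_mem h₁ h₂

variable {X : Set S} {M : Submonoid S}

/-- Every product of elements of `X` has an inverse `b` such that `m ↦ b * m * a` preserves `M`,
provided that this holds for the elements of `X`. -/
theorem exists_isInversePair_of_mem_closure (hcomm : ∀ m ∈ M, ∀ n ∈ M, Commute m n)
    (hX : ∀ x ∈ X, ∃ y, IsInversePair x y ∧ x * y ∈ M ∧ ∀ m ∈ M, y * m * x ∈ M)
    {a : S} (ha : a ∈ Submonoid.closure X) :
    ∃ b, IsInversePair a b ∧ ∀ m ∈ M, b * m * a ∈ M := by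
  induction ha using Submonoid.closure_induction_right with
  | one => exact ⟨1, by simp [IsInversePair], by simp⟩
  | mul_right c _ x hx ih =>
    obtain ⟨d, hd, hdM⟩ := ih
    obtain ⟨y, hy, hxy, hyM⟩ := hX x hx
    refine ⟨y * d, hd.mul hy (hcomm _ ?_ _ hxy), fun m hm => ?_⟩
    · simpa using hdM 1 M.one_mem
    · simpa only [mul_assoc] using hyM _ (hdM m hm)

/-- Two-sided version of `exists_isInversePair_of_mem_closure`. -/
theorem exists_isInversePair_of_mem_closure' (hcomm : ∀ m ∈ M, ∀ n ∈ M, Commute m n)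
    (hX : ∀ x ∈ X, ∃ y, IsInversePair x y ∧ (∀ m ∈ M, x * m * y ∈ M) ∧ ∀ m ∈ M, y * m * x ∈ M)
    {a : S} (ha : a ∈ Submonoid.closure X) :
    ∃ b, IsInversePair a b ∧ (∀ m ∈ M, a * m * b ∈ M) ∧ ∀ m ∈ M, b * m * a ∈ M := by
  induction ha using Submonoid.closure_induction_right with
  | one => exact ⟨1, by simp [IsInversePair], by simp, by simp⟩
  | mul_right c _ x hx ih =>
    obtain ⟨d, hd, hcM, hdM⟩ := ih
    obtain ⟨y, hy, hxM, hyM⟩ := hX x hx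
    refine ⟨y * d, hd.mul hy (hcomm _ ?_ _ ?_), fun m hm => ?_, fun m hm => ?_⟩
    · simpa using hdM 1 M.one_mem
    · simpa using hxM 1 M.one_mem
    · simpa only [mul_assoc] using hcM _ (hxM m hm)
    · simpa only [mul_assoc] using hyM _ (hdM m hm)

/-- If `y` is the group inverse of `x`, and `y` has some inverse `d` such that `m ↦ d * m * y`
preserves the commutative submonoid `M`, then `m ↦ x * m * y` preserves `M` as well. -/
theorem mul_mul_mem_of_isInversePair (hcomm : ∀ m ∈ M, ∀ n ∈ M, Commute m n) {x y d : S}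
    (hxy : IsInversePair x y) (hc : x * y = y * x) (hM : x * y ∈ M) (hd : IsInversePair y d)
    (hdM : ∀ m ∈ M, d * m * y ∈ M) {m : S} (hm : m ∈ M) : x * m * y ∈ M := by
  have hdy : d * y ∈ M := by simpa using hdM 1 M.one_mem
  -- `d * y` and `x * y` are commuting idempotents generating the same left ideal.
  have heq : d * y = x * y := by
    calc d * y = d * y * (x * y) := by
          rw [mul_assoc, ← mul_assoc y, hxy.2]
      _ = x * y * (d * y) := (hcomm _ hdy _ hM).eq
      _ = x * (y * d * y) := by simp only [mul_assoc]
      _ = x * y := by rw [hd.1]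
  have hx : d * (x * y) = x := by
    rw [hc, ← mul_assoc, heq, hxy.1]
  have h : x * m * y = d * m * y := by
    calc x * m * y = d * ((x * y) * m) * y := by
          conv_lhs => rw [← hx]
          simp only [mul_assoc]
      _ = d * m * (x * y * y) := by rw [(hcomm _ hM _ hm).eq]; simp only [mul_assoc]
      _ = d * m * y := by rw [hc, hxy.2]
  exact h ▸ hdM m hm

/-- Pairwise commuting elements generate a commutative submonoid. -/
theorem commute_of_mem_closure {Y : Set S} (hY : ∀ e ∈ Y, ∀ f ∈ Y, Commute e f) :
    ∀ m ∈ Submonoid.closure Y, ∀ n ∈ Submonoid.closure Y, Commute m n := by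
  intro m hm n hn
  induction hm, hn using Submonoid.closure_induction₂ with
  | mem x y hx hy => exact hY x hx y hy
  | one_left => exact Commute.one_left _
  | one_right => exact Commute.one_right _
  | mul_left _ _ _ _ _ _ h₁ h₂ => exact h₁.mul_left h₂
  | mul_right _ _ _ _ _ _ h₁ h₂ => exact h₁.mul_right h₂

/-- Commuting idempotents generate a submonoid of idempotents. -/
theorem isIdempotentElem_of_mem_closure {Y : Set S} (hY : ∀ e ∈ Y, ∀ f ∈ Y, Commute e f)
    (hidem : ∀ e ∈ Y, IsIdempotentElem e) :
    ∀ m ∈ Submonoid.closure Y, IsIdempotentElem m := by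
  intro m hm
  induction hm using Submonoid.closure_induction with
  | mem x hx => exact hidem x hx
  | one => exact IsIdempotentElem.one
  | mul a b ha hb iha ihb => exact iha.mul_of_commute (commute_of_mem_closure hY a ha b hb) ihb

/-- Conjugation by an inverse pair `(x, y)` preserves a commutative submonoid `⟨Y⟩` containing
`x * y` and `y * x` as soon as it maps `Y` into `⟨Y⟩`. -/
theorem conj_mem_closure {Y : Set S} (hY : ∀ e ∈ Y, ∀ f ∈ Y, Commute e f) {x y : S}
    (hxy : IsInversePair x y) (h₁ : x * y ∈ Submonoid.closure Y)
    (h₂ : y * x ∈ Submonoid.closure Y) (h : ∀ e ∈ Y, y * e * x ∈ Submonoid.closure Y) :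
    ∀ m ∈ Submonoid.closure Y, y * m * x ∈ Submonoid.closure Y := by
  intro m hm
  induction hm using Submonoid.closure_induction with
  | mem e he => exact h e he
  | one => simpa using h₂
  | mul e f he hf ihe ihf =>
    have key : y * e * x * (y * f * x) = y * (e * f) * x := by
      calc y * e * x * (y * f * x) = y * (e * (x * y)) * f * x := by simp only [mul_assoc]
        _ = (y * x * y) * (e * f) * x := by
          rw [(commute_of_mem_closure hY e he _ h₁).eq]; simp only [mul_assoc]
        _ = y * (e * f) * x := by rw [hxy.2]
    exact key ▸ mul_mem ihe ihf

end InversePairs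

/-- Let `S` be a monoid generated by a set `X` of completely regular
elements (with `inv x` the completely regular inverse of each `x ∈ X`, so that
`x⁰ = x * inv x`).  Then `S` is an inverse monoid with set of idempotents equal to the
submonoid generated by `X⁰` if and only if for all `x, y ∈ X` we have
`x⁰ y⁰ = y⁰ x⁰` and `y⁻¹ x⁰ y ∈ ⟨X⁰⟩`. -/
theorem stmt0 {S : Type*} [Monoid S] (X : Set S) (inv : S → S)
    (hcr : ∀ x ∈ X, x * inv x = inv x * x ∧ x * inv x * x = x ∧ inv x * x * inv x = inv x)
    (hgen : Submonoid.closure X = ⊤) :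
    (IsInverseMonoid S ∧
      {a : S | IsIdempotentElem a} =
        (Submonoid.closure ((fun x => x * inv x) '' X) : Set S))
  ↔ (∀ x ∈ X, ∀ y ∈ X,
      (x * inv x) * (y * inv y) = (y * inv y) * (x * inv x) ∧
      inv y * (x * inv x) * y ∈ Submonoid.closure ((fun x => x * inv x) '' X)) := by
  have hpair : ∀ x ∈ X, IsInversePair x (inv x) := fun x hx => (hcr x hx).2
  have hidem : ∀ x ∈ X, IsIdempotentElem (x * inv x) := fun x hx => by
    rw [IsIdempotentElem, ← mul_assoc, (hpair x hx).1]
  constructor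
  · rintro ⟨⟨-, hcomm⟩, hE⟩ x hx y hy
    have hxy := hcomm _ _ (hidem x hx) (hidem y hy)
    refine ⟨hxy, ?_⟩
    rw [← SetLike.mem_coe, ← hE]
    calc inv y * (x * inv x) * y * (inv y * (x * inv x) * y)
        = inv y * ((x * inv x) * (y * inv y)) * (x * inv x) * y := by simp only [mul_assoc]
      _ = (inv y * y * inv y) * ((x * inv x) * (x * inv x)) * y := by
        rw [hxy]; simp only [mul_assoc]
      _ = inv y * (x * inv x) * y := by rw [(hpair y hy).2, (hidem x hx).eq]
  · intro h
    set Y := (fun x => x * inv x) '' X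
    have hYmem : ∀ x ∈ X, x * inv x ∈ Submonoid.closure Y := fun x hx =>
      Submonoid.subset_closure ⟨x, hx, rfl⟩
    have hY : ∀ e ∈ Y, ∀ f ∈ Y, Commute e f := by
      rintro _ ⟨x, hx, rfl⟩ _ ⟨y, hy, rfl⟩
      exact (h x hx y hy).1
    have hMcomm := commute_of_mem_closure hY
    have hMidem := isIdempotentElem_of_mem_closure hY (by rintro _ ⟨x, hx, rfl⟩; exact hidem x hx)
    have hconj : ∀ x ∈ X, ∀ m ∈ Submonoid.closure Y, inv x * m * x ∈ Submonoid.closure Y := by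
      intro x hx
      refine conj_mem_closure hY (hpair x hx) (hYmem x hx) ((hcr x hx).1 ▸ hYmem x hx) ?_
      rintro _ ⟨z, hz, rfl⟩
      exact (h z hz x hx).2
    have hconj' : ∀ x ∈ X, ∀ m ∈ Submonoid.closure Y, x * m * inv x ∈ Submonoid.closure Y := by
      intro x hx m hm
      obtain ⟨d, hd, hdM⟩ := exists_isInversePair_of_mem_closure hMcomm
        (fun z hz => ⟨inv z, hpair z hz, hYmem z hz, hconj z hz⟩)
        (hgen ▸ Submonoid.mem_top (inv x))
      exact mul_mul_mem_of_isInversePair hMcomm (hpair x hx) (hcr x hx).1 (hYmem x hx) hd hdM hm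
    have hinv : ∀ a : S, ∃ b, IsInversePair a b ∧ (∀ m ∈ Submonoid.closure Y,
        a * m * b ∈ Submonoid.closure Y) ∧ ∀ m ∈ Submonoid.closure Y,
        b * m * a ∈ Submonoid.closure Y := fun a =>
      exists_isInversePair_of_mem_closure' hMcomm
        (fun z hz => ⟨inv z, hpair z hz, hconj' z hz, hconj z hz⟩)
        (hgen ▸ Submonoid.mem_top a)
    have hE : ∀ e : S, IsIdempotentElem e → e ∈ Submonoid.closure Y := by
      intro e he
      obtain ⟨b, hb, h₁, h₂⟩ := hinv e
      exact hb.mem_of_isIdempotentElem hMidem he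
        (by simpa using h₁ 1 (one_mem _)) (by simpa using h₂ 1 (one_mem _))
    refine ⟨⟨fun a => ?_, fun e f he hf => hMcomm e (hE e he) f (hE f hf)⟩, ?_⟩
    · obtain ⟨b, hb, -⟩ := hinv a
      exact ⟨b, hb⟩
    · exact Set.Subset.antisymm hE hMidem
end

section
/- Let S be a monoid and X ⊆ S a set of completely regular elements such that for all x, y ∈ X one has x⁰ y⁰ = y⁰ x⁰ and y⁻¹ x⁰ y ∈ ⟨X⁰⟩. Then for every y ∈ X and every w ∈ ⟨X⁰⟩, the element y⁻¹ w y lies in ⟨X⁰⟩. -/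
/-- Let `S` be a monoid and `X ⊆ S` a set of completely regular elements
(with `inv x` the completely regular inverse of `x`, and `x⁰ = x * inv x`) such that for
all `x, y ∈ X` one has `x⁰ y⁰ = y⁰ x⁰` and `y⁻¹ x⁰ y ∈ ⟨X⁰⟩`.  Then for every `y ∈ X` and
every `w ∈ ⟨X⁰⟩`, the element `y⁻¹ w y` lies in `⟨X⁰⟩`. -/
theorem stmt1 {S : Type*} [Monoid S] (X : Set S) (inv : S → S)
    (hcr : ∀ x ∈ X, x * inv x = inv x * x ∧ x * inv x * x = x ∧ inv x * x * inv x = inv x)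
    (hcomm : ∀ x ∈ X, ∀ y ∈ X,
      (x * inv x) * (y * inv y) = (y * inv y) * (x * inv x))
    (hconj : ∀ x ∈ X, ∀ y ∈ X,
      inv y * (x * inv x) * y ∈ Submonoid.closure ((fun x => x * inv x) '' X)) :
    ∀ y ∈ X, ∀ w ∈ Submonoid.closure ((fun x => x * inv x) '' X),
      inv y * w * y ∈ Submonoid.closure ((fun x => x * inv x) '' X) := by
  intro y hy w hw
  obtain ⟨hyc, -, hyi⟩ := hcr y hy
  induction hw using Submonoid.closure_induction_left with
  | one =>
    rw [mul_one, ← hyc]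
    exact Submonoid.subset_closure ⟨y, hy, rfl⟩
  | mul_left e he w _ ih =>
    obtain ⟨x, hx, rfl⟩ := he
    have key : inv y * (x * inv x * w) * y = inv y * (x * inv x) * y * (inv y * w * y) :=
      calc inv y * (x * inv x * w) * y
          = inv y * y * inv y * (x * inv x * w) * y := by rw [hyi]
        _ = inv y * ((y * inv y) * (x * inv x)) * w * y := by simp only [mul_assoc]
        _ = inv y * ((x * inv x) * (y * inv y)) * w * y := by rw [hcomm y hy x hx]
        _ = inv y * (x * inv x) * y * (inv y * w * y) := by simp only [mul_assoc]
    change inv y * (x * inv x * w) * y ∈ _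
    rw [key]
    exact mul_mem (hconj x hx y hy) ih
end

section
/- Let S be a monoid generated by a set X of completely regular elements such that for all x, y ∈ X one has x⁰ y⁰ = y⁰ x⁰ and y⁻¹ x⁰ y ∈ ⟨X⁰⟩. Then for every w ∈ S there exists w' ∈ S such that: (B1) w' u w ∈ ⟨X⁰⟩ for every u ∈ ⟨X⁰⟩; (B2) w w' ∈ ⟨X⁰⟩ and w' w ∈ ⟨X⁰⟩; and (B3) w w' w = w and w' w w' = w'. -/
/-- `w'` is a semigroup inverse of `w`, and `u ↦ w' * u * w` maps `E` into itself. -/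
structure IsConjInverse {S : Type*} [Monoid S] (E : Submonoid S) (w w' : S) : Prop where
  conj_mem : ∀ u ∈ E, w' * u * w ∈ E
  mul_inv_mul : w * w' * w = w
  inv_mul_inv : w' * w * w' = w'

namespace IsConjInverse

variable {S : Type*} [Monoid S] {E : Submonoid S} {v v' x x' : S}

theorem one : IsConjInverse E (1 : S) 1 := by
  constructor <;> simp

theorem inv_mul_mem (h : IsConjInverse E v v') : v' * v ∈ E := by
  simpa using h.conj_mem 1 E.one_mem

theorem mul (hE : ∀ a ∈ E, ∀ b ∈ E, a * b = b * a) (hv : IsConjInverse E v v')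
    (hx : IsConjInverse E x x') (hxE : x * x' ∈ E) :
    IsConjInverse E (v * x) (x' * v') where
  conj_mem u hu := by
    simpa only [mul_assoc] using hx.conj_mem _ (hv.conj_mem u hu)
  mul_inv_mul := by
    calc v * x * (x' * v') * (v * x) = v * ((x * x') * (v' * v)) * x := by
          simp only [mul_assoc]
      _ = v * ((v' * v) * (x * x')) * x := by rw [hE _ hxE _ hv.inv_mul_mem]
      _ = (v * v' * v) * (x * x' * x) := by simp only [mul_assoc]
      _ = v * x := by rw [hv.mul_inv_mul, hx.mul_inv_mul]
  inv_mul_inv := by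
    calc x' * v' * (v * x) * (x' * v') = x' * ((v' * v) * (x * x')) * v' := by
          simp only [mul_assoc]
      _ = x' * ((x * x') * (v' * v)) * v' := by rw [hE _ hxE _ hv.inv_mul_mem]
      _ = (x' * x * x') * (v' * v * v') := by simp only [mul_assoc]
      _ = x' * v' := by rw [hv.inv_mul_inv, hx.inv_mul_inv]

/-- If a completely regular inverse `x'` of `x` itself admits a conjugating inverse `z`,
then conjugation by `x` in the opposite direction also preserves `E`. -/
theorem conj_mem_of_isConjInverse {z : S} (hE : ∀ a ∈ E, ∀ b ∈ E, a * b = b * a)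
    (hx : IsConjInverse E x x') (hcomm : x * x' = x' * x) (hz : IsConjInverse E x' z)
    {e : S} (he : e ∈ E) : x * e * x' ∈ E := by
  have hxE : x * x' ∈ E := hcomm ▸ hx.inv_mul_mem
  have hf : z * x' = x * x' := by
    calc z * x' = z * x' * (x * x') := by
          rw [mul_assoc, ← mul_assoc x', hx.inv_mul_inv]
      _ = x * x' * (z * x') := hE _ hz.inv_mul_mem _ hxE
      _ = x * (x' * z * x') := by simp only [mul_assoc]
      _ = x * x' := by rw [hz.mul_inv_mul]
  have key : z * e * x' = x * e * x' := by
    calc z * e * x' = z * e * (x' * x * x') := by rw [hx.inv_mul_inv]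
      _ = z * (e * (x * x')) * x' := by rw [hcomm]; simp only [mul_assoc]
      _ = z * (x' * x * e) * x' := by rw [hE _ he _ hxE, hcomm]
      _ = z * x' * (x * e * x') := by simp only [mul_assoc]
      _ = x * x' * x * (e * x') := by rw [hf]; simp only [mul_assoc]
      _ = x * e * x' := by rw [hx.mul_inv_mul, mul_assoc]
  exact key ▸ hz.conj_mem e he

end IsConjInverse

/-- If `y * y'` commutes with a generating set of `E`, conjugation by `y` is multiplicative
on `E`, so it preserves `E` as soon as it maps the generators into `E`. -/
theorem Submonoid.conj_mem_closure {S : Type*} [Monoid S] {G : Set S} {y y' : S}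
    (hone : y' * y ∈ closure G) (hy : y' * y * y' = y')
    (hcomm : ∀ g ∈ G, y * y' * g = g * (y * y')) (hG : ∀ g ∈ G, y' * g * y ∈ closure G)
    {u : S} (hu : u ∈ closure G) : y' * u * y ∈ closure G := by
  induction hu using closure_induction_left with
  | one => simpa using hone
  | mul_left g hg u _ ih =>
    have : y' * (g * u) * y = (y' * g * y) * (y' * u * y) := by
      calc y' * (g * u) * y = y' * y * y' * (g * u) * y := by rw [hy]
        _ = y' * (y * y' * g) * (u * y) := by simp only [mul_assoc]
        _ = (y' * g * y) * (y' * u * y) := by rw [hcomm g hg]; simp only [mul_assoc]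
    exact this ▸ mul_mem (hG g hg) ih

/-- Let `S` be a monoid generated by a set `X` of completely regular
elements (with `inv x` the completely regular inverse of `x`, and `x⁰ = x * inv x`) such
that for all `x, y ∈ X` one has `x⁰ y⁰ = y⁰ x⁰` and `y⁻¹ x⁰ y ∈ ⟨X⁰⟩`.  Then for every
`w ∈ S` there exists `w' ∈ S` such that:
(B1) `w' u w ∈ ⟨X⁰⟩` for every `u ∈ ⟨X⁰⟩`;
(B2) `w w' ∈ ⟨X⁰⟩` and `w' w ∈ ⟨X⁰⟩`;
(B3) `w w' w = w` and `w' w w' = w'`. -/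
theorem stmt2 {S : Type*} [Monoid S] (X : Set S) (inv : S → S)
    (hcr : ∀ x ∈ X, x * inv x = inv x * x ∧ x * inv x * x = x ∧ inv x * x * inv x = inv x)
    (hgen : Submonoid.closure X = ⊤)
    (hcomm : ∀ x ∈ X, ∀ y ∈ X,
      (x * inv x) * (y * inv y) = (y * inv y) * (x * inv x))
    (hconj : ∀ x ∈ X, ∀ y ∈ X,
      inv y * (x * inv x) * y ∈ Submonoid.closure ((fun x => x * inv x) '' X)) :
    ∀ w : S, ∃ w' : S,
      (∀ u ∈ Submonoid.closure ((fun x => x * inv x) '' X),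
        w' * u * w ∈ Submonoid.closure ((fun x => x * inv x) '' X)) ∧
      w * w' ∈ Submonoid.closure ((fun x => x * inv x) '' X) ∧
      w' * w ∈ Submonoid.closure ((fun x => x * inv x) '' X) ∧
      w * w' * w = w ∧ w' * w * w' = w' := by
  set E := Submonoid.closure ((fun x => x * inv x) '' X)
  have hgenE : ∀ x ∈ X, x * inv x ∈ E := fun x hx =>
    Submonoid.subset_closure (Set.mem_image_of_mem _ hx)
  have hE : ∀ a ∈ E, ∀ b ∈ E, a * b = b * a := by
    have hG : ∀ a ∈ (fun x => x * inv x) '' X, ∀ b ∈ (fun x => x * inv x) '' X,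
        a * b = b * a := by
      rintro _ ⟨x, hx, rfl⟩ _ ⟨y, hy, rfl⟩
      exact hcomm x hx y hy
    have := Submonoid.isMulCommutative_closure S hG
    exact fun a ha b hb => congrArg Subtype.val (mul_comm' (⟨a, ha⟩ : E) ⟨b, hb⟩)
  have hX : ∀ x ∈ X, IsConjInverse E x (inv x) := fun x hx =>
    { conj_mem := fun u hu => by
        obtain ⟨hxc, -, hxi⟩ := hcr x hx
        refine Submonoid.conj_mem_closure (hxc ▸ hgenE x hx) hxi ?_ ?_ hu
        · rintro _ ⟨y, hy, rfl⟩
          exact hcomm x hx y hy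
        · rintro _ ⟨y, hy, rfl⟩
          exact hconj y hy x hx
      mul_inv_mul := (hcr x hx).2.1
      inv_mul_inv := (hcr x hx).2.2 }
  have hexists : ∀ w : S, ∃ w', IsConjInverse E w w' := fun w => by
    have hw : w ∈ Submonoid.closure X := hgen ▸ Submonoid.mem_top w
    induction hw using Submonoid.closure_induction_right with
    | one => exact ⟨1, .one⟩
    | mul_right v _ x hx ih =>
      obtain ⟨v', hv⟩ := ih
      exact ⟨inv x * v', hv.mul hE (hX x hx) (hgenE x hx)⟩
  have hXconj : ∀ x ∈ X, ∀ e ∈ E, x * e * inv x ∈ E := fun x hx e he =>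
    let ⟨_, hz⟩ := hexists (inv x)
    (hX x hx).conj_mem_of_isConjInverse hE (hcr x hx).1 hz he
  intro w
  obtain ⟨w', hw', hconj'⟩ : ∃ w', IsConjInverse E w w' ∧ ∀ e ∈ E, w * e * w' ∈ E := by
    have hw : w ∈ Submonoid.closure X := hgen ▸ Submonoid.mem_top w
    induction hw using Submonoid.closure_induction_right with
    | one => exact ⟨1, .one, by simp⟩
    | mul_right v _ x hx ih =>
      obtain ⟨v', hv, hvE⟩ := ih
      refine ⟨inv x * v', hv.mul hE (hX x hx) (hgenE x hx), fun e he => ?_⟩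
      simpa only [mul_assoc] using hvE _ (hXconj x hx e he)
  exact ⟨w', hw'.conj_mem, by simpa using hconj' 1 E.one_mem, hw'.inv_mul_mem,
    hw'.mul_inv_mul, hw'.inv_mul_inv⟩
end

section
/- Let S be a monoid with group of units G = G(S), and let z ∈ S satisfy z³ = z, and suppose S is generated by G ∪ {z}. Then S is an inverse monoid with E(S) = ⟨g⁻¹ z² g : g ∈ G⟩ and with factorizable part F(S) = E(S)G(S) equal to ⟨G ∪ {z²}⟩ if and only if for all g ∈ G: (C1) g⁻¹ z² g z² = z² g⁻¹ z² g, and (C2) z g⁻¹ z² g z ∈ ⟨G ∪ {z²}⟩. -/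
/-- The submonoid generated by the conjugates of `w` by units. -/
def conjClosure {S : Type*} [Monoid S] (w : S) : Submonoid S :=
  Submonoid.closure {a : S | ∃ g : Sˣ, a = ↑g⁻¹ * w * ↑g}

section

variable {S : Type*} [Monoid S] {w z : S}

theorem self_mem_conjClosure (w : S) : w ∈ conjClosure w :=
  Submonoid.subset_closure ⟨1, by simp⟩

theorem conj_mem_conjClosure (h : Sˣ) {e : S} (he : e ∈ conjClosure w) :
    ↑h * e * ↑h⁻¹ ∈ conjClosure w := by
  induction he using Submonoid.closure_induction with
  | mem x hx =>
    obtain ⟨g, rfl⟩ := hx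
    exact Submonoid.subset_closure ⟨g * h⁻¹, by simp [mul_assoc]⟩
  | one => simp
  | mul x y _ _ hx hy =>
    have := mul_mem hx hy
    simpa [mul_assoc] using this

/-- If `w` commutes with its conjugates by units, then `conjClosure w` is commutative. -/
theorem commute_of_mem_conjClosure
    (hc : ∀ g : Sˣ, (↑g⁻¹ * w * ↑g) * w = w * (↑g⁻¹ * w * ↑g))
    {e f : S} (he : e ∈ conjClosure w) (hf : f ∈ conjClosure w) : Commute e f := by
  induction he, hf using Submonoid.closure_induction₂ with
  | mem x y hx hy =>
    obtain ⟨g, rfl⟩ := hx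
    obtain ⟨h, rfl⟩ := hy
    have := congrArg (fun t => (↑h⁻¹ : S) * t * (h : S)) (hc (g * h⁻¹))
    simpa [Commute, SemiconjBy, mul_assoc] using this
  | one_left => exact Commute.one_left _
  | one_right => exact Commute.one_right _
  | mul_left _ _ _ _ _ _ h₁ h₂ => exact h₁.mul_left h₂
  | mul_right _ _ _ _ _ _ h₁ h₂ => exact h₁.mul_right h₂

theorem isIdempotentElem_conj (hw : IsIdempotentElem w) (g : Sˣ) :
    IsIdempotentElem (↑g⁻¹ * w * ↑g : S) := by
  have := congrArg (fun t => ↑g⁻¹ * t * (g : S)) hw.eq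
  simpa [IsIdempotentElem, mul_assoc] using this

theorem isIdempotentElem_of_mem_conjClosure (hw : IsIdempotentElem w)
    (hc : ∀ g : Sˣ, (↑g⁻¹ * w * ↑g) * w = w * (↑g⁻¹ * w * ↑g))
    {e : S} (he : e ∈ conjClosure w) : IsIdempotentElem e := by
  induction he using Submonoid.closure_induction with
  | mem x hx =>
    obtain ⟨g, rfl⟩ := hx
    exact isIdempotentElem_conj hw g
  | one => exact IsIdempotentElem.one
  | mul x y hx hy ihx ihy =>
    exact IsIdempotentElem.mul_of_commute (commute_of_mem_conjClosure hc hx hy) ihx ihy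

/-- The submonoid generated by the units and `w` is the product of `conjClosure w` with the
group of units. -/
theorem mem_closure_units_union_iff {a : S} :
    a ∈ Submonoid.closure ({a : S | IsUnit a} ∪ {w}) ↔
      ∃ e ∈ conjClosure w, ∃ g : Sˣ, a = e * g := by
  constructor
  · intro ha
    induction ha using Submonoid.closure_induction with
    | mem x hx =>
      rcases hx with ⟨g, rfl⟩ | rfl
      · exact ⟨1, one_mem _, g, by simp⟩
      · exact ⟨x, self_mem_conjClosure x, 1, by simp⟩
    | one => exact ⟨1, one_mem _, 1, by simp⟩
    | mul x y _ _ hx hy =>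
      obtain ⟨e, he, g, rfl⟩ := hx
      obtain ⟨f, hf, h, rfl⟩ := hy
      exact ⟨e * (↑g * f * ↑g⁻¹), mul_mem he (conj_mem_conjClosure g hf), g * h,
        by simp [mul_assoc]⟩
  · rintro ⟨e, he, g, rfl⟩
    have unit_mem (u : Sˣ) : (u : S) ∈ Submonoid.closure ({a : S | IsUnit a} ∪ {w}) :=
      Submonoid.subset_closure (Or.inl u.isUnit)
    refine mul_mem (Submonoid.closure_le.2 ?_ he) (unit_mem g)
    rintro _ ⟨h, rfl⟩
    exact mul_mem (mul_mem (unit_mem _) (Submonoid.subset_closure (Or.inr rfl))) (unit_mem h)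

/-- An idempotent of the form `f * h`, with `f ∈ conjClosure w` and `h` a unit, lies in
`conjClosure w`. -/
theorem mem_conjClosure_of_isIdempotentElem_mul_unit (hw : IsIdempotentElem w)
    (hc : ∀ g : Sˣ, (↑g⁻¹ * w * ↑g) * w = w * (↑g⁻¹ * w * ↑g))
    {f : S} (hf : f ∈ conjClosure w) (h : Sˣ) (hx : IsIdempotentElem (f * h)) :
    f * h ∈ conjClosure w := by
  have hf' := conj_mem_conjClosure h hf
  have hcomm := (commute_of_mem_conjClosure hc hf hf').eq
  have hidem' := (isIdempotentElem_of_mem_conjClosure hw hc hf').eq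
  have hfhf : f * h * f = f := by
    have := congrArg (· * (↑h⁻¹ : S)) hx.eq
    simpa [mul_assoc] using this
  have hff'h : f * (↑h * f * ↑h⁻¹) * h = f := by simpa [mul_assoc] using hfhf
  generalize (↑h * f * ↑h⁻¹ : S) = f' at *
  have hff' : f * f' = f := by
    calc f * f' = f' * (f * f' * h) := by rw [hff'h, hcomm]
      _ = f * (f' * f') * h := by rw [← mul_assoc, ← mul_assoc, ← hcomm, mul_assoc f]
      _ = f := by rw [hidem', hff'h]
  rw [hff'] at hff'h
  rwa [hff'h]

/-- Conjugation by `z` preserves `conjClosure (z ^ 2)`. -/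
theorem mul_mul_mem_conjClosure (hz : z ^ 3 = z)
    (hc : ∀ g : Sˣ, (↑g⁻¹ * z ^ 2 * ↑g) * z ^ 2 = z ^ 2 * (↑g⁻¹ * z ^ 2 * ↑g))
    (hconj : ∀ g : Sˣ, z * (↑g⁻¹ * z ^ 2 * ↑g) * z ∈ conjClosure (z ^ 2))
    {e : S} (he : e ∈ conjClosure (z ^ 2)) : z * e * z ∈ conjClosure (z ^ 2) := by
  induction he using Submonoid.closure_induction with
  | mem x hx =>
    obtain ⟨g, rfl⟩ := hx
    exact hconj g
  | one => simpa [← sq] using self_mem_conjClosure (z ^ 2)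
  | mul x y hx _ ihx ihy =>
    have hcomm := (commute_of_mem_conjClosure hc hx (self_mem_conjClosure _)).eq
    have : z * (x * y) * z = z * x * z * (z * y * z) := by
      calc z * (x * y) * z = z ^ 3 * (x * y) * z := by rw [hz]
        _ = z * (z ^ 2 * x) * y * z := by simp only [pow_succ', mul_assoc, pow_zero, one_mul]
        _ = z * x * z * (z * y * z) := by
          rw [← hcomm]; simp only [pow_succ', mul_assoc, pow_zero, mul_one]
    rw [this]
    exact mul_mem ihx ihy

theorem isIdempotentElem_mul_mul (hz : z ^ 3 = z) {e : S} (he : IsIdempotentElem e)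
    (hcomm : e * z ^ 2 = z ^ 2 * e) : IsIdempotentElem (z * e * z) := by
  calc z * e * z * (z * e * z) = z * (e * z ^ 2) * e * z := by simp only [sq, mul_assoc]
    _ = z ^ 3 * (e * e) * z := by
      rw [hcomm]; simp only [pow_succ', mul_assoc, pow_zero, mul_one]
    _ = z * e * z := by rw [hz, he.eq]

/-- If a commutative submonoid `E` is stable under conjugation by `z` and by units, and the monoid
is generated by these, then every element has an inverse such that conjugation by the pair, in
either order, maps `E` into itself. -/
theorem exists_inverse_preserving (hz : z ^ 3 = z)
    (hgen : Submonoid.closure ({a : S | IsUnit a} ∪ {z}) = ⊤) (E : Submonoid S)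
    (hcomm : ∀ e ∈ E, ∀ f ∈ E, Commute e f)
    (hunit : ∀ g : Sˣ, ∀ e ∈ E, ↑g * e * ↑g⁻¹ ∈ E)
    (hconj : ∀ e ∈ E, z * e * z ∈ E) (a : S) :
    ∃ b : S, a * b * a = a ∧ b * a * b = b ∧
      (∀ e ∈ E, a * e * b ∈ E) ∧ (∀ e ∈ E, b * e * a ∈ E) := by
  have ha : a ∈ Submonoid.closure ({a : S | IsUnit a} ∪ {z}) := hgen ▸ Submonoid.mem_top a
  induction ha using Submonoid.closure_induction with
  | mem x hx =>
    rcases hx with ⟨g, rfl⟩ | rfl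
    · exact ⟨↑g⁻¹, by simp, by simp, hunit g, by simpa using hunit g⁻¹⟩
    · have hxxx : x * x * x = x := by simpa [pow_succ] using hz
      exact ⟨x, hxxx, hxxx, hconj, hconj⟩
  | one => exact ⟨1, by simp, by simp, by simp, by simp⟩
  | mul x y _ _ ihx ihy =>
    obtain ⟨b, hxb, hbx, hxE, hEx⟩ := ihx
    obtain ⟨c, hyc, hcy, hyE, hEy⟩ := ihy
    have hbxE : b * x ∈ E := by simpa using hEx 1 (one_mem E)
    have hycE : y * c ∈ E := by simpa using hyE 1 (one_mem E)
    have hswap := (hcomm _ hbxE _ hycE).eq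
    refine ⟨c * b, ?_, ?_, fun e he => ?_, fun e he => ?_⟩
    · calc x * y * (c * b) * (x * y) = x * (y * c * (b * x)) * y := by simp only [mul_assoc]
        _ = x * b * x * (y * c * y) := by rw [← hswap]; simp only [mul_assoc]
        _ = x * y := by rw [hxb, hyc]
    · calc c * b * (x * y) * (c * b) = c * (b * x * (y * c)) * b := by simp only [mul_assoc]
        _ = c * y * c * (b * x * b) := by rw [hswap]; simp only [mul_assoc]
        _ = c * b := by rw [hcy, hbx]
    · simpa only [mul_assoc] using hxE _ (hyE e he)
    · simpa only [mul_assoc] using hEy _ (hEx e he)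

/-- An idempotent `x` with an inverse `b` such that `x * b` and `b * x` lie in a submonoid `E` of
idempotents lies in `E` itself. -/
theorem mem_of_isIdempotentElem_of_inverse {E : Submonoid S}
    (hE : ∀ e ∈ E, IsIdempotentElem e) {x b : S} (hx : IsIdempotentElem x)
    (hxb : x * b * x = x) (hbx : b * x * b = b) (hxbE : x * b ∈ E) (hbxE : b * x ∈ E) :
    x ∈ E := by
  have hbE : b ∈ E := by
    have h : b * x * (x * b) = b := by
      rw [← mul_assoc, mul_assoc b, hx.eq, hbx]
    exact h ▸ mul_mem hbxE hxbE
  have h : x * b * (b * x) = x := by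
    rw [← mul_assoc, mul_assoc x, (hE b hbE).eq, hxb]
  exact h ▸ mul_mem hxbE hbxE

end

/-- Let `S` be a monoid with group of units `G`, and let `z ∈ S`
satisfy `z³ = z`, and suppose `S` is generated by `G ∪ {z}`.  Then `S` is an inverse
monoid with `E(S) = ⟨g⁻¹ z² g : g ∈ G⟩` and with factorizable part
`F(S) = E(S)G(S) = ⟨G ∪ {z²}⟩`, if and only if for all `g ∈ G`:
(C1) `g⁻¹ z² g z² = z² g⁻¹ z² g`, and (C2) `z g⁻¹ z² g z ∈ ⟨G ∪ {z²}⟩`. -/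
theorem stmt3 {S : Type*} [Monoid S] (z : S) (hz : z ^ 3 = z)
    (hgen : Submonoid.closure ({a : S | IsUnit a} ∪ {z}) = ⊤) :
    (IsInverseMonoid S ∧
      {a : S | IsIdempotentElem a} =
        (Submonoid.closure {a : S | ∃ g : Sˣ, a = ↑g⁻¹ * z ^ 2 * ↑g} : Set S) ∧
      {a : S | ∃ e g : S, IsIdempotentElem e ∧ IsUnit g ∧ a = e * g} =
        (Submonoid.closure ({a : S | IsUnit a} ∪ {z ^ 2}) : Set S))
  ↔ (∀ g : Sˣ,
      (↑g⁻¹ * z ^ 2 * ↑g) * z ^ 2 = z ^ 2 * (↑g⁻¹ * z ^ 2 * ↑g) ∧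
      z * ↑g⁻¹ * z ^ 2 * ↑g * z ∈ Submonoid.closure ({a : S | IsUnit a} ∪ {z ^ 2})) := by
  have hw : IsIdempotentElem (z ^ 2) := by
    rw [IsIdempotentElem, ← pow_add, show 2 + 2 = 3 + 1 from rfl, pow_succ, hz, sq]
  constructor
  · rintro ⟨⟨-, hcomm⟩, -, hF⟩ g
    have he := isIdempotentElem_conj hw g
    have hC := hcomm _ _ he hw
    refine ⟨hC, ?_⟩
    rw [← SetLike.mem_coe, ← hF]
    exact ⟨_, 1, isIdempotentElem_mul_mul hz he hC, isUnit_one, by simp only [mul_assoc, mul_one]⟩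
  · intro H
    have hc := fun g => (H g).1
    have hidem : ∀ e ∈ conjClosure (z ^ 2), IsIdempotentElem e :=
      fun e => isIdempotentElem_of_mem_conjClosure hw hc
    have hconj (g : Sˣ) : z * (↑g⁻¹ * z ^ 2 * ↑g) * z ∈ conjClosure (z ^ 2) := by
      obtain ⟨f, hf, h, hfh⟩ := mem_closure_units_union_iff.1 (H g).2
      have heq : z * (↑g⁻¹ * z ^ 2 * ↑g) * z = f * h := by
        rw [← hfh]; simp only [mul_assoc]
      have hi := isIdempotentElem_mul_mul hz (isIdempotentElem_conj hw g) (hc g)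
      rw [heq] at hi ⊢
      exact mem_conjClosure_of_isIdempotentElem_mul_unit hw hc hf h hi
    have hinv := exists_inverse_preserving hz hgen (conjClosure (z ^ 2))
      (fun e he f hf => commute_of_mem_conjClosure hc he hf)
      (fun g e he => conj_mem_conjClosure g he)
      (fun e he => mul_mul_mem_conjClosure hz hc hconj he)
    have hE (x : S) : IsIdempotentElem x ↔ x ∈ conjClosure (z ^ 2) := by
      refine ⟨fun hx => ?_, hidem x⟩
      obtain ⟨b, hxb, hbx, hxE, hEx⟩ := hinv x
      exact mem_of_isIdempotentElem_of_inverse hidem hx hxb hbx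
        (by simpa using hxE 1 (one_mem _)) (by simpa using hEx 1 (one_mem _))
    refine ⟨⟨fun a => ?_, fun e f he hf => ?_⟩, Set.ext hE, Set.ext fun a => ?_⟩
    · obtain ⟨b, hab, hba, -⟩ := hinv a
      exact ⟨b, hab, hba⟩
    · exact (commute_of_mem_conjClosure hc ((hE e).1 he) ((hE f).1 hf)).eq
    · rw [SetLike.mem_coe, mem_closure_units_union_iff]
      constructor
      · rintro ⟨e, _, he, ⟨g, rfl⟩, rfl⟩
        exact ⟨e, (hE e).1 he, g, rfl⟩
      · rintro ⟨e, he, g, rfl⟩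
        exact ⟨e, g, (hE e).2 he, g.isUnit, rfl⟩
end

section
/- Let S and T be inverse monoids, and let e ∈ E(S) be an idempotent with e ≠ 1 having property (P): for every idempotent f ≠ 1 of S there exists a unit g ∈ G(S) with g⁻¹ f g ∈ eSe. Let φ : S → T be a monoid homomorphism whose restrictions to E(S), to G(S), and to eSe are each injective. Then φ is injective. -/
/-- Semigroup inverses are unique when idempotents commute. -/
theorem IsInverseMonoid.inverse_unique {M : Type*} [Monoid M] (hM : IsInverseMonoid M)
    {a x y : M} (hx : a * x * a = a) (hx' : x * a * x = x)
    (hy : a * y * a = a) (hy' : y * a * y = y) : x = y := by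
  have h_left : x * a = y * a := by
    have comm := hM.2 (x * a) (y * a) (by rw [IsIdempotentElem, ← mul_assoc, hx'])
      (by rw [IsIdempotentElem, ← mul_assoc, hy'])
    rwa [mul_assoc, ← mul_assoc a, hy, mul_assoc y, ← mul_assoc a, hx] at comm
  have h_right : a * x = a * y := by
    have comm := hM.2 (a * x) (a * y) (by rw [IsIdempotentElem, ← mul_assoc, hx])
      (by rw [IsIdempotentElem, ← mul_assoc, hy])
    rw [← mul_assoc, hx, ← mul_assoc, hy] at comm
    exact comm.symm
  rw [← hx', h_left, mul_assoc, h_right, ← mul_assoc, hy']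

/-- If an idempotent `p` is conjugate into `eMe` and `φ` is injective on `eMe`, then the only
element of `pMp` with the same image as `p` is `p` itself. -/
theorem eq_of_map_eq_of_conj_mem_local {M N : Type*} [Monoid M] [Monoid N]
    {e p c : M} (he : IsIdempotentElem e) (φ : M →* N)
    (hloc : Set.InjOn φ {m : M | e * m * e = m})
    (g : Mˣ) (hg : e * (↑g⁻¹ * p * ↑g) * e = ↑g⁻¹ * p * ↑g)
    (hpc : p * c = c) (hcp : c * p = c) (hφ : φ c = φ p) : c = p := by
  have h_left : e * (↑g⁻¹ * p * ↑g) = ↑g⁻¹ * p * ↑g := by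
    rw [← hg, ← mul_assoc, ← mul_assoc, he.eq]
  have h_right : (↑g⁻¹ * p * ↑g) * e = ↑g⁻¹ * p * ↑g := by
    rw [← hg, mul_assoc, he.eq]
  have hc : (↑g⁻¹ * c * ↑g : M) = (↑g⁻¹ * p * ↑g) * (↑g⁻¹ * c * ↑g) := by
    simp [mul_assoc, ← mul_assoc p c, hpc]
  have hc' : (↑g⁻¹ * c * ↑g : M) = (↑g⁻¹ * c * ↑g) * (↑g⁻¹ * p * ↑g) := by
    simp [mul_assoc, ← mul_assoc c p, hcp]
  have hmem : e * (↑g⁻¹ * c * ↑g) * e = ↑g⁻¹ * c * ↑g := by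
    have h : e * (↑g⁻¹ * c * ↑g) = ↑g⁻¹ * c * ↑g := by
      rw [hc, ← mul_assoc, h_left]
    rw [h, hc', mul_assoc, h_right]
  have hconj : (↑g⁻¹ * c * ↑g : M) = ↑g⁻¹ * p * ↑g :=
    hloc hmem hg (by simp only [map_mul, hφ])
  simpa using hconj

/-- Let `S` and `T` be inverse monoids, and let `e ∈ E(S)` be an
idempotent with `e ≠ 1` having property (P): for every idempotent `f ≠ 1` of `S` there
is a unit `g` with `g⁻¹ f g ∈ eSe` (equivalently `e (g⁻¹ f g) e = g⁻¹ f g`).  If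
`φ : S → T` is a monoid homomorphism whose restrictions to the idempotents, to the
units, and to the local submonoid `eSe` are each injective, then `φ` is injective. -/
theorem stmt4 {S T : Type*} [Monoid S] [Monoid T]
    (hS : IsInverseMonoid S) (hT : IsInverseMonoid T)
    (e : S) (he : IsIdempotentElem e) (hne : e ≠ 1)
    (hP : ∀ f : S, IsIdempotentElem f → f ≠ 1 →
      ∃ g : Sˣ, e * (↑g⁻¹ * f * ↑g) * e = ↑g⁻¹ * f * ↑g)
    (φ : S →* T)
    (hE : Set.InjOn φ {a : S | IsIdempotentElem a})
    (hG : Set.InjOn φ {a : S | IsUnit a})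
    (hloc : Set.InjOn φ {m : S | e * m * e = m}) :
    Function.Injective φ := by
  intro a b hab
  obtain ⟨a', ha, ha'⟩ := hS.1 a
  obtain ⟨b', hb, hb'⟩ := hS.1 b
  have hinv : φ a' = φ b' :=
    hT.inverse_unique (a := φ a) (by simp only [← map_mul, ha]) (by simp only [← map_mul, ha'])
      (by rw [hab]; simp only [← map_mul, hb]) (by rw [hab]; simp only [← map_mul, hb'])
  have hIdem : ∀ {x y : S}, x * y * x = x → IsIdempotentElem (x * y) := fun h => by
    rw [IsIdempotentElem, ← mul_assoc, h]
  have hran : a * a' = b * b' :=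
    hE (hIdem ha) (hIdem hb) (by rw [map_mul, map_mul, hab, hinv])
  have hdom : a' * a = b' * b :=
    hE (hIdem ha') (hIdem hb') (by rw [map_mul, map_mul, hab, hinv])
  by_cases hp : a' * a = 1
  · by_cases hq : a * a' = 1
    · exact hG ⟨⟨a, a', hq, hp⟩, rfl⟩ ⟨⟨b, b', hran ▸ hq, hdom ▸ hp⟩, rfl⟩ hab
    · obtain ⟨g, hg⟩ := hP _ (hIdem ha) hq
      have h : b * a' = a * a' :=
        eq_of_map_eq_of_conj_mem_local he φ hloc g hg
          (by rw [hran, ← mul_assoc, hb]) (by rw [mul_assoc, ← mul_assoc a', ha'])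
          (by rw [map_mul, map_mul, hab])
      calc a = a * a' * a := ha.symm
        _ = b * (a' * a) := by rw [← h, mul_assoc]
        _ = b := by rw [hp, mul_one]
  · obtain ⟨g, hg⟩ := hP _ (hIdem ha') hp
    have h : a' * b = a' * a :=
      eq_of_map_eq_of_conj_mem_local he φ hloc g hg
        (by rw [← mul_assoc, ha']) (by rw [hdom, mul_assoc, ← mul_assoc b, hb])
        (by rw [map_mul, map_mul, hab])
    calc a = a * (a' * a) := by rw [← mul_assoc, ha]
      _ = b * b' * b := by rw [← h, ← mul_assoc, hran]
      _ = b := hb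
end

section
/- The monoid M_3, presented by generators x, s_1, s_2 subject to the relations s_1² = 1, s_2² = 1, (s_1 s_2)³ = 1, x³ = x, x s_1 = s_1 x = x, and x s_2 x = x s_2 x s_2 = s_2 x s_2 x = x s_2 x² = x² s_2 x, has exactly 25 elements. -/
/-- Words over the alphabet `{x, s₁, s₂}`, encoded as `FreeMonoid (Fin 3)` with
letter `0 = x`, `1 = s₁`, `2 = s₂`. -/
abbrev W3 := FreeMonoid (Fin 3)

/-- The letter `x`. -/
def xw3 : W3 := FreeMonoid.of 0
/-- The letter `s₁`. -/
def s1w3 : W3 := FreeMonoid.of 1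
/-- The letter `s₂`. -/
def s2w3 : W3 := FreeMonoid.of 2

/-- The defining relations of `M₃`: `s₁² = 1`, `s₂² = 1`, `(s₁ s₂)³ = 1`, `x³ = x`,
`x s₁ = s₁ x = x`, and `x s₂ x = x s₂ x s₂ = s₂ x s₂ x = x s₂ x² = x² s₂ x`. -/
inductive Rel3 : W3 → W3 → Prop
  | s1sq : Rel3 (s1w3 * s1w3) 1
  | s2sq : Rel3 (s2w3 * s2w3) 1
  | braid : Rel3 ((s1w3 * s2w3) ^ 3) 1
  | x3 : Rel3 (xw3 ^ 3) xw3
  | xs1 : Rel3 (xw3 * s1w3) xw3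
  | s1x : Rel3 (s1w3 * xw3) xw3
  | r4a : Rel3 (xw3 * s2w3 * xw3) (xw3 * s2w3 * xw3 * s2w3)
  | r4b : Rel3 (xw3 * s2w3 * xw3) (s2w3 * xw3 * s2w3 * xw3)
  | r4c : Rel3 (xw3 * s2w3 * xw3) (xw3 * s2w3 * xw3 ^ 2)
  | r4d : Rel3 (xw3 * s2w3 * xw3) (xw3 ^ 2 * s2w3 * xw3)

/-- The monoid `M₃`, presented by generators `x, s₁, s₂` subject to the relations
`Rel3`: the quotient of the free monoid on `{x, s₁, s₂}` by the monoid congruence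
generated by the relations. -/
abbrev M3 := (conGen Rel3).Quotient

namespace M3

/-- The class of the letter `a` in `M₃`. -/
def gen (a : Fin 3) : M3 := (conGen Rel3).mk' (FreeMonoid.of a)

lemma mk'_eq_of_rel {u v : W3} (h : Rel3 u v) :
    (conGen Rel3).mk' u = (conGen Rel3).mk' v :=
  (Con.eq _).2 (ConGen.Rel.of _ _ h)

lemma s1_mul_s1 : gen 1 * gen 1 = 1 := mk'_eq_of_rel .s1sq

lemma s2_mul_s2 : gen 2 * gen 2 = 1 := mk'_eq_of_rel .s2sq

lemma s1_mul_s2_pow : (gen 1 * gen 2) ^ 3 = 1 := mk'_eq_of_rel .braid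

lemma x_pow_three : gen 0 ^ 3 = gen 0 := mk'_eq_of_rel .x3

lemma x_mul_s1 : gen 0 * gen 1 = gen 0 := mk'_eq_of_rel .xs1

lemma s1_mul_x : gen 1 * gen 0 = gen 0 := mk'_eq_of_rel .s1x

/-- The class of `x s₂ x`, which turns out to be a zero element. -/
def zero : M3 := gen 0 * gen 2 * gen 0

lemma zero_mul_s2 : zero * gen 2 = zero := (mk'_eq_of_rel .r4a).symm

lemma s2_mul_zero : gen 2 * zero = zero := by
  simpa only [zero, mul_assoc] using
    (show zero = gen 2 * gen 0 * gen 2 * gen 0 from mk'_eq_of_rel .r4b).symm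

lemma zero_mul_x : zero * gen 0 = zero := by
  have h : zero = gen 0 * gen 2 * gen 0 ^ 2 := mk'_eq_of_rel .r4c
  rw [zero, mul_assoc, ← pow_two, ← h, zero]

lemma x_mul_zero : gen 0 * zero = zero := by
  have h : zero = gen 0 ^ 2 * gen 2 * gen 0 := mk'_eq_of_rel .r4d
  simpa only [zero, mul_assoc, pow_two] using h.symm

lemma zero_mul_s1 : zero * gen 1 = zero := by
  rw [zero, mul_assoc, x_mul_s1]

lemma s1_mul_zero : gen 1 * zero = zero := by
  rw [zero, ← mul_assoc, ← mul_assoc, s1_mul_x]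

lemma braid : gen 2 * (gen 1 * gen 2) = gen 1 * (gen 2 * gen 1) := by
  calc gen 2 * (gen 1 * gen 2)
      = gen 1 * (gen 1 * gen 2) * (gen 1 * gen 2) := by
        simp only [← mul_assoc, s1_mul_s1, one_mul]
    _ = gen 1 * (gen 1 * gen 2) * (gen 1 * gen 2) * (gen 1 * (gen 2 * gen 2) * gen 1) := by
        rw [s2_mul_s2, mul_one, s1_mul_s1, mul_one]
    _ = gen 1 * (gen 1 * gen 2) ^ 3 * (gen 2 * gen 1) := by
        simp only [pow_succ, pow_zero, one_mul, mul_assoc]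
    _ = gen 1 * (gen 2 * gen 1) := by rw [s1_mul_s2_pow, mul_one]

/-- Normal forms for the elements of `M₃`: with `g₀ = 1`, `g₁ = s₂`, `g₂ = s₁ s₂` and
`h₀ = 1`, `h₁ = s₂`, `h₂ = s₂ s₁`, these are the six units `gᵢ s₁ᵇ`, the eighteen elements
`gᵢ x hⱼ` and `gᵢ x² hⱼ`, and the zero `x s₂ x`. -/
inductive NormalForm
  | unit (i : Fin 3) (b : Bool)
  | mid (i : Fin 3) (k : Bool) (j : Fin 3)
  | zero
  deriving DecidableEq, Fintype

namespace NormalForm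

/-- The coset representative `gᵢ`. -/
def left : Fin 3 → M3 := ![1, gen 2, gen 1 * gen 2]

/-- The coset representative `hⱼ`. -/
def right : Fin 3 → M3 := ![1, gen 2, gen 2 * gen 1]

/-- The element of `M₃` represented by a normal form. -/
def val : NormalForm → M3
  | unit i b => left i * bif b then gen 1 else 1
  | mid i k j => left i * ((bif k then gen 0 * gen 0 else gen 0) * right j)
  | zero => M3.zero

/-- Right multiplication of a normal form by a letter. -/
def act : NormalForm → Fin 3 → NormalForm
  | unit i _, 0 => mid i false 0
  | unit i b, 1 => unit i !b
  | unit i false, 2 => ![unit 1 false, unit 0 false, unit 0 true] i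
  | unit i true, 2 => ![unit 2 false, unit 2 true, unit 1 true] i
  | mid i k j, 0 => if j = 0 then mid i (!k) 0 else zero
  | mid i k j, 1 => mid i k (Equiv.swap 1 2 j)
  | mid i k j, 2 => mid i k (Equiv.swap 0 1 j)
  | zero, _ => zero

lemma left_mul_zero (i : Fin 3) : left i * M3.zero = M3.zero := by
  fin_cases i <;> simp [left, mul_assoc, s1_mul_zero, s2_mul_zero]

lemma left_mul_x_mul_s2_mul_x (i : Fin 3) (k : Bool) :
    left i * ((bif k then gen 0 * gen 0 else gen 0) * (gen 2 * gen 0)) = M3.zero := by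
  have h : gen 0 * (gen 2 * gen 0) = M3.zero := (mul_assoc _ _ _).symm
  cases k <;> simp [mul_assoc, h, x_mul_zero, left_mul_zero]

lemma x_pow_mul_s1 (k : Bool) :
    (bif k then gen 0 * gen 0 else gen 0) * gen 1 = bif k then gen 0 * gen 0 else gen 0 := by
  cases k <;> simp [mul_assoc, x_mul_s1]

lemma val_mul_gen (n : NormalForm) (a : Fin 3) : n.val * gen a = (n.act a).val := by
  have hx : gen 0 * (gen 0 * gen 0) = gen 0 := by
    simpa [pow_succ, mul_assoc] using x_pow_three
  have hb : gen 1 * (gen 1 * (gen 2 * gen 1)) = gen 2 * gen 1 := by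
    rw [← mul_assoc, s1_mul_s1, one_mul]
  match n, a with
  | unit i b, 0 => cases b <;> simp [val, act, right, mul_assoc, s1_mul_x]
  | unit i b, 1 => cases b <;> simp [val, act, mul_assoc, s1_mul_s1]
  | unit i false, 2 => fin_cases i <;> simp [val, act, left, mul_assoc, s2_mul_s2]
  | unit i true, 2 => fin_cases i <;> simp [val, act, left, mul_assoc, braid, hb]
  | mid i k j, 0 =>
    fin_cases j
    · cases k <;> simp [val, act, right, mul_assoc, hx]
    · simp [val, act, right, mul_assoc, left_mul_x_mul_s2_mul_x]
    · simp [val, act, right, mul_assoc, s1_mul_x, left_mul_x_mul_s2_mul_x]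
  | mid i k j, 1 =>
    have h : Equiv.swap (1 : Fin 3) 2 0 = 0 := by decide
    fin_cases j <;> simp [val, act, right, mul_assoc, h, s1_mul_s1, x_pow_mul_s1]
  | mid i k j, 2 =>
    have h : Equiv.swap (0 : Fin 3) 1 2 = 2 := by decide
    have hk : (bif k then gen 0 * gen 0 else gen 0) * (gen 1 * (gen 2 * gen 1)) =
        (bif k then gen 0 * gen 0 else gen 0) * (gen 2 * gen 1) := by
      rw [← mul_assoc, x_pow_mul_s1]
    fin_cases j <;> simp [val, act, right, mul_assoc, h, s2_mul_s2, braid, hk]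
  | zero, 0 => exact zero_mul_x
  | zero, 1 => exact zero_mul_s1
  | zero, 2 => exact zero_mul_s2

/-- Apply an element of the opposite of the endomorphism monoid to a normal form. -/
def applyTo (f : (Function.End NormalForm)ᵐᵒᵖ) (n : NormalForm) : NormalForm := f.unop n

/-- The right action of words on normal forms. -/
def wordAct : W3 →* (Function.End NormalForm)ᵐᵒᵖ :=
  FreeMonoid.lift fun a => .op fun n => n.act a

lemma conGen_le_ker_wordAct : conGen Rel3 ≤ Con.ker wordAct := by
  refine Con.conGen_le.2 fun u v h => ?_
  suffices h' : ∀ n, applyTo (wordAct u) n = applyTo (wordAct v) n from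
    MulOpposite.unop_injective (funext h')
  cases h <;> decide

/-- The right action of `M₃` on normal forms. -/
def monoidAct : M3 →* (Function.End NormalForm)ᵐᵒᵖ :=
  (conGen Rel3).lift wordAct conGen_le_ker_wordAct

lemma monoidAct_val (n : NormalForm) : applyTo (monoidAct n.val) (unit 0 false) = n := by
  revert n
  decide

lemma val_injective : Function.Injective val :=
  Function.LeftInverse.injective (g := fun m => applyTo (monoidAct m) (unit 0 false)) monoidAct_val

lemma exists_val_eq_val_mul (w : W3) (n : NormalForm) :
    ∃ n' : NormalForm, n'.val = n.val * (conGen Rel3).mk' w := by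
  induction w using FreeMonoid.inductionOn' generalizing n with
  | one => exact ⟨n, by rw [map_one, mul_one]⟩
  | of_mul a w ih =>
    obtain ⟨n', hn'⟩ := ih (n.act a)
    refine ⟨n', ?_⟩
    rw [hn', ← val_mul_gen, map_mul, mul_assoc, gen]

lemma val_surjective : Function.Surjective val := fun m => by
  obtain ⟨w, rfl⟩ := Con.mk'_surjective m
  obtain ⟨n, hn⟩ := exists_val_eq_val_mul w (unit 0 false)
  exact ⟨n, by simpa [val, left] using hn⟩

end NormalForm

end M3

/-- The monoid `M₃` has exactly 25 elements. -/
theorem stmt7 : Nat.card M3 = 25 := by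
  rw [← Nat.card_eq_of_bijective M3.NormalForm.val
    ⟨M3.NormalForm.val_injective, M3.NormalForm.val_surjective⟩, Nat.card_eq_fintype_card]
  decide
end

section
/- For n ≥ 4, in the monoid M_n, writing T = x², the following identities hold: T² = T; T s_1 = s_1 T = T; T s_i = s_i T for all 3 ≤ i ≤ n−1; T s_2 T s_2 = s_2 T s_2 T; and T σ T σ = σ T σ T, where σ = s_2 s_3 s_1 s_2. (Thus the assignment t ↦ x², s_i ↦ s_i satisfies the defining relations of the factorizable part.) -/
/-! Words over the alphabet `{x, s₁, …, s_{n-1}}` of the presentation of the dual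
symmetric inverse monoid, encoded as `FreeMonoid (Fin n)` with letter `0 = x` and
letter `i = sᵢ` for `1 ≤ i ≤ n - 1`. -/

/-- The letter `x`. -/
def xw (n : ℕ) : FreeMonoid (Fin n) :=
  if h : 0 < n then FreeMonoid.of ⟨0, h⟩ else 1

/-- The letter `sᵢ` (for `1 ≤ i ≤ n - 1`; junk value `1` otherwise). -/
def sw (n : ℕ) (i : ℕ) : FreeMonoid (Fin n) :=
  if h : i < n then FreeMonoid.of ⟨i, h⟩ else 1

/-- The word `σ = s₂ s₃ s₁ s₂`. -/
def σw (n : ℕ) : FreeMonoid (Fin n) := sw n 2 * sw n 3 * sw n 1 * sw n 2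

/-- The exponent `m_{ij}`: `1` if `i = j`, `3` if `|i - j| = 1`, and `2` if
`|i - j| > 1`. -/
def mExp (i j : ℕ) : ℕ :=
  if i = j then 1 else if j - i = 1 ∨ i - j = 1 then 3 else 2

/-- The words `l₂ = x s₂ s₁` and `l_{i+1} = s_{i+1} lᵢ s_{i+1} sᵢ` (junk value `1`
for `i < 2`). -/
def lw (n : ℕ) : ℕ → FreeMonoid (Fin n)
  | 0 => 1
  | 1 => 1
  | 2 => xw n * sw n 2 * sw n 1
  | (i + 3) => sw n (i + 3) * lw n (i + 2) * sw n (i + 3) * sw n (i + 2)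

/-- The words `y₃ = x` and `y_{i+1} = lᵢ yᵢ sᵢ` (junk value `1` for `i < 3`). -/
def yw (n : ℕ) : ℕ → FreeMonoid (Fin n)
  | 0 => 1
  | 1 => 1
  | 2 => 1
  | 3 => xw n
  | (i + 4) => lw n (i + 3) * yw n (i + 3) * sw n (i + 3)

/-- The defining relations (R1)–(R7) of the monoid `Mₙ`.  Any relation involving a
generator `sᵢ` with `i > n - 1` is omitted (this is the role of the hypotheses
bounding the indices, and of `4 ≤ n` in (R5), which involves `s₃`). -/
inductive MRel (n : ℕ) : FreeMonoid (Fin n) → FreeMonoid (Fin n) → Prop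
  | r1 {i j : ℕ} : 1 ≤ i → i ≤ j → j ≤ n - 1 →
      MRel n ((sw n i * sw n j) ^ mExp i j) 1
  | r2 : MRel n (xw n ^ 3) (xw n)
  | r3a : MRel n (xw n * sw n 1) (xw n)
  | r3b : MRel n (sw n 1 * xw n) (xw n)
  | r4a : MRel n (xw n * sw n 2 * xw n) (xw n * sw n 2 * xw n * sw n 2)
  | r4b : MRel n (xw n * sw n 2 * xw n) (sw n 2 * xw n * sw n 2 * xw n)
  | r4c : MRel n (xw n * sw n 2 * xw n) (xw n * sw n 2 * xw n ^ 2)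
  | r4d : MRel n (xw n * sw n 2 * xw n) (xw n ^ 2 * sw n 2 * xw n)
  | r5a : 4 ≤ n →
      MRel n (xw n ^ 2 * σw n * xw n ^ 2 * σw n) (σw n * xw n ^ 2 * σw n * xw n ^ 2)
  | r5b : 4 ≤ n →
      MRel n (xw n ^ 2 * σw n * xw n ^ 2 * σw n) (xw n * sw n 2 * sw n 3 * sw n 2 * xw n)
  | r6 {i : ℕ} : 3 ≤ i → i ≤ n - 1 →
      MRel n (yw n i * sw n i * yw n i) (sw n i * yw n i * sw n i)
  | r7 {i : ℕ} : 4 ≤ i → i ≤ n - 1 →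
      MRel n (xw n * sw n i) (sw n i * xw n)

/-- The monoid congruence generated by the relations (R1)–(R7). -/
def Mcon (n : ℕ) : Con (FreeMonoid (Fin n)) := conGen (MRel n)

/-- The monoid `Mₙ` presented by generators `x, s₁, …, s_{n-1}` and relations
(R1)–(R7). -/
abbrev M (n : ℕ) := (Mcon n).Quotient

/-- The generator `x` of `Mₙ`. -/
def xm (n : ℕ) : M n := (Mcon n).mk' (xw n)

/-- The generator `sᵢ` of `Mₙ`. -/
def sm (n : ℕ) (i : ℕ) : M n := (Mcon n).mk' (sw n i)

/-- The element `σ = s₂ s₃ s₁ s₂` of `Mₙ`. -/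
def σm (n : ℕ) : M n := (Mcon n).mk' (σw n)

theorem mk'_eq_of_MRel {n : ℕ} {a b : FreeMonoid (Fin n)} (h : MRel n a b) :
    (Mcon n).mk' a = (Mcon n).mk' b :=
  (Con.eq _).2 (ConGen.Rel.of _ _ h)

/-- If `x` and an involution `s` satisfy the braid relation, then `s` commutes with `x²`. -/
theorem sq_mul_comm_of_braid {N : Type*} [Monoid N] {x s : N} (hs : s * s = 1)
    (h : x * s * x = s * x * s) : x ^ 2 * s = s * x ^ 2 := by
  calc x ^ 2 * s = x * (s * s) * x * s := by rw [hs, mul_one, sq]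
    _ = x * s * (s * x * s) := by simp only [mul_assoc]
    _ = x * s * x * s * x := by rw [← h]; simp only [mul_assoc]
    _ = s * x * (s * s) * x := by rw [h]; simp only [mul_assoc]
    _ = s * x ^ 2 := by rw [hs, mul_one, sq, mul_assoc]

/-- For `n ≥ 4`, in the monoid `Mₙ`, writing `T = x²`, the identities
`T² = T`, `T s₁ = s₁ T = T`, `T sᵢ = sᵢ T` for `3 ≤ i ≤ n - 1`,
`T s₂ T s₂ = s₂ T s₂ T`, and `T σ T σ = σ T σ T` hold (where `σ = s₂ s₃ s₁ s₂`);
thus the assignment `t ↦ x²`, `sᵢ ↦ sᵢ` satisfies the defining relations of the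
factorizable part. -/
theorem stmt8 (n : ℕ) (hn : 4 ≤ n) :
    (xm n ^ 2) * (xm n ^ 2) = xm n ^ 2 ∧
    (xm n ^ 2) * sm n 1 = xm n ^ 2 ∧
    sm n 1 * (xm n ^ 2) = xm n ^ 2 ∧
    (∀ i : ℕ, 3 ≤ i → i ≤ n - 1 → (xm n ^ 2) * sm n i = sm n i * (xm n ^ 2)) ∧
    (xm n ^ 2) * sm n 2 * (xm n ^ 2) * sm n 2 = sm n 2 * (xm n ^ 2) * sm n 2 * (xm n ^ 2) ∧
    (xm n ^ 2) * σm n * (xm n ^ 2) * σm n = σm n * (xm n ^ 2) * σm n * (xm n ^ 2) := by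
  have h2 : xm n ^ 3 = xm n := mk'_eq_of_MRel .r2
  have h3a : xm n * sm n 1 = xm n := mk'_eq_of_MRel .r3a
  have h3b : sm n 1 * xm n = xm n := mk'_eq_of_MRel .r3b
  have h4a : xm n * sm n 2 * xm n = xm n * sm n 2 * xm n * sm n 2 :=
    mk'_eq_of_MRel .r4a
  have h4b : xm n * sm n 2 * xm n = sm n 2 * xm n * sm n 2 * xm n :=
    mk'_eq_of_MRel .r4b
  have h4c : xm n * sm n 2 * xm n = xm n * sm n 2 * xm n ^ 2 :=
    mk'_eq_of_MRel .r4c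
  have h4d : xm n * sm n 2 * xm n = xm n ^ 2 * sm n 2 * xm n :=
    mk'_eq_of_MRel .r4d
  have hT : xm n ^ 2 * sm n 2 * xm n ^ 2 = xm n * sm n 2 * xm n := by
    rw [sq (xm n), ← mul_assoc, ← sq, ← h4d, mul_assoc, ← sq, ← h4c]
  refine ⟨?_, ?_, ?_, ?_, ?_, mk'_eq_of_MRel (.r5a hn)⟩
  · rw [← pow_add, pow_succ, h2, sq]
  · rw [sq, mul_assoc, h3a]
  · rw [sq, ← mul_assoc, h3b]
  · intro i hi hin
    rcases hi.eq_or_lt with rfl | hi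
    · refine sq_mul_comm_of_braid ?_ (mk'_eq_of_MRel (.r6 le_rfl hin))
      have h1 := mk'_eq_of_MRel (.r1 (n := n) (i := 3) (j := 3) (by omega) le_rfl hin)
      simpa [mExp, sm] using h1
    · have h7 : Commute (xm n) (sm n i) := mk'_eq_of_MRel (.r7 hi hin)
      exact h7.pow_left 2
  · have h : sm n 2 * (xm n * sm n 2 * xm n) = xm n * sm n 2 * xm n := by
      simpa only [mul_assoc] using h4b.symm
    rw [hT, ← h4a, mul_assoc (sm n 2), mul_assoc (sm n 2), hT, h]
end

section
/- For n ≥ 4, let F̂_n be the monoid presented by generators t, s_1, …, s_{n−1} subject to the relations (F1) (s_i s_j)^{m_ij} = 1 for 1 ≤ i ≤ j ≤ n−1, where m_ij = 1 if i = j, m_ij = 3 if |i−j| = 1, and m_ij = 2 if |i−j| > 1; (F2) t² = t; (F3) t s_1 = s_1 t = t; (F4) t s_i = s_i t for 3 ≤ i ≤ n−1; (F5) t s_2 t s_2 = s_2 t s_2 t; (F6) t σ t σ = σ t σ t, where σ = s_2 s_3 s_1 s_2. Then the monoid homomorphism F̂_n → M_n determined by t ↦ x² and s_i ↦ s_i is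 injective. -/
/-- The letter `t` of the presentation of the factorizable part (letter `0` of the
alphabet `{t, s₁, …, s_{n-1}}`). -/
def tw (n : ℕ) : FreeMonoid (Fin n) :=
  if h : 0 < n then FreeMonoid.of ⟨0, h⟩ else 1

/-- The defining relations (F1)–(F6) of the presentation `F̂ₙ` of the factorizable
part.  Any relation involving a generator `sᵢ` with `i > n - 1` is omitted (hence the
hypothesis `4 ≤ n` in (F6), which involves `s₃`). -/
inductive FRel (n : ℕ) : FreeMonoid (Fin n) → FreeMonoid (Fin n) → Prop
  | f1 {i j : ℕ} : 1 ≤ i → i ≤ j → j ≤ n - 1 →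
      FRel n ((sw n i * sw n j) ^ mExp i j) 1
  | f2 : FRel n (tw n * tw n) (tw n)
  | f3a : FRel n (tw n * sw n 1) (tw n)
  | f3b : FRel n (sw n 1 * tw n) (tw n)
  | f4 {i : ℕ} : 3 ≤ i → i ≤ n - 1 →
      FRel n (tw n * sw n i) (sw n i * tw n)
  | f5 : FRel n (tw n * sw n 2 * tw n * sw n 2) (sw n 2 * tw n * sw n 2 * tw n)
  | f6 : 4 ≤ n →
      FRel n (tw n * σw n * tw n * σw n) (σw n * tw n * σw n * tw n)

/-- The monoid congruence generated by the relations (F1)–(F6). -/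
def Fcon (n : ℕ) : Con (FreeMonoid (Fin n)) := conGen (FRel n)

/-- The monoid `F̂ₙ` presented by generators `t, s₁, …, s_{n-1}` and relations
(F1)–(F6). -/
abbrev Fhat (n : ℕ) := (Fcon n).Quotient

/-- The generator `t` of `F̂ₙ`. -/
def tf (n : ℕ) : Fhat n := (Fcon n).mk' (tw n)

/-- The generator `sᵢ` of `F̂ₙ`. -/
def sf (n : ℕ) (i : ℕ) : Fhat n := (Fcon n).mk' (sw n i)


namespace UniformBlock

open Equiv

/-! ### Partial transformations of `ℕ → Prop` by precomposition -/

open Classical in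
/-- The partial transformation `f ↦ f ∘ α` of `ℕ → Prop` with domain `P`, made total by
adjoining a sink `none`. -/
noncomputable def guardedPrecomp (P : (ℕ → Prop) → Prop) (α : ℕ → ℕ) :
    Function.End (Option (ℕ → Prop)) :=
  fun o => o.bind fun f => if P f then some (f ∘ α) else none

theorem guardedPrecomp_some (P : (ℕ → Prop) → Prop) (α : ℕ → ℕ) (f : ℕ → Prop) :
    guardedPrecomp P α (some f) = open Classical in if P f then some (f ∘ α) else none :=
  rfl

theorem guardedPrecomp_mul (P Q : (ℕ → Prop) → Prop) (α β : ℕ → ℕ) :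
    guardedPrecomp P α * guardedPrecomp Q β =
      guardedPrecomp (fun f => Q f ∧ P (f ∘ β)) (β ∘ α) := by
  funext o
  rcases o with _ | f
  · rfl
  · change guardedPrecomp P α (guardedPrecomp Q β (some f)) = _
    by_cases hQ : Q f <;> by_cases hP : P (f ∘ β) <;>
      simp [guardedPrecomp, hQ, hP, Function.comp_assoc]

theorem guardedPrecomp_congr {P Q : (ℕ → Prop) → Prop} {α β : ℕ → ℕ}
    (hPQ : ∀ f, P f ↔ Q f) (hαβ : ∀ f, P f → ∀ k, f (α k) = f (β k)) :
    guardedPrecomp P α = guardedPrecomp Q β := by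
  funext o
  rcases o with _ | f
  · rfl
  · by_cases hP : P f
    · have hcomp : f ∘ α = f ∘ β := funext (hαβ f hP)
      simp [guardedPrecomp, hP, (hPQ f).1 hP, hcomp]
    · simp [guardedPrecomp, hP, mt (hPQ f).2 hP]

theorem guardedPrecomp_true_id : guardedPrecomp (fun _ => True) id = 1 := by
  funext o
  rcases o with _ | f
  · rfl
  · exact if_pos trivial

/-- Permutations of `ℕ` act on `ℕ → Prop` by precomposition with the inverse. -/
noncomputable def permAction : Perm ℕ →* Function.End (Option (ℕ → Prop)) where
  toFun π := guardedPrecomp (fun _ => True) ⇑π⁻¹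
  map_one' := guardedPrecomp_true_id
  map_mul' π τ := by
    rw [guardedPrecomp_mul]
    exact guardedPrecomp_congr (by simp) (by simp)

theorem permAction_some (π : Perm ℕ) (f : ℕ → Prop) :
    permAction π (some f) = some (f ∘ ⇑π⁻¹) := by
  simp [permAction, guardedPrecomp]

/-! ### Coxeter relations -/

/-- The adjacent transposition of `i` and `i + 1`. -/
def adjSwap (i : ℕ) : Perm ℕ := swap i (i + 1)

theorem adjSwap_apply (i k : ℕ) :
    adjSwap i k = if k = i then i + 1 else if k = i + 1 then i else k :=
  swap_apply_def _ _ _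

theorem adjSwap_inv (i : ℕ) : (adjSwap i)⁻¹ = adjSwap i := swap_inv _ _

/-- The Coxeter relations of type `A` for the elements `a₁, …, a_{n-1}` of a monoid. -/
structure IsCoxeterFamily {N : Type*} [Monoid N] (n : ℕ) (a : ℕ → N) : Prop where
  sq : ∀ i, 1 ≤ i → i < n → a i * a i = 1
  braid : ∀ i, 1 ≤ i → i + 1 < n → a i * a (i + 1) * a i = a (i + 1) * a i * a (i + 1)
  comm : ∀ i j, 1 ≤ i → i + 1 < j → j < n → a i * a j = a j * a i

theorem isCoxeterFamily_iff_pow {N : Type*} [Monoid N] (n : ℕ) (a : ℕ → N) :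
    IsCoxeterFamily n a ↔
      ∀ i j, 1 ≤ i → i ≤ j → j < n → (a i * a j) ^ mExp i j = 1 := by
  constructor
  · intro h i j hi hij hj
    rcases Nat.lt_trichotomy (i + 1) j with hlt | rfl | hgt
    · rw [mExp, if_neg (by omega), if_neg (by omega), pow_two]
      calc a i * a j * (a i * a j) = a j * (a i * a i) * a j := by
            nth_rewrite 1 [h.comm i j hi hlt hj]
            simp only [mul_assoc]
        _ = 1 := by rw [h.sq i hi (by omega), mul_one, h.sq j (by omega) hj]
    · rw [mExp, if_neg (by omega), if_pos (by omega), pow_succ, pow_two]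
      calc a i * a (i + 1) * (a i * a (i + 1)) * (a i * a (i + 1))
          = (a i * a (i + 1) * a i) * (a (i + 1) * a i * a (i + 1)) := by
            simp only [mul_assoc]
        _ = a i * a (i + 1) * (a i * a i) * a (i + 1) * a i := by
            rw [← h.braid i hi hj]
            simp only [mul_assoc]
        _ = a i * (a (i + 1) * a (i + 1)) * a i := by
            rw [h.sq i hi (by omega)]
            simp only [mul_assoc, one_mul]
        _ = 1 := by rw [h.sq (i + 1) (by omega) hj, mul_one, h.sq i hi (by omega)]
    · obtain rfl : i = j := by omega
      rw [mExp, if_pos rfl, pow_one, h.sq i hi hj]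
  · intro h
    have hsq : ∀ i, 1 ≤ i → i < n → a i * a i = 1 := fun i hi hin => by
      simpa [mExp] using h i i hi le_rfl hin
    refine ⟨hsq, fun i hi hin => ?_, fun i j hi hij hj => ?_⟩
    · have hpow := h i (i + 1) hi (by omega) hin
      rw [mExp, if_neg (by omega), if_pos (by omega), pow_succ, pow_two] at hpow
      have hi' := hsq i hi (by omega)
      have hj' := hsq (i + 1) (by omega) hin
      have hinv : (a (i + 1) * a i * a (i + 1)) * (a (i + 1) * a i * a (i + 1)) = 1 := by
        calc _ = a (i + 1) * (a i * (a (i + 1) * a (i + 1)) * a i) * a (i + 1) := by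
              simp only [mul_assoc]
          _ = 1 := by rw [hj', mul_one, hi', mul_one, hj']
      calc a i * a (i + 1) * a i
          = a i * a (i + 1) * a i *
              ((a (i + 1) * a i * a (i + 1)) * (a (i + 1) * a i * a (i + 1))) := by
            rw [hinv, mul_one]
        _ = a i * a (i + 1) * (a i * a (i + 1)) * (a i * a (i + 1)) *
              (a (i + 1) * a i * a (i + 1)) := by simp only [mul_assoc]
        _ = _ := by rw [hpow, one_mul]
    · have hpow := h i j hi (by omega) hj
      rw [mExp, if_neg (by omega), if_neg (by omega), pow_two] at hpow
      have hi' := hsq i hi (by omega)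
      have hj' := hsq j (by omega) hj
      have hinv : (a j * a i) * (a i * a j) = 1 := by
        rw [mul_assoc, ← mul_assoc (a i), hi', one_mul, hj']
      calc a i * a j = (a j * a i) * (a i * a j) * (a i * a j) := by rw [hinv, one_mul]
        _ = a j * a i * (a i * a j * (a i * a j)) := by simp only [mul_assoc]
        _ = _ := by rw [hpow, mul_one]

theorem IsCoxeterFamily.map {N N' : Type*} [Monoid N] [Monoid N'] {n : ℕ} {a : ℕ → N}
    (h : IsCoxeterFamily n a) (F : N →* N') : IsCoxeterFamily n (fun i => F (a i)) where
  sq i hi hin := by rw [← map_mul, h.sq i hi hin, map_one]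
  braid i hi hin := by simp only [← map_mul, h.braid i hi hin]
  comm i j hi hij hj := by simp only [← map_mul, h.comm i j hi hij hj]

theorem isCoxeterFamily_adjSwap (n : ℕ) : IsCoxeterFamily n adjSwap where
  sq i _ _ := swap_mul_self _ _
  braid i _ _ := by
    ext k
    simp only [Perm.mul_apply, adjSwap_apply]
    grind
  comm i j _ hij _ := by
    ext k
    simp only [Perm.mul_apply, adjSwap_apply]
    grind

/-! ### A representation of `M n` -/

/-- The partial transformation representing `x`. -/
noncomputable def xOp : Function.End (Option (ℕ → Prop)) :=
  guardedPrecomp (fun f => f 1 = f 2)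
    (fun k => if k = 1 ∨ k = 2 then 3 else if k = 3 then 1 else k)

/-- The partial transformation representing `sᵢ`. -/
noncomputable def sOp (i : ℕ) : Function.End (Option (ℕ → Prop)) := permAction (adjSwap i)

theorem sOp_eq (i : ℕ) : sOp i = guardedPrecomp (fun _ => True)
    (fun k => if k = i then i + 1 else if k = i + 1 then i else k) := by
  change guardedPrecomp _ ⇑(adjSwap i)⁻¹ = _
  rw [adjSwap_inv]
  exact congrArg _ (funext (adjSwap_apply i))

/-- The values of the representation on letters. -/
noncomputable def wordAction (n : ℕ) : FreeMonoid (Fin n) →* Function.End (Option (ℕ → Prop)) :=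
  FreeMonoid.lift fun i => if (i : ℕ) = 0 then xOp else sOp i

theorem wordAction_xw {n : ℕ} (hn : 0 < n) : wordAction n (xw n) = xOp := by
  simp [wordAction, xw, hn]

theorem wordAction_sw {n i : ℕ} (hi : 1 ≤ i) (hin : i < n) :
    wordAction n (sw n i) = sOp i := by
  simp [wordAction, sw, hin, Nat.ne_of_gt hi]

theorem wordAction_lw {n i : ℕ} (hi : 2 ≤ i) (hin : i < n) :
    wordAction n (lw n i) = guardedPrecomp (fun f => f i = f (i + 1))
      (fun k => if 2 ≤ k ∧ k ≤ i + 1 then k - 1 else k) := by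
  induction i, hi using Nat.le_induction with
  | base =>
    rw [lw, map_mul, map_mul, wordAction_xw (by omega), wordAction_sw (by omega) hin,
      wordAction_sw le_rfl (by omega), xOp, sOp_eq, sOp_eq, guardedPrecomp_mul,
      guardedPrecomp_mul]
    apply guardedPrecomp_congr
    · intro f
      simp [Function.comp_def]
    · intro f hf k
      simp only [Function.comp_def] at hf ⊢
      grind
  | succ i hi ih =>
    obtain ⟨j, rfl⟩ : ∃ j, i = j + 2 := ⟨i - 2, by omega⟩
    rw [lw, map_mul, map_mul, map_mul, ih (by omega), wordAction_sw (by omega) hin,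
      wordAction_sw (by omega) (by omega), sOp_eq, sOp_eq, guardedPrecomp_mul,
      guardedPrecomp_mul, guardedPrecomp_mul]
    apply guardedPrecomp_congr
    · intro f
      simp [Function.comp_def]
    · intro f hf k
      simp only [Function.comp_def] at hf ⊢
      grind

theorem wordAction_yw {n i : ℕ} (hi : 3 ≤ i) (hin : i ≤ n) :
    wordAction n (yw n i) = guardedPrecomp (fun f => ∀ k, 1 ≤ k → k < i → f k = f 1)
      (fun k => if 1 ≤ k ∧ k < i then i else if k = i then 1 else k) := by
  induction i, hi using Nat.le_induction with
  | base =>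
    rw [yw, wordAction_xw (by omega), xOp]
    apply guardedPrecomp_congr
    · intro f
      constructor
      · intro h k hk hk'
        obtain rfl | rfl : k = 1 ∨ k = 2 := by omega
        exacts [rfl, h.symm]
      · exact fun h => (h 2 (by omega) (by omega)).symm
    · intro f hf k
      grind
  | succ i hi ih =>
    obtain ⟨j, rfl⟩ : ∃ j, i = j + 3 := ⟨i - 3, by omega⟩
    rw [yw, map_mul, map_mul, ih (by omega), wordAction_sw (by omega) (by omega),
      wordAction_lw (by omega) (by omega), sOp_eq, guardedPrecomp_mul, guardedPrecomp_mul]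
    apply guardedPrecomp_congr
    · intro f
      simp only [Function.comp_def]
      constructor
      · rintro ⟨-, h, h'⟩ k hk hk'
        have := h k hk
        grind
      · intro h
        refine ⟨trivial, fun k hk hk' => ?_, ?_⟩
        · have := h k hk (by omega)
          grind
        · have := h (j + 3) (by omega) (by omega)
          grind
    · rintro f ⟨-, h, h'⟩ k
      simp only [Function.comp_def] at h h' ⊢
      grind

theorem xOp_sq : xOp * xOp = guardedPrecomp (fun f => f 1 = f 2) id := by
  rw [xOp, guardedPrecomp_mul]
  apply guardedPrecomp_congr
  · simp
  · intro f hf k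
    simp only [Function.comp_def] at hf ⊢
    grind

theorem wordAction_yw_braid {n i : ℕ} (hi : 3 ≤ i) (hin : i < n) :
    wordAction n (yw n i * sw n i * yw n i) = wordAction n (sw n i * yw n i * sw n i) := by
  rw [map_mul, map_mul, map_mul, map_mul, wordAction_yw hi (by omega),
    wordAction_sw (by omega) (by omega), sOp_eq, guardedPrecomp_mul, guardedPrecomp_mul,
    guardedPrecomp_mul, guardedPrecomp_mul]
  have hi0 : 1 < i := by omega
  have hi1 : 1 ≠ i := by omega
  have hi2 : i ≠ 0 := by omega
  have hconst : ∀ f : ℕ → Prop, (∀ k, 1 ≤ k → k < i →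
      f (if k = i then i + 1 else if k = i + 1 then i else k) =
        f (if 1 = i then i + 1 else if 1 = i + 1 then i else 1)) ↔
      ∀ k, 1 ≤ k → k < i → f k = f 1 := by
    intro f
    refine forall_congr' fun k => imp_congr_right fun _ => imp_congr_right fun hk => ?_
    rw [if_neg (by omega), if_neg (by omega), if_neg (by omega), if_neg (by omega)]
  apply guardedPrecomp_congr
  · intro f
    simp only [Function.comp_def, true_and, and_true]
    rw [hconst, hconst (fun k => f (if 1 ≤ k ∧ k < i then i else if k = i then 1 else k)),
      and_iff_left_iff_imp]
    intro _ k hk hk'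
    rw [if_pos ⟨hk, hk'⟩, if_pos ⟨le_rfl, hi0⟩]
  · rintro f ⟨h, -, -⟩ k
    simp only [Function.comp_def]
    by_cases hk : 1 ≤ k ∧ k < i
    · have hk1 : k ≠ i := by omega
      have hk2 : k ≠ i + 1 := by omega
      simp [hk, hk1, hk2]
    · by_cases hk1 : k = i
      · subst hk1
        simp [hi0, hi1, hi2]
      · by_cases hk2 : k = i + 1
        · subst hk2
          simp [hi1, hi2]
        · simp [hk, hk1, hk2]

theorem wordAction_σw {n : ℕ} (hn : 4 ≤ n) :
    wordAction n (σw n) = guardedPrecomp (fun _ => True)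
      (fun k => if k = 1 then 3 else if k = 2 then 4 else if k = 3 then 1 else
        if k = 4 then 2 else k) := by
  rw [σw, map_mul, map_mul, map_mul, wordAction_sw (by omega) (by omega),
    wordAction_sw (by omega) (by omega), wordAction_sw (by omega) (by omega), sOp_eq, sOp_eq,
    sOp_eq, guardedPrecomp_mul, guardedPrecomp_mul, guardedPrecomp_mul]
  apply guardedPrecomp_congr
  · simp
  · intro f _ k
    rcases k with _ | _ | _ | _ | _ | k <;> simp

theorem wordAction_eq_of_MRel {n : ℕ} (hn : 4 ≤ n) {v w : FreeMonoid (Fin n)}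
    (h : MRel n v w) : wordAction n v = wordAction n w := by
  cases h with
  | @r1 i j hi hij hj =>
    rw [map_pow, map_mul, wordAction_sw hi (by omega), wordAction_sw (by omega) (by omega),
      map_one]
    exact (isCoxeterFamily_iff_pow n _).1 ((isCoxeterFamily_adjSwap n).map permAction) i j hi hij
      (by omega)
  | @r6 i hi hin => exact wordAction_yw_braid hi (by omega)
  | @r7 i hi hin =>
    rw [map_mul, map_mul, wordAction_xw (by omega), wordAction_sw (by omega) (by omega), xOp,
      sOp_eq, guardedPrecomp_mul, guardedPrecomp_mul]
    apply guardedPrecomp_congr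
    · intro f
      simp only [Function.comp_def]
      grind
    · intro f hf k
      simp only [Function.comp_def] at hf ⊢
      grind
  | r5a _ | r5b _ =>
    simp only [map_mul, wordAction_σw hn, wordAction_xw (show 0 < n by omega),
      wordAction_sw (show 1 ≤ 2 by omega) (show 2 < n by omega),
      wordAction_sw (show 1 ≤ 3 by omega) (show 3 < n by omega), pow_two, xOp_sq, sOp_eq]
    simp only [xOp, guardedPrecomp_mul]
    apply guardedPrecomp_congr
    · intro f
      simp [Function.comp_def]
      tauto
    · intro f hf k
      simp [Function.comp_def] at hf
      rcases k with _ | _ | _ | _ | _ | k <;> simp [Function.comp_def] <;> tauto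
  | _ =>
    simp only [map_mul, wordAction_xw (show 0 < n by omega),
      wordAction_sw (show 1 ≤ 1 by omega) (show 1 < n by omega),
      wordAction_sw (show 1 ≤ 2 by omega) (show 2 < n by omega), pow_succ, pow_zero, one_mul,
      xOp_sq, sOp_eq]
    simp only [xOp, guardedPrecomp_mul]
    apply guardedPrecomp_congr
    · intro f
      simp [Function.comp_def] <;> tauto
    · intro f hf k
      simp [Function.comp_def] at hf
      rcases k with _ | _ | _ | _ | k <;> simp [Function.comp_def] <;> tauto

/-- The representation of `M n` by partial transformations of `ℕ → Prop`. -/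
noncomputable def monoidAction {n : ℕ} (hn : 4 ≤ n) :
    M n →* Function.End (Option (ℕ → Prop)) :=
  (Mcon n).lift (wordAction n) (Con.conGen_le.2 fun _ _ h => wordAction_eq_of_MRel hn h)

theorem monoidAction_mk {n : ℕ} (hn : 4 ≤ n) (w : FreeMonoid (Fin n)) :
    monoidAction hn ((Mcon n).mk' w) = wordAction n w :=
  rfl

/-! ### The symmetric group as a Coxeter group -/

section Coxeter

variable {N : Type*} [Monoid N]

/-- The product `a_{j+k-1} ⋯ a_{j+1} a_j`. -/
def descProd (a : ℕ → N) (j : ℕ) : ℕ → N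
  | 0 => 1
  | k + 1 => a (j + k) * descProd a j k

theorem descProd_succ_right (a : ℕ → N) (j k : ℕ) :
    descProd a j (k + 1) = descProd a (j + 1) k * a j := by
  induction k with
  | zero => simp [descProd]
  | succ k ih => rw [descProd, ih, descProd, mul_assoc, show j + (k + 1) = j + 1 + k by omega]

variable {n : ℕ} {a : ℕ → N}

theorem IsCoxeterFamily.descProd_mul_of_lt (ha : IsCoxeterFamily n a) {i j k : ℕ} (hi : 1 ≤ i)
    (hij : i + 1 < j) (hk : j + k ≤ n) : descProd a j k * a i = a i * descProd a j k := by
  induction k with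
  | zero => simp [descProd]
  | succ k ih =>
    rw [descProd, mul_assoc, ih (by omega), ← mul_assoc, ← mul_assoc,
      ha.comm i (j + k) hi (by omega) (by omega)]

theorem IsCoxeterFamily.descProd_mul_of_gt (ha : IsCoxeterFamily n a) {i j k : ℕ} (hj : 1 ≤ j)
    (hij : j + k < i) (hi : i < n) : descProd a j k * a i = a i * descProd a j k := by
  induction k with
  | zero => simp [descProd]
  | succ k ih =>
    rw [descProd, mul_assoc, ih (by omega), ← mul_assoc, ← mul_assoc,
      ha.comm (j + k) i (by omega) (by omega) hi]

theorem IsCoxeterFamily.descProd_mul_succ (ha : IsCoxeterFamily n a) {i j k : ℕ} (hj : 1 ≤ j)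
    (hji : j ≤ i) (hik : i + 1 < j + k) (hk : j + k ≤ n) :
    descProd a j k * a (i + 1) = a i * descProd a j k := by
  induction k with
  | zero => omega
  | succ k ih =>
    by_cases hlt : i + 1 < j + k
    · rw [descProd, mul_assoc, ih hlt (by omega), ← mul_assoc, ← mul_assoc,
        ha.comm i (j + k) (by omega) hlt (by omega)]
    · obtain ⟨l, rfl⟩ : ∃ l, k = l + 1 := ⟨k - 1, by omega⟩
      obtain rfl : i = j + l := by omega
      rw [descProd, descProd, mul_assoc, mul_assoc,
        ha.descProd_mul_of_gt hj (by omega) (by omega), ← mul_assoc, ← mul_assoc, ← mul_assoc,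
        ← mul_assoc, ← add_assoc, ha.braid (j + l) (by omega) (by omega)]

/-- The submonoid generated by `a₁, …, a_{m-1}`. -/
def parabolic (a : ℕ → N) (m : ℕ) : Submonoid N :=
  Submonoid.closure {g | ∃ i, 1 ≤ i ∧ i < m ∧ g = a i}

theorem mem_parabolic {m i : ℕ} (hi : 1 ≤ i) (him : i < m) : a i ∈ parabolic a m :=
  Submonoid.subset_closure ⟨i, hi, him, rfl⟩

theorem parabolic_mono {m m' : ℕ} (h : m ≤ m') : parabolic a m ≤ parabolic a m' :=
  Submonoid.closure_mono fun _ ⟨i, hi, him, hg⟩ => ⟨i, hi, him.trans_le h, hg⟩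

theorem descProd_mem_parabolic {m j k : ℕ} (hj : 1 ≤ j) (hk : j + k ≤ m) :
    descProd a j k ∈ parabolic a m := by
  induction k with
  | zero => exact one_mem _
  | succ k ih => exact mul_mem (mem_parabolic (by omega) (by omega)) (ih (by omega))

theorem IsCoxeterFamily.exists_eq_mul_descProd (ha : IsCoxeterFamily n a) {m : ℕ}
    (hm : m + 1 ≤ n) {g : N} (hg : g ∈ parabolic a (m + 1)) :
    ∃ g₀ ∈ parabolic a m, ∃ j k, 1 ≤ j ∧ j + k = m + 1 ∧ g = g₀ * descProd a j k := by
  induction hg using Submonoid.closure_induction_right with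
  | one => exact ⟨1, one_mem _, m + 1, 0, by omega, rfl, by simp [descProd]⟩
  | mul_right x _ y hy ih =>
    obtain ⟨i, hi, him, rfl⟩ := hy
    obtain ⟨g₀, hg₀, j, k, hj, hjk, rfl⟩ := ih
    rcases Nat.lt_trichotomy (i + 1) j with hlt | rfl | hgt
    · refine ⟨g₀ * a i, mul_mem hg₀ (mem_parabolic hi (by omega)), j, k, hj, hjk, ?_⟩
      rw [mul_assoc, ha.descProd_mul_of_lt hi hlt (by omega), mul_assoc]
    · refine ⟨g₀, hg₀, i, k + 1, hi, by omega, ?_⟩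
      rw [descProd_succ_right, mul_assoc]
    · rcases Nat.lt_or_ge j i with hji | hij
      · obtain ⟨l, rfl⟩ : ∃ l, i = l + 1 := ⟨i - 1, by omega⟩
        refine ⟨g₀ * a l, mul_mem hg₀ (mem_parabolic (by omega) (by omega)), j, k, hj, hjk, ?_⟩
        rw [mul_assoc, ha.descProd_mul_succ hj (by omega) (by omega) (by omega), mul_assoc]
      · obtain rfl : i = j := by omega
        obtain ⟨l, rfl⟩ : ∃ l, k = l + 1 := ⟨k - 1, by omega⟩
        refine ⟨g₀, hg₀, i + 1, l, by omega, by omega, ?_⟩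
        rw [descProd_succ_right, mul_assoc, mul_assoc, ha.sq i hi (by omega), mul_one]

theorem descProd_adjSwap_apply (j k : ℕ) : descProd adjSwap j k j = j + k := by
  induction k with
  | zero => rfl
  | succ k ih => rw [descProd, Perm.mul_apply, ih, adjSwap_apply, if_pos rfl, add_assoc]

/-- The adjacent transpositions paired with the elements `aᵢ`. -/
def swapPair (a : ℕ → N) (i : ℕ) : Perm ℕ × N := (adjSwap i, a i)

theorem IsCoxeterFamily.swapPair (ha : IsCoxeterFamily n a) :
    IsCoxeterFamily n (swapPair a) where
  sq i hi hin := Prod.ext ((isCoxeterFamily_adjSwap n).sq i hi hin) (ha.sq i hi hin)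
  braid i hi hin := Prod.ext ((isCoxeterFamily_adjSwap n).braid i hi hin) (ha.braid i hi hin)
  comm i j hi hij hj :=
    Prod.ext ((isCoxeterFamily_adjSwap n).comm i j hi hij hj) (ha.comm i j hi hij hj)

theorem descProd_swapPair_fst (a : ℕ → N) (j k : ℕ) :
    (descProd (swapPair a) j k).1 = descProd adjSwap j k := by
  induction k with
  | zero => rfl
  | succ k ih => rw [descProd, descProd, Prod.fst_mul, ih, swapPair]

theorem fst_apply_of_mem_parabolic {m : ℕ} {g : Perm ℕ × N}
    (hg : g ∈ parabolic (swapPair a) m) {k : ℕ} (hk : ¬(1 ≤ k ∧ k ≤ m)) : g.1 k = k := by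
  induction hg using Submonoid.closure_induction with
  | mem x hx =>
    obtain ⟨i, hi, him, rfl⟩ := hx
    rw [swapPair, adjSwap_apply, if_neg (by omega), if_neg (by omega)]
  | one => rfl
  | mul x y _ _ hx hy => rw [Prod.fst_mul, Perm.mul_apply, hy, hx]

theorem IsCoxeterFamily.eq_one_of_fst_eq_one (ha : IsCoxeterFamily n a) {m : ℕ} (hm : m ≤ n)
    {g : Perm ℕ × N} (hg : g ∈ parabolic (UniformBlock.swapPair a) m) (h1 : g.1 = 1) :
    g = 1 := by
  induction m generalizing g with
  | zero =>
    have hempty : {g | ∃ i, 1 ≤ i ∧ i < 0 ∧ g = UniformBlock.swapPair a i} = ∅ := by simp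
    rwa [parabolic, hempty, Submonoid.closure_empty, Submonoid.mem_bot] at hg
  | succ m ih =>
    obtain ⟨g₀, hg₀, j, k, hj, hjk, rfl⟩ := ha.swapPair.exists_eq_mul_descProd hm hg
    have hval : (g₀ * descProd (UniformBlock.swapPair a) j k).1 j = m + 1 := by
      rw [Prod.fst_mul, Perm.mul_apply, descProd_swapPair_fst, descProd_adjSwap_apply, hjk,
        fst_apply_of_mem_parabolic hg₀ (by omega)]
    rw [h1, Perm.one_apply] at hval
    obtain rfl : k = 0 := by omega
    rw [descProd, mul_one] at h1 ⊢
    exact ih (by omega) hg₀ h1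

theorem exists_mem_parabolic (a : ℕ → N) {m : ℕ} {π : Perm ℕ}
    (hπ : ∀ k, ¬(1 ≤ k ∧ k ≤ m) → π k = k) : ∃ g, (π, g) ∈ parabolic (swapPair a) m := by
  induction m generalizing π with
  | zero =>
    obtain rfl : π = 1 := Equiv.ext fun k => hπ k (by omega)
    exact ⟨1, one_mem _⟩
  | succ m ih =>
    obtain ⟨j, hj⟩ := π.surjective (m + 1)
    have hjm : 1 ≤ j ∧ j ≤ m + 1 := by
      by_contra hcon
      have := hπ j hcon
      omega
    obtain ⟨k, hk⟩ : ∃ k, j + k = m + 1 := ⟨m + 1 - j, by omega⟩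
    have hmem : descProd (swapPair a) j k ∈ parabolic (swapPair a) (m + 1) :=
      descProd_mem_parabolic hjm.1 hk.le
    set d := descProd (swapPair a) j k with hd
    have hdj : d.1 j = m + 1 := by
      rw [hd, descProd_swapPair_fst, descProd_adjSwap_apply, hk]
    obtain ⟨g₀, hg₀⟩ := @ih (π * d.1⁻¹) fun l hl => by
      rw [Perm.mul_apply]
      by_cases hlm : l = m + 1
      · rw [hlm, Perm.inv_eq_iff_eq.2 hdj.symm, hj]
      · rw [Perm.inv_eq_iff_eq.2 (fst_apply_of_mem_parabolic hmem (k := l) (by omega)).symm,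
          hπ l (by omega)]
    refine ⟨g₀ * d.2, ?_⟩
    have := mul_mem (parabolic_mono m.le_succ hg₀) hmem
    rwa [← Prod.mk.eta (p := d), Prod.mk_mul_mk, inv_mul_cancel_right] at this

theorem IsCoxeterFamily.snd_unique (ha : IsCoxeterFamily n a) {π : Perm ℕ} {g g' : N}
    (hg : (π, g) ∈ parabolic (UniformBlock.swapPair a) n)
    (hg' : (π, g') ∈ parabolic (UniformBlock.swapPair a) n) : g = g' := by
  obtain ⟨h, hh⟩ := exists_mem_parabolic a (π := π⁻¹) (m := n) fun k hk =>
    Perm.inv_eq_iff_eq.2 (fst_apply_of_mem_parabolic hg hk).symm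
  have hright := congrArg Prod.snd
    (ha.eq_one_of_fst_eq_one le_rfl (mul_mem hg hh) (mul_inv_cancel π))
  have hleft := congrArg Prod.snd
    (ha.eq_one_of_fst_eq_one le_rfl (mul_mem hh hg') (inv_mul_cancel π))
  exact left_inv_eq_right_inv hright hleft

/-- The points `1, …, n`. -/
abbrev Point (n : ℕ) : Type := {k : ℕ // 1 ≤ k ∧ k ≤ n}

/-- Elements of a monoid satisfying the Coxeter relations of type `A` define a homomorphism
from the symmetric group. -/
theorem IsCoxeterFamily.exists_permHom (ha : IsCoxeterFamily n a) :
    ∃ ρ : Perm (Point n) →* N,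
      (∀ i (hi : 1 ≤ i) (hin : i < n),
        ρ (swap ⟨i, hi, hin.le⟩ ⟨i + 1, by omega, hin⟩) = a i) ∧
      ∀ π, (Perm.ofSubtype π, ρ π) ∈ parabolic (UniformBlock.swapPair a) n := by
  have hex : ∀ π : Perm (Point n), ∃ g,
      (Perm.ofSubtype π, g) ∈ parabolic (UniformBlock.swapPair a) n := fun π =>
    exists_mem_parabolic a fun k hk => Perm.ofSubtype_apply_of_not_mem π hk
  choose r hr using hex
  have hone : r 1 = 1 := by
    refine ha.snd_unique (hr 1) ?_
    rw [map_one]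
    exact one_mem _
  have hmul : ∀ π τ, r (π * τ) = r π * r τ := by
    intro π τ
    refine ha.snd_unique (hr (π * τ)) ?_
    rw [map_mul, ← Prod.mk_mul_mk]
    exact mul_mem (hr π) (hr τ)
  refine ⟨⟨⟨r, hone⟩, hmul⟩, ?_, hr⟩
  intro i hi hin
  refine ha.snd_unique (hr _) ?_
  have hswap : Perm.ofSubtype (p := fun k => 1 ≤ k ∧ k ≤ n)
      (swap ⟨i, hi, hin.le⟩ ⟨i + 1, by omega, hin⟩) = adjSwap i :=
    Perm.ofSubtype_swap_eq _ _
  rw [hswap]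
  exact mem_parabolic (a := UniformBlock.swapPair a) hi hin

end Coxeter

/-! ### Join idempotents indexed by pairs of points -/

section Join

variable {X : Type*} {N : Type*} [Monoid N]

/-- The product of the idempotents indexed by a list of pairs. -/
def joinProd (e : X → X → N) (L : List (X × X)) : N := (L.map fun p => e p.1 p.2).prod

theorem joinProd_cons (e : X → X → N) (p : X × X) (L : List (X × X)) :
    joinProd e (p :: L) = e p.1 p.2 * joinProd e L := by
  simp [joinProd]

/-- The equivalence relation generated by a list of pairs. -/
def joinSetoid (L : List (X × X)) : Setoid X := Relation.EqvGen.setoid fun a b => (a, b) ∈ L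

theorem joinSetoid_of_mem {L : List (X × X)} {p : X × X} (hp : p ∈ L) :
    joinSetoid L p.1 p.2 :=
  Relation.EqvGen.rel _ _ hp

variable [DecidableEq X]

/-- A permutation preserving every class of an equivalence relation is a product of
transpositions within the classes. -/
theorem perm_mem_closure_swap [Finite X] (r : Setoid X) (σ : Perm X) (hσ : ∀ a, r a (σ a)) :
    σ ∈ Submonoid.closure {τ : Perm X | ∃ a b, r a b ∧ τ = swap a b} := by
  have := Fintype.ofFinite X
  induction hs : σ.support.card using Nat.strong_induction_on generalizing σ with
  | _ m ih =>
    by_cases h1 : σ = 1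
    · exact h1 ▸ one_mem _
    obtain ⟨a, ha⟩ : ∃ a, σ a ≠ a := by
      by_contra! hcon
      exact h1 (Equiv.ext hcon)
    have hlt : (swap a (σ a) * σ).support.card < m := hs ▸ Perm.card_support_swap_mul ha
    have hmem := ih _ hlt (swap a (σ a) * σ) (fun b => by
      rw [Perm.mul_apply, swap_apply_def]
      split_ifs with hba hb
      · exact r.trans (hσ b) (hba ▸ hσ a)
      · exact σ.injective hb ▸ r.refl _
      · exact hσ b) rfl
    have hswap : swap a (σ a) ∈ Submonoid.closure {τ : Perm X | ∃ a b, r a b ∧ τ = swap a b} :=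
      Submonoid.subset_closure ⟨a, σ a, hσ a, rfl⟩
    have hprod := mul_mem hswap hmem
    rwa [← mul_assoc, swap_mul_self, one_mul] at hprod

/-- A family of commuting idempotents `e a b` which is equivariant under the symmetric group
and absorbs transpositions. -/
structure IsJoinFamily (ρ : Perm X →* N) (e : X → X → N) : Prop where
  self : ∀ a, e a a = 1
  idem : ∀ a b, e a b * e a b = e a b
  symm : ∀ a b, e a b = e b a
  comm : ∀ a b c d, e a b * e c d = e c d * e a b
  conj : ∀ π a b, ρ π * e a b = e (π a) (π b) * ρ π
  absorb : ∀ a b, e a b * ρ (swap a b) = e a b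

namespace IsJoinFamily

variable {ρ : Perm X →* N} {e : X → X → N}

theorem triangle (h : IsJoinFamily ρ e) {a b c : X} :
    e a b * e b c * e a c = e a b * e b c := by
  by_cases hbc : c = b
  · subst hbc
    rw [h.self, mul_one, h.idem]
  by_cases hac : c = a
  · subst hac
    rw [h.self, mul_one]
  have hprod : e a b * e b c = e a c * e a b := by
    conv_lhs => rw [← h.absorb a b, mul_assoc, h.conj, swap_apply_right,
      swap_apply_of_ne_of_ne hac hbc, ← mul_assoc, h.comm, mul_assoc, h.absorb]
  rw [hprod, mul_assoc, h.comm a b, ← mul_assoc, h.idem]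

theorem joinProd_mul_comm (h : IsJoinFamily ρ e) (L : List (X × X)) (a b : X) :
    joinProd e L * e a b = e a b * joinProd e L := by
  induction L with
  | nil => simp [joinProd]
  | cons p L ih => rw [joinProd_cons, mul_assoc, ih, ← mul_assoc, h.comm, mul_assoc]

theorem perm_mul_joinProd (h : IsJoinFamily ρ e) (π : Perm X) (L : List (X × X)) :
    ρ π * joinProd e L = joinProd e (L.map (Prod.map π π)) * ρ π := by
  induction L with
  | nil => simp [joinProd]
  | cons p L ih =>
    rw [List.map_cons, joinProd_cons, joinProd_cons, ← mul_assoc, h.conj, mul_assoc, ih,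
      ← mul_assoc]
    rfl

theorem joinProd_mul_of_joinSetoid (h : IsJoinFamily ρ e) {L : List (X × X)} {a b : X}
    (hab : joinSetoid L a b) : joinProd e L * e a b = joinProd e L := by
  induction hab with
  | rel a b hmem =>
    induction L with
    | nil => simp at hmem
    | cons p L ih =>
      rcases List.mem_cons.1 hmem with rfl | hmem
      · rw [joinProd_cons, mul_assoc, h.joinProd_mul_comm, ← mul_assoc, h.idem]
      · rw [joinProd_cons, mul_assoc, ih hmem]
  | refl a => rw [h.self, mul_one]
  | symm a b _ ih => rw [h.symm, ih]
  | trans a b c _ _ hab hbc =>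
    calc joinProd e L * e a c = joinProd e L * (e a b * e b c * e a c) := by
          rw [← mul_assoc, ← mul_assoc, hab, hbc]
      _ = joinProd e L := by rw [h.triangle, ← mul_assoc, hab, hbc]

theorem joinProd_mul_joinProd (h : IsJoinFamily ρ e) {L L' : List (X × X)}
    (hL : ∀ p ∈ L', joinSetoid L p.1 p.2) :
    joinProd e L * joinProd e L' = joinProd e L := by
  induction L' with
  | nil => simp [joinProd]
  | cons p L' ih =>
    rw [joinProd_cons, ← mul_assoc, h.joinProd_mul_of_joinSetoid (hL p (by simp)),
      ih fun q hq => hL q (by simp [hq])]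

theorem joinProd_comm (h : IsJoinFamily ρ e) (L L' : List (X × X)) :
    joinProd e L * joinProd e L' = joinProd e L' * joinProd e L := by
  induction L with
  | nil => simp [joinProd]
  | cons p L ih => rw [joinProd_cons, mul_assoc, ih, ← mul_assoc, ← mul_assoc, h.joinProd_mul_comm]

theorem joinProd_eq (h : IsJoinFamily ρ e) {L L' : List (X × X)}
    (hL : ∀ p ∈ L', joinSetoid L p.1 p.2) (hL' : ∀ p ∈ L, joinSetoid L' p.1 p.2) :
    joinProd e L = joinProd e L' := by
  rw [← h.joinProd_mul_joinProd hL, h.joinProd_comm, h.joinProd_mul_joinProd hL']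

theorem joinProd_mul_perm [Finite X] (h : IsJoinFamily ρ e) {L : List (X × X)} {σ : Perm X}
    (hσ : ∀ a, joinSetoid L a (σ a)) : joinProd e L * ρ σ = joinProd e L := by
  have hmem := perm_mem_closure_swap (joinSetoid L) σ hσ
  clear hσ
  induction hmem using Submonoid.closure_induction with
  | mem τ hτ =>
    obtain ⟨a, b, hab, rfl⟩ := hτ
    rw [← h.joinProd_mul_of_joinSetoid hab, mul_assoc, h.absorb]
  | one => rw [map_one, mul_one]
  | mul σ τ _ _ hσ hτ => rw [map_mul, ← mul_assoc, hσ, hτ]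

end IsJoinFamily

/-! ### Join idempotents as conjugates of a single one -/

theorem swap_mul_apply_left (π : Perm X) (x y : X) : (swap (π x) y * π) x = y := by
  simp

theorem swap_mul_apply_of_ne (π : Perm X) {x y z : X} (hzx : z ≠ x) (hzy : π z ≠ y) :
    (swap (π x) y * π) z = π z := by
  rw [Perm.mul_apply, swap_apply_of_ne_of_ne (π.injective.ne hzx) hzy]

theorem exists_perm_apply_two {p q a b : X} (hpq : p ≠ q) (hab : a ≠ b) :
    ∃ π : Perm X, π p = a ∧ π q = b := by
  have hp := swap_mul_apply_left (1 : Perm X) p a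
  set π := swap ((1 : Perm X) p) a * 1
  exact ⟨swap (π q) b * π, by rw [swap_mul_apply_of_ne π hpq (hp ▸ hab), hp],
    swap_mul_apply_left π q b⟩

theorem exists_perm_apply_three {p q r a b c : X} (hpq : p ≠ q) (hpr : p ≠ r) (hqr : q ≠ r)
    (hab : a ≠ b) (hac : a ≠ c) (hbc : b ≠ c) : ∃ π : Perm X, π p = a ∧ π q = b ∧ π r = c := by
  obtain ⟨π, hp, hq⟩ := exists_perm_apply_two hpq hab
  exact ⟨swap (π r) c * π, by rw [swap_mul_apply_of_ne π hpr (hp ▸ hac), hp],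
    by rw [swap_mul_apply_of_ne π hqr (hq ▸ hbc), hq], swap_mul_apply_left π r c⟩

theorem exists_perm_apply_four {p q r u a b c d : X} (hpq : p ≠ q) (hpr : p ≠ r) (hpu : p ≠ u)
    (hqr : q ≠ r) (hqu : q ≠ u) (hru : r ≠ u) (hab : a ≠ b) (hac : a ≠ c) (had : a ≠ d)
    (hbc : b ≠ c) (hbd : b ≠ d) (hcd : c ≠ d) :
    ∃ π : Perm X, π p = a ∧ π q = b ∧ π r = c ∧ π u = d := by
  obtain ⟨π, hp, hq, hr⟩ := exists_perm_apply_three hpq hpr hqr hab hac hbc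
  exact ⟨swap (π u) d * π, by rw [swap_mul_apply_of_ne π hpu (hp ▸ had), hp],
    by rw [swap_mul_apply_of_ne π hqu (hq ▸ hbd), hq],
    by rw [swap_mul_apply_of_ne π hru (hr ▸ hcd), hr], swap_mul_apply_left π u d⟩

/-- If `t` is an idempotent commuting with the pointwise stabilizer of `p` and `q`, absorbing
the transposition of `p` and `q`, and commuting with two of its conjugates, then the conjugates of
`t` form a join family. -/
theorem exists_isJoinFamily (ρ : Perm X →* N) {t : N} {p q r u : X}
    (hpq : p ≠ q) (hpr : p ≠ r) (hpu : p ≠ u) (hqr : q ≠ r) (hqu : q ≠ u) (hru : r ≠ u)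
    (ht : t * t = t) (hright : t * ρ (swap p q) = t) (hleft : ρ (swap p q) * t = t)
    (hstab : ∀ τ : Perm X, τ p = p → τ q = q → ρ τ * t = t * ρ τ)
    {α : Perm X} (hαp : α p = p) (hαq : α q = r)
    (hα : Commute t (ρ α * t * ρ α⁻¹))
    {β : Perm X} (hβp : β p = r) (hβq : β q = u) (hβ : Commute t (ρ β * t * ρ β⁻¹)) :
    ∃ e : X → X → N, IsJoinFamily ρ e ∧
      ∀ π : Perm X, e (π p) (π q) = ρ π * t * ρ π⁻¹ := by
  have hinv : ∀ π : Perm X, ρ π⁻¹ * ρ π = 1 := fun π => by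
    rw [← map_mul, inv_mul_cancel, map_one]
  have hex : ∀ a b : X, ∃ g : N, (a = b → g = 1) ∧
      ∀ π : Perm X, π p = a → π q = b → g = ρ π * t * ρ π⁻¹ := by
    intro a b
    by_cases hab : a = b
    · exact ⟨1, fun _ => rfl, fun π ha hb => (hpq (π.injective (by rw [ha, hb, hab]))).elim⟩
    obtain ⟨τ, hτp, hτq⟩ := exists_perm_apply_two hpq hab
    refine ⟨ρ τ * t * ρ τ⁻¹, fun h => (hab h).elim, fun π ha hb => ?_⟩
    have hcomm := hstab (π⁻¹ * τ) (by rw [Perm.mul_apply, hτp, ← ha]; simp)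
      (by rw [Perm.mul_apply, hτq, ← hb]; simp)
    calc ρ τ * t * ρ τ⁻¹ = ρ π * (ρ (π⁻¹ * τ) * t) * ρ τ⁻¹ := by
          rw [← mul_assoc, ← map_mul, mul_inv_cancel_left]
      _ = ρ π * t * ρ π⁻¹ := by
          rw [hcomm, ← mul_assoc, mul_assoc (ρ π * t), ← map_mul, mul_inv_cancel_right]
  choose e hself he using hex
  have heq : ∀ π : Perm X, e (π p) (π q) = ρ π * t * ρ π⁻¹ := fun π => he _ _ π rfl rfl
  have hsymm : ∀ a b, e a b = e b a := by
    intro a b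
    by_cases hab : a = b
    · rw [hab]
    obtain ⟨π, rfl, rfl⟩ := exists_perm_apply_two hpq hab
    rw [heq, he _ _ (π * swap p q) (by simp) (by simp), mul_inv_rev, swap_inv, map_mul, map_mul,
      ← mul_assoc (_ * t), mul_assoc (ρ π) _ t, hleft, mul_assoc (ρ π) t (ρ (swap p q)), hright]
  have hconj : ∀ π a b, ρ π * e a b = e (π a) (π b) * ρ π := by
    intro π a b
    by_cases hab : a = b
    · rw [hself a b hab, hself _ _ (congrArg π hab), one_mul, mul_one]
    obtain ⟨τ, rfl, rfl⟩ := exists_perm_apply_two hpq hab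
    rw [heq, ← Perm.mul_apply, ← Perm.mul_apply, heq, mul_assoc _ _ (ρ π), ← map_mul, mul_inv_rev,
      inv_mul_cancel_right, ← mul_assoc, ← mul_assoc, ← map_mul]
  have hcommConj : ∀ (π : Perm X) {a b c d : X}, Commute (e a b) (e c d) →
      Commute (e (π a) (π b)) (e (π c) (π d)) := by
    intro π a b c d h
    have hc : ∀ a b, e (π a) (π b) = ρ π * e a b * ρ π⁻¹ := fun a b => by
      rw [hconj, mul_assoc, ← map_mul, mul_inv_cancel, map_one, mul_one]
    have hm : ∀ g h : N, ρ π * g * ρ π⁻¹ * (ρ π * h * ρ π⁻¹) = ρ π * (g * h) * ρ π⁻¹ := by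
      intro g h
      simp only [mul_assoc]
      rw [← mul_assoc (ρ π⁻¹) (ρ π), hinv, one_mul]
    rw [hc, hc, Commute, SemiconjBy, hm, hm, h.eq]
  have het : e p q = t := by simpa using heq 1
  have hcommShare : ∀ a b c, Commute (e a b) (e a c) := by
    intro a b c
    by_cases hab : a = b
    · rw [hself a b hab]
      exact Commute.one_left _
    by_cases hac : a = c
    · rw [hself a c hac]
      exact Commute.one_right _
    by_cases hbc : b = c
    · rw [hbc]
    obtain ⟨π, rfl, rfl, rfl⟩ := exists_perm_apply_three hpq hpr hqr hab hac hbc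
    refine hcommConj π ?_
    rwa [het, he p r α hαp hαq]
  have hcomm : ∀ a b c d, Commute (e a b) (e c d) := by
    intro a b c d
    by_cases hac : a = c
    · rw [hac]
      exact hcommShare _ _ _
    by_cases had : a = d
    · rw [had, hsymm c d]
      exact hcommShare _ _ _
    by_cases hbc : b = c
    · rw [hbc, hsymm a c]
      exact hcommShare _ _ _
    by_cases hbd : b = d
    · rw [hbd, hsymm a d, hsymm c d]
      exact hcommShare _ _ _
    by_cases hab : a = b
    · rw [hself a b hab]
      exact Commute.one_left _
    by_cases hcd : c = d
    · rw [hself c d hcd]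
      exact Commute.one_right _
    obtain ⟨π, rfl, rfl, rfl, rfl⟩ :=
      exists_perm_apply_four hpq hpr hpu hqr hqu hru hab hac had hbc hbd hcd
    refine hcommConj π ?_
    rwa [het, he r u β hβp hβq]
  refine ⟨e, ⟨fun a => hself a a rfl, ?_, hsymm, fun a b c d => (hcomm a b c d).eq, hconj, ?_⟩, heq⟩
  · intro a b
    by_cases hab : a = b
    · rw [hself a b hab, one_mul]
    obtain ⟨π, rfl, rfl⟩ := exists_perm_apply_two hpq hab
    rw [heq, mul_assoc (ρ π), mul_assoc (ρ π), mul_assoc t, ← mul_assoc (ρ π⁻¹), hinv, one_mul,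
      ← mul_assoc t, ht]
  · intro a b
    by_cases hab : a = b
    · rw [hab, swap_self]
      exact (congrArg _ (map_one ρ)).trans (mul_one _)
    obtain ⟨π, rfl, rfl⟩ := exists_perm_apply_two hpq hab
    have hswap : swap (π p) (π q) = π * swap p q * π⁻¹ := by
      rw [Perm.mul_def, Perm.mul_def]
      exact (Equiv.symm_trans_swap_trans p q π).symm
    rw [heq, hswap, mul_assoc _ _ (ρ _), ← map_mul, ← mul_assoc, ← mul_assoc, inv_mul_cancel,
      one_mul, map_mul, ← mul_assoc, mul_assoc (ρ π), hright]

end Join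

/-! ### The structure of `Fhat n` -/

instance (n : ℕ) : Finite (Point n) := (Set.finite_Icc 1 n).to_subtype

theorem Fhat_mk_eq_of_FRel {n : ℕ} {v w : FreeMonoid (Fin n)} (h : FRel n v w) :
    (Fcon n).mk' v = (Fcon n).mk' w :=
  (Con.eq _).2 (ConGen.Rel.of _ _ h)

theorem isCoxeterFamily_sf (n : ℕ) : IsCoxeterFamily n (sf n) := by
  rw [isCoxeterFamily_iff_pow]
  intro i j hi hij hj
  have h := Fhat_mk_eq_of_FRel (FRel.f1 (n := n) hi hij (by omega))
  rwa [map_pow, map_mul, map_one] at h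

theorem commute_of_apply_eq_self {N : Type*} [Monoid N] {n : ℕ} (ρ : Perm (Point n) →* N) {t : N}
    {a : ℕ → N}
    (hρ : ∀ i (hi : 1 ≤ i) (hin : i < n),
      ρ (swap ⟨i, hi, hin.le⟩ ⟨i + 1, by omega, hin⟩) = a i)
    (ht : ∀ i, 3 ≤ i → i < n → Commute t (a i)) {τ : Perm (Point n)}
    (hτ : ∀ k : Point n, (k : ℕ) < 3 → τ k = k) : Commute t (ρ τ) := by
  have hswap : ∀ (k l : Point n), 3 ≤ (k : ℕ) → (k : ℕ) < l → Commute t (ρ (swap k l)) := by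
    rintro ⟨k, hk⟩ ⟨l, hl⟩ (hk3 : 3 ≤ k) (hkl : k < l)
    induction l, hkl using Nat.le_induction with
    | base =>
      rw [hρ k hk.1 hl.2]
      exact ht k hk3 hl.2
    | succ l hkl ih =>
      have hl' : 1 ≤ l ∧ l ≤ n := by omega
      have hfac : swap (⟨k, hk⟩ : Point n) ⟨l + 1, hl⟩ =
          swap ⟨l, hl'⟩ ⟨l + 1, hl⟩ * swap ⟨k, hk⟩ ⟨l, hl'⟩ * swap ⟨l, hl'⟩ ⟨l + 1, hl⟩ := by
        have hkl' : (⟨k, hk⟩ : Point n) ≠ ⟨l, hl'⟩ := by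
          simp only [ne_eq, Subtype.mk.injEq]; omega
        have hkl'' : (⟨k, hk⟩ : Point n) ≠ ⟨l + 1, hl⟩ := by
          simp only [ne_eq, Subtype.mk.injEq]; omega
        rw [swap_mul_swap_mul_swap hkl' hkl'', swap_comm]
      have hadj : Commute t (ρ (swap (⟨l, hl'⟩ : Point n) ⟨l + 1, hl⟩)) := by
        rw [hρ l hl'.1 hl.2]
        exact ht l (by omega) hl.2
      rw [hfac, map_mul, map_mul]
      exact (hadj.mul_right (ih hl')).mul_right hadj
  let r : Setoid (Point n) :=
    { r := fun k l => k = l ∨ 3 ≤ (k : ℕ) ∧ 3 ≤ (l : ℕ)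
      iseqv := ⟨fun _ => Or.inl rfl, by rintro k l (rfl | h) <;> simp_all,
        by rintro k l m (rfl | h) (rfl | h') <;> simp_all⟩ }
  have hmem := perm_mem_closure_swap r τ fun k => by
    by_cases hk : (k : ℕ) < 3
    · exact Or.inl (hτ k hk).symm
    · by_cases hτk : ((τ k : Point n) : ℕ) < 3
      · exact Or.inl (τ.injective (hτ _ hτk)).symm
      · exact Or.inr ⟨not_lt.1 hk, not_lt.1 hτk⟩
  clear hτ
  induction hmem using Submonoid.closure_induction with
  | mem τ hτ =>
    obtain ⟨k, l, hkl, rfl⟩ := hτ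
    obtain rfl | ⟨hk, hl⟩ := hkl
    · rw [swap_self]
      exact (map_one ρ).symm ▸ Commute.one_right t
    · rcases lt_trichotomy (k : ℕ) l with h | h | h
      · exact hswap k l hk h
      · rw [Subtype.ext h, swap_self]
        exact (map_one ρ).symm ▸ Commute.one_right t
      · exact swap_comm k l ▸ hswap l k hl h
  | one => exact (map_one ρ).symm ▸ Commute.one_right t
  | mul σ τ _ _ hσ hτ => exact (map_mul ρ σ τ).symm ▸ hσ.mul_right hτ

/-- The symmetric group maps to `Fhat n`, and the conjugates of `t` form a join family. -/
theorem exists_isJoinFamily_Fhat {n : ℕ} (hn : 4 ≤ n) :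
    ∃ (ρ : Perm (Point n) →* Fhat n) (e : Point n → Point n → Fhat n),
      IsJoinFamily ρ e ∧
      (∀ i (hi : 1 ≤ i) (hin : i < n),
        ρ (swap ⟨i, hi, hin.le⟩ ⟨i + 1, by omega, hin⟩) = sf n i) ∧
      (∀ π, (Perm.ofSubtype π, ρ π) ∈ parabolic (swapPair (sf n)) n) ∧
      ∀ π : Perm (Point n), e (π ⟨1, by omega⟩) (π ⟨2, by omega⟩) = ρ π * tf n * ρ π⁻¹ := by
  obtain ⟨ρ, hρ, hpar⟩ := (isCoxeterFamily_sf n).exists_permHom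
  let p : Point n := ⟨1, by omega⟩
  let q : Point n := ⟨2, by omega⟩
  let r : Point n := ⟨3, by omega⟩
  let u : Point n := ⟨4, by omega⟩
  have hpq : p ≠ q := by simp [p, q]
  have hpr : p ≠ r := by simp [p, r]
  have hpu : p ≠ u := by simp [p, u]
  have hqr : q ≠ r := by simp [q, r]
  have hqu : q ≠ u := by simp [q, u]
  have hru : r ≠ u := by simp [r, u]
  have h1 : ρ (swap p q) = sf n 1 := hρ 1 (by omega) (by omega)
  have h2 : ρ (swap q r) = sf n 2 := hρ 2 (by omega) (by omega)
  have h3 : ρ (swap r u) = sf n 3 := hρ 3 (by omega) (by omega)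
  let β : Perm (Point n) := swap q r * swap r u * swap p q * swap q r
  have hβinv : β⁻¹ = β := by
    have hdisj : swap r u * swap p q = swap p q * swap r u :=
      (Perm.Disjoint.commute (Perm.disjoint_swap_swap (by simp [p, q, r, u]))).eq
    simp only [β, mul_inv_rev, swap_inv, mul_assoc]
    rw [← mul_assoc (swap p q), ← hdisj, mul_assoc]
  have hβ : ρ β = (Fcon n).mk' (σw n) := by
    simp only [β, map_mul, h1, h2, h3]
    rfl
  obtain ⟨e, he, hconj⟩ := exists_isJoinFamily ρ (t := tf n) hpq hpr hpu hqr hqu hru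
    (Fhat_mk_eq_of_FRel FRel.f2)
    (by rw [h1]; exact Fhat_mk_eq_of_FRel FRel.f3a)
    (by rw [h1]; exact Fhat_mk_eq_of_FRel FRel.f3b)
    (fun τ hp hq => by
      refine (commute_of_apply_eq_self (t := tf n) ρ hρ
        (fun i hi hin => Fhat_mk_eq_of_FRel (FRel.f4 (n := n) hi (by omega)))
        fun k hk => ?_).symm.eq
      obtain ⟨k, hk'⟩ := k
      obtain rfl | rfl : k = 1 ∨ k = 2 := by simp only at hk; omega
      exacts [hp, hq])
    (α := swap q r) (swap_apply_of_ne_of_ne hpq hpr) (swap_apply_left q r)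
    (by
      rw [swap_inv, h2, Commute, SemiconjBy, ← mul_assoc, ← mul_assoc]
      exact Fhat_mk_eq_of_FRel FRel.f5)
    (β := β)
    (by simp [β, swap_apply_of_ne_of_ne, hpq, hpr, hqr, hqu])
    (by simp [β, swap_apply_of_ne_of_ne, hru.symm, hqu.symm, hqr.symm, hpr.symm])
    (by
      rw [hβinv, hβ, Commute, SemiconjBy, ← mul_assoc, ← mul_assoc]
      exact Fhat_mk_eq_of_FRel (FRel.f6 hn))
  exact ⟨ρ, e, he, hρ, hpar, hconj⟩

theorem exists_eq_joinProd_mul {n : ℕ} (hn : 4 ≤ n) {ρ : Perm (Point n) →* Fhat n}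
    {e : Point n → Point n → Fhat n} (he : IsJoinFamily ρ e)
    (hρ : ∀ i (hi : 1 ≤ i) (hin : i < n),
      ρ (swap ⟨i, hi, hin.le⟩ ⟨i + 1, by omega, hin⟩) = sf n i)
    (het : e ⟨1, by omega⟩ ⟨2, by omega⟩ = tf n) (g : Fhat n) :
    ∃ L π, g = joinProd e L * ρ π := by
  obtain ⟨w, rfl⟩ := (Fcon n).mk'_surjective g
  induction w using FreeMonoid.inductionOn' with
  | one => exact ⟨[], 1, by simp [joinProd]⟩
  | of_mul i w ih =>
    obtain ⟨L, π, hw⟩ := ih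
    rw [map_mul, hw]
    by_cases hi : (i : ℕ) = 0
    · refine ⟨(⟨1, by omega⟩, ⟨2, by omega⟩) :: L, π, ?_⟩
      have hgen : (Fcon n).mk' (FreeMonoid.of i) = tf n := by
        rw [tf, tw, dif_pos (by omega)]
        exact congrArg _ (congrArg _ (Fin.ext hi))
      rw [hgen, joinProd_cons, het, mul_assoc]
    · have hgen : (Fcon n).mk' (FreeMonoid.of i) = sf n i := by
        rw [sf, sw, dif_pos i.2]
      rw [hgen, ← hρ i (by omega) i.2, ← mul_assoc, he.perm_mul_joinProd, mul_assoc, ← map_mul]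
      exact ⟨_, _, rfl⟩

/-! ### Faithfulness of the action -/

section Action

variable {n : ℕ} {ρ : Perm (Point n) →* Fhat n} {e : Point n → Point n → Fhat n}
  {Φ : Fhat n →* Function.End (Option (ℕ → Prop))}

theorem action_perm (hpar : ∀ π, (Perm.ofSubtype π, ρ π) ∈ parabolic (swapPair (sf n)) n)
    (hΦs : ∀ i, 1 ≤ i → i < n → Φ (sf n i) = sOp i) (π : Perm (Point n)) :
    Φ (ρ π) = permAction (Perm.ofSubtype π) := by
  have hmem := hpar π
  suffices h : ∀ g ∈ parabolic (swapPair (sf n)) n, Φ g.2 = permAction g.1 from h _ hmem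
  intro g hg
  induction hg using Submonoid.closure_induction with
  | mem x hx =>
    obtain ⟨i, hi, hin, rfl⟩ := hx
    exact hΦs i hi hin
  | one => rw [Prod.fst_one, Prod.snd_one, map_one, map_one]
  | mul x y _ _ hx hy => rw [Prod.fst_mul, Prod.snd_mul, map_mul, map_mul, hx, hy]

theorem action_join (hn : 4 ≤ n) (he : IsJoinFamily ρ e)
    (hconj : ∀ π : Perm (Point n),
      e (π ⟨1, by omega⟩) (π ⟨2, by omega⟩) = ρ π * tf n * ρ π⁻¹)
    (hΦρ : ∀ π, Φ (ρ π) = permAction (Perm.ofSubtype π))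
    (hΦt : Φ (tf n) = guardedPrecomp (fun f => f 1 = f 2) id) (a b : Point n) :
    Φ (e a b) = guardedPrecomp (fun f => f a = f b) id := by
  by_cases hab : a = b
  · subst hab
    rw [he.self, map_one, ← guardedPrecomp_true_id]
    exact guardedPrecomp_congr (by simp) (by simp)
  have hp : 1 ≤ 1 ∧ 1 ≤ n := by omega
  have hq : 1 ≤ 2 ∧ 2 ≤ n := by omega
  obtain ⟨π, rfl, rfl⟩ := exists_perm_apply_two
    (p := (⟨1, hp⟩ : Point n)) (q := ⟨2, hq⟩) (by simp) hab
  rw [hconj, map_mul, map_mul, hΦρ, hΦρ, hΦt]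
  have hperm : ∀ τ : Perm ℕ, permAction τ = guardedPrecomp (fun _ => True) ⇑τ⁻¹ := fun _ => rfl
  rw [hperm, hperm, guardedPrecomp_mul, guardedPrecomp_mul]
  apply guardedPrecomp_congr
  · intro f
    have hval : ∀ k : Point n, Perm.ofSubtype π k = (π k : ℕ) := Perm.ofSubtype_apply_coe π
    simp only [true_and, and_true, map_inv, inv_inv, Function.comp_apply, ← hval]
  · intro f _ k
    simp

theorem action_joinProd
    (hΦe : ∀ a b, Φ (e a b) = guardedPrecomp (fun f => f a = f b) id)
    (L : List (Point n × Point n)) :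
    Φ (joinProd e L) = guardedPrecomp (fun f => ∀ p ∈ L, f p.1 = f p.2) id := by
  induction L with
  | nil =>
    rw [joinProd, List.map_nil, List.prod_nil, map_one, ← guardedPrecomp_true_id]
    exact guardedPrecomp_congr (by simp) (by simp)
  | cons p L ih =>
    rw [joinProd_cons, map_mul, ih, hΦe, guardedPrecomp_mul]
    refine guardedPrecomp_congr (fun f => ?_) (by simp)
    rw [List.forall_mem_cons, and_comm]
    rfl

theorem action_joinProd_mul
    (hΦρ : ∀ π, Φ (ρ π) = permAction (Perm.ofSubtype π))
    (hΦe : ∀ a b, Φ (e a b) = guardedPrecomp (fun f => f a = f b) id)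
    (L : List (Point n × Point n)) (π : Perm (Point n)) (f : ℕ → Prop) :
    Φ (joinProd e L * ρ π) (some f) =
      guardedPrecomp (fun f => ∀ p ∈ L, f p.1 = f p.2) id
        (some (f ∘ ⇑(Perm.ofSubtype π)⁻¹)) := by
  rw [map_mul, hΦρ, action_joinProd hΦe, ← permAction_some]
  rfl

theorem joinSetoid_of_action_eq
    (hΦρ : ∀ π, Φ (ρ π) = permAction (Perm.ofSubtype π))
    (hΦe : ∀ a b, Φ (e a b) = guardedPrecomp (fun f => f a = f b) id)
    {L L' : List (Point n × Point n)} {π π' : Perm (Point n)}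
    (h : Φ (joinProd e L * ρ π) = Φ (joinProd e L' * ρ π')) :
    (∀ p ∈ L', joinSetoid L p.1 p.2) ∧ ∀ a, joinSetoid L a ((π * π'⁻¹) a) := by
  have key : ∀ a : Point n, (∀ p ∈ L', joinSetoid L a p.1 ↔ joinSetoid L a p.2) ∧
      (joinSetoid L a a ↔ joinSetoid L a ((π * π'⁻¹) a)) := by
    intro a
    let G : ℕ → Prop := fun k => ∃ hk, joinSetoid L a ⟨k, hk⟩
    have hG : ∀ k : Point n, G k ↔ joinSetoid L a k :=
      fun k => ⟨fun ⟨_, hk⟩ => hk, fun hk => ⟨k.2, hk⟩⟩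
    have hGL : ∀ p ∈ L, G p.1 = G p.2 := by
      intro p hp
      rw [hG, hG]
      exact propext ⟨fun hap => (joinSetoid L).trans hap (joinSetoid_of_mem hp),
        fun hap => (joinSetoid L).trans hap ((joinSetoid L).symm (joinSetoid_of_mem hp))⟩
    have hcancel : (G ∘ ⇑(Perm.ofSubtype π)) ∘ ⇑(Perm.ofSubtype π)⁻¹ = G := by
      funext k
      simp
    have happ := congrFun h (some (G ∘ ⇑(Perm.ofSubtype π)))
    rw [action_joinProd_mul hΦρ hΦe, action_joinProd_mul hΦρ hΦe, guardedPrecomp_some,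
      guardedPrecomp_some, hcancel, if_pos hGL] at happ
    split_ifs at happ with hguard
    have hfun : G = (G ∘ ⇑(Perm.ofSubtype π)) ∘ ⇑(Perm.ofSubtype π')⁻¹ := Option.some.inj happ
    rw [← hfun] at hguard
    refine ⟨fun p hp => ?_, ?_⟩
    · rw [← hG, ← hG, hguard p hp]
    · have hval : ((π * π'⁻¹) a : ℕ) = Perm.ofSubtype π ((Perm.ofSubtype π')⁻¹ a) := by
        rw [← Perm.mul_apply, ← map_inv, ← map_mul]
        exact (Perm.ofSubtype_apply_coe _ a).symm
      rw [← hG, ← hG, hval]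
      exact iff_of_eq (congrFun hfun a)
  exact ⟨fun p hp => ((key p.1).1 p hp).1 ((joinSetoid L).refl _),
    fun a => (key a).2.1 ((joinSetoid L).refl _)⟩

end Action

/-- A homomorphism from `Fhat n` to partial transformations with the expected values on
generators is injective. -/
theorem injective_of_action {n : ℕ} (hn : 4 ≤ n)
    {Φ : Fhat n →* Function.End (Option (ℕ → Prop))}
    (hΦt : Φ (tf n) = guardedPrecomp (fun f => f 1 = f 2) id)
    (hΦs : ∀ i, 1 ≤ i → i < n → Φ (sf n i) = sOp i) : Function.Injective Φ := by
  obtain ⟨ρ, e, he, hρ, hpar, hconj⟩ := exists_isJoinFamily_Fhat hn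
  have hΦρ := action_perm hpar hΦs
  have hΦe := action_join hn he hconj hΦρ hΦt
  have het : e ⟨1, by omega⟩ ⟨2, by omega⟩ = tf n := by simpa using hconj 1
  intro g g' h
  obtain ⟨L, π, rfl⟩ := exists_eq_joinProd_mul hn he hρ het g
  obtain ⟨L', π', rfl⟩ := exists_eq_joinProd_mul hn he hρ het g'
  obtain ⟨hL, hπ⟩ := joinSetoid_of_action_eq hΦρ hΦe h
  obtain ⟨hL', -⟩ := joinSetoid_of_action_eq hΦρ hΦe h.symm
  calc joinProd e L * ρ π = joinProd e L * ρ (π * π'⁻¹) * ρ π' := by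
        rw [mul_assoc, ← map_mul, inv_mul_cancel_right]
    _ = joinProd e L' * ρ π' := by rw [he.joinProd_mul_perm hπ, he.joinProd_eq hL hL']

end UniformBlock

/-- For `n ≥ 4`, the monoid homomorphism `F̂ₙ → Mₙ` determined by
`t ↦ x²` and `sᵢ ↦ sᵢ` is injective.  (Since the generators generate `F̂ₙ`, any monoid
homomorphism taking these values on the generators is that homomorphism.) -/
theorem stmt9 (n : ℕ) (hn : 4 ≤ n) (φ : Fhat n →* M n)
    (ht : φ (tf n) = xm n ^ 2)
    (hs : ∀ i : ℕ, 1 ≤ i → i ≤ n - 1 → φ (sf n i) = sm n i) :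
    Function.Injective φ := by
  refine Function.Injective.of_comp (f := UniformBlock.monoidAction hn) ?_
  refine UniformBlock.injective_of_action hn (Φ := (UniformBlock.monoidAction hn).comp φ) ?_ ?_
  · rw [MonoidHom.comp_apply, ht, map_pow, xm, UniformBlock.monoidAction_mk,
      UniformBlock.wordAction_xw (by omega), pow_two, UniformBlock.xOp_sq]
  · intro i hi hin
    rw [MonoidHom.comp_apply, hs i hi (by omega), sm, UniformBlock.monoidAction_mk,
      UniformBlock.wordAction_sw hi hin]
end

section
/- For n ≥ 3, the group of units of the monoid M_n is exactly the submonoid of M_n generated by {s_1, …, s_{n−1}}; that is, an element of M_n is invertible if and only if it is a product of the generators s_1, …, s_{n−1}. -/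
/-- The homomorphism to `(ℕ, *)` sending `x` to `0` and every `sᵢ` to `1`: it detects whether
a word contains the letter `x`. -/
def xFree (n : ℕ) : FreeMonoid (Fin n) →* ℕ :=
  FreeMonoid.lift fun i => if i.val = 0 then 0 else 1

theorem xFree_xw {n : ℕ} (hn : 0 < n) : xFree n (xw n) = 0 := by
  simp [xFree, xw, hn]

theorem xFree_sw {n i : ℕ} (hi : 1 ≤ i) : xFree n (sw n i) = 1 := by
  have : i ≠ 0 := by omega
  unfold sw
  split <;> simp [xFree, this]

theorem xFree_yw {n : ℕ} (hn : 0 < n) : ∀ i, 3 ≤ i → xFree n (yw n i) = 0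
  | 3, _ => xFree_xw hn
  | i + 4, _ => by simp [yw, xFree_yw hn (i + 3) (by omega)]

theorem Mcon_le_ker_xFree {n : ℕ} (hn : 0 < n) : Mcon n ≤ Con.ker (xFree n) := by
  refine Con.conGen_le.2 fun v w h => ?_
  have hx := xFree_xw hn
  rw [Con.ker_rel]
  cases h with
  | r1 hi hij _ => simp [xFree_sw hi, xFree_sw (hi.trans hij)]
  | r6 hi _ => simp [xFree_yw hn _ hi]
  | _ => simp [hx]

/-- A word not containing `x` represents a product of the generators `sᵢ`. -/
theorem mk_mem_closure_of_xFree_ne_zero {n : ℕ} (w : FreeMonoid (Fin n)) (hw : xFree n w ≠ 0) :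
    (Mcon n).mk' w ∈
      Submonoid.closure {b : M n | ∃ i : ℕ, 1 ≤ i ∧ i ≤ n - 1 ∧ b = sm n i} := by
  induction w using FreeMonoid.inductionOn' with
  | one => simp
  | of_mul i w ih =>
    rw [map_mul, mul_ne_zero_iff] at hw
    rw [map_mul]
    refine mul_mem (Submonoid.subset_closure ⟨i, ?_, by omega, ?_⟩) (ih hw.2)
    · by_contra hi
      exact hw.1 (by simp [xFree, show i.val = 0 by omega])
    · simp [sm, sw]

theorem isUnit_sm {n i : ℕ} (hi : 1 ≤ i) (hin : i ≤ n - 1) : IsUnit (sm n i) := by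
  have h : sm n i * sm n i = 1 := by
    have := (Con.eq (Mcon n)).2 (ConGen.Rel.of _ _ (MRel.r1 hi le_rfl hin))
    simpa [mExp, sm] using this
  exact ⟨⟨_, _, h, h⟩, rfl⟩

/-- For `n ≥ 3`, the group of units of `Mₙ` is exactly the submonoid
of `Mₙ` generated by `{s₁, …, s_{n-1}}`: an element of `Mₙ` is invertible if and only
if it is a product of the generators `s₁, …, s_{n-1}`. -/
theorem stmt10 (n : ℕ) (hn : 3 ≤ n) (a : M n) :
    IsUnit a ↔
      a ∈ Submonoid.closure {b : M n | ∃ i : ℕ, 1 ≤ i ∧ i ≤ n - 1 ∧ b = sm n i} := by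
  constructor
  · intro ha
    obtain ⟨w, rfl⟩ := Con.mk'_surjective a
    have hle := Mcon_le_ker_xFree (show 0 < n by omega)
    have hu := ha.map ((Mcon n).lift (xFree n) hle)
    rw [Con.lift_mk'] at hu
    exact mk_mem_closure_of_xFree_ne_zero w hu.ne_zero
  · intro ha
    refine (Submonoid.closure_le (S := IsUnit.submonoid (M n))).2 ?_ ha
    rintro _ ⟨i, hi, hin, rfl⟩
    exact isUnit_sm hi hin
end

section
/- For n ≥ 4, the monoid M_n is an inverse monoid; its set of idempotents E(M_n) equals the submonoid generated by {g⁻¹ x² g : g a unit of M_n}; and its factorizable part E(M_n)G(M_n) equals the submonoid generated by {x², s_1, …, s_{n−1}}. -/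
/-- The conjugate `g f g⁻¹` of an element of a monoid by a unit. -/
def unitConj {N : Type*} [Monoid N] (g : Nˣ) (f : N) : N := g * f * ↑g⁻¹

section UnitConj

variable {N : Type*} [Monoid N]

theorem unitConj_mul (g : Nˣ) (a b : N) :
    unitConj g (a * b) = unitConj g a * unitConj g b := by
  simp [unitConj, mul_assoc]

theorem mul_unitConj (g h : Nˣ) (a : N) :
    unitConj (g * h) a = unitConj g (unitConj h a) := by
  simp [unitConj, mul_assoc]

theorem unitConj_one (g : Nˣ) : unitConj g (1 : N) = 1 := by
  simp [unitConj]

theorem one_unitConj (a : N) : unitConj 1 a = a := by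
  simp [unitConj]

theorem unitConj_eq_self_iff {g : Nˣ} {a : N} :
    unitConj g a = a ↔ (g : N) * a = a * g := by
  rw [unitConj, Units.mul_inv_eq_iff_eq_mul]

theorem Commute.unitConj_right {g : Nˣ} {a b : N} (h : Commute a b) (ha : unitConj g a = a) :
    Commute a (unitConj g b) := by
  have key : unitConj g (a * b) = unitConj g (b * a) := by rw [h.eq]
  rwa [unitConj_mul, unitConj_mul, ha] at key

theorem unitConj_eq_self_of_mem_closure {S : Set Nˣ} {a : N} (hS : ∀ g ∈ S, unitConj g a = a)
    {g : Nˣ} (hg : g ∈ Subgroup.closure S) : unitConj g a = a := by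
  induction hg using Subgroup.closure_induction with
  | mem g hg => exact hS g hg
  | one => exact one_unitConj a
  | mul g h _ _ ihg ihh => rw [mul_unitConj, ihh, ihg]
  | inv g _ ih =>
    conv_lhs => rw [← ih]
    rw [← mul_unitConj, inv_mul_cancel, one_unitConj]

end UnitConj

section InverseCriterion

variable {N : Type*} [Monoid N]

/-- The submonoid generated by the conjugates of `x²` by units. -/
def conjSqClosure (x : N) : Submonoid N :=
  Submonoid.closure {a : N | ∃ g : Nˣ, a = ↑g⁻¹ * x ^ 2 * ↑g}

theorem unitConj_sq_mem_conjSqClosure (x : N) (g : Nˣ) : unitConj g (x ^ 2) ∈ conjSqClosure x :=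
  Submonoid.subset_closure ⟨g⁻¹, by simp [unitConj]⟩

theorem sq_mem_conjSqClosure (x : N) : x ^ 2 ∈ conjSqClosure x := by
  simpa [one_unitConj] using unitConj_sq_mem_conjSqClosure x 1

@[elab_as_elim]
theorem conjSqClosure_induction {x : N} {p : (a : N) → a ∈ conjSqClosure x → Prop}
    (one : p 1 (one_mem _))
    (conj : ∀ g : Nˣ, p (unitConj g (x ^ 2)) (unitConj_sq_mem_conjSqClosure x g))
    (mul : ∀ a b ha hb, p a ha → p b hb → p (a * b) (mul_mem ha hb))
    {a : N} (ha : a ∈ conjSqClosure x) : p a ha := by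
  induction ha using Submonoid.closure_induction with
  | mem a ha =>
    obtain ⟨g, rfl⟩ := ha
    simpa [unitConj] using conj g⁻¹
  | one => exact one
  | mul a b ha hb iha ihb => exact mul a b ha hb iha ihb

theorem unitConj_mem_conjSqClosure {x a : N} (h : Nˣ) (ha : a ∈ conjSqClosure x) :
    unitConj h a ∈ conjSqClosure x := by
  induction ha using conjSqClosure_induction with
  | one => rw [unitConj_one]; exact one_mem _
  | conj g => rw [← mul_unitConj]; exact unitConj_sq_mem_conjSqClosure x _
  | mul a b _ _ iha ihb => rw [unitConj_mul]; exact mul_mem iha ihb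

theorem conjSqClosure_commute {x : N} (hcomm : ∀ g : Nˣ, Commute (x ^ 2) (unitConj g (x ^ 2)))
    {a b : N} (ha : a ∈ conjSqClosure x) (hb : b ∈ conjSqClosure x) : Commute a b := by
  induction ha using conjSqClosure_induction with
  | one => exact Commute.one_left b
  | mul a a' _ _ iha iha' => exact iha.mul_left iha'
  | conj g =>
    induction hb using conjSqClosure_induction with
    | one => exact Commute.one_right _
    | mul b b' _ _ ihb ihb' => exact ihb.mul_right ihb'
    | conj h =>
      have key := congrArg (unitConj g) (hcomm (g⁻¹ * h)).eq
      simpa only [commute_iff_eq, unitConj_mul, ← mul_unitConj, mul_inv_cancel_left] using key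

theorem isIdempotentElem_of_mem_conjSqClosure {x : N} (hx : x ^ 3 = x)
    (hcomm : ∀ g : Nˣ, Commute (x ^ 2) (unitConj g (x ^ 2)))
    {a : N} (ha : a ∈ conjSqClosure x) : IsIdempotentElem a := by
  induction ha using conjSqClosure_induction with
  | one => exact IsIdempotentElem.one
  | mul a b ha hb iha ihb => exact iha.mul_of_commute (conjSqClosure_commute hcomm ha hb) ihb
  | conj g =>
    have h4 : x ^ 2 * x ^ 2 = x ^ 2 := by
      rw [← pow_add, pow_succ x 3, hx, sq]
    rw [IsIdempotentElem, ← unitConj_mul, h4]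

theorem mul_mul_mem_conjSqClosure {x : N} (hx : x ^ 3 = x)
    (hcomm : ∀ g : Nˣ, Commute (x ^ 2) (unitConj g (x ^ 2)))
    (hxx : ∀ g : Nˣ, x * unitConj g (x ^ 2) * x ∈ conjSqClosure x)
    {a : N} (ha : a ∈ conjSqClosure x) : x * a * x ∈ conjSqClosure x := by
  induction ha using conjSqClosure_induction with
  | one => simpa [sq] using sq_mem_conjSqClosure x
  | conj g => exact hxx g
  | mul a b ha hb iha ihb =>
    have h : x * (a * b) * x = x * a * x * (x * b * x) := by
      have hc := (conjSqClosure_commute hcomm (sq_mem_conjSqClosure x) ha).eq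
      calc x * (a * b) * x = x ^ 3 * (a * b) * x := by rw [hx]
        _ = x * (x ^ 2 * a) * b * x := by simp only [pow_succ, pow_zero, one_mul, mul_assoc]
        _ = x * a * x * (x * b * x) := by rw [hc]; simp only [sq, mul_assoc]
    rw [h]
    exact mul_mem iha ihb

/-- `b` is an inverse of `a`, and conjugation by `a` and by `b` preserves `E`. -/
structure IsNormalizingInverse (E : Submonoid N) (a b : N) : Prop where
  mul_mul_left : a * b * a = a
  mul_mul_right : b * a * b = b
  conj_left : ∀ f ∈ E, a * f * b ∈ E
  conj_right : ∀ f ∈ E, b * f * a ∈ E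

theorem IsNormalizingInverse.mul {E : Submonoid N} (hE : ∀ e ∈ E, ∀ f ∈ E, Commute e f)
    {a b a' b' : N} (h : IsNormalizingInverse E a b) (h' : IsNormalizingInverse E a' b') :
    IsNormalizingInverse E (a * a') (b' * b) := by
  have hba : b * a ∈ E := by simpa using h.conj_right 1 (one_mem E)
  have hab' : a' * b' ∈ E := by simpa using h'.conj_left 1 (one_mem E)
  have hc := (hE _ hba _ hab').eq
  refine ⟨?_, ?_, fun f hf => ?_, fun f hf => ?_⟩
  · calc a * a' * (b' * b) * (a * a') = a * ((a' * b') * (b * a)) * a' := by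
          simp only [mul_assoc]
      _ = (a * b * a) * (a' * b' * a') := by rw [← hc]; simp only [mul_assoc]
      _ = a * a' := by rw [h.mul_mul_left, h'.mul_mul_left]
  · calc b' * b * (a * a') * (b' * b) = b' * ((b * a) * (a' * b')) * b := by
          simp only [mul_assoc]
      _ = (b' * a' * b') * (b * a * b) := by rw [hc]; simp only [mul_assoc]
      _ = b' * b := by rw [h.mul_mul_right, h'.mul_mul_right]
  · simpa only [mul_assoc] using h.conj_left _ (h'.conj_left f hf)
  · simpa only [mul_assoc] using h'.conj_right _ (h.conj_right f hf)

theorem exists_isNormalizingInverse {x : N} (hx : x ^ 3 = x)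
    (hgen : Submonoid.closure ({x} ∪ {a : N | IsUnit a}) = ⊤)
    (hcomm : ∀ g : Nˣ, Commute (x ^ 2) (unitConj g (x ^ 2)))
    (hxx : ∀ g : Nˣ, x * unitConj g (x ^ 2) * x ∈ conjSqClosure x) (a : N) :
    ∃ b, IsNormalizingInverse (conjSqClosure x) a b := by
  have ha : a ∈ Submonoid.closure ({x} ∪ {a : N | IsUnit a}) := hgen ▸ Submonoid.mem_top a
  induction ha using Submonoid.closure_induction with
  | mem a ha =>
    rcases ha with rfl | ⟨u, rfl⟩
    · have h : a * a * a = a := by rw [← sq, ← pow_succ, hx]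
      exact ⟨a, h, h, fun _ => mul_mul_mem_conjSqClosure hx hcomm hxx,
        fun _ => mul_mul_mem_conjSqClosure hx hcomm hxx⟩
    · refine ⟨↑u⁻¹, by simp, by simp, fun f hf => unitConj_mem_conjSqClosure u hf,
        fun f hf => ?_⟩
      simpa [unitConj] using unitConj_mem_conjSqClosure u⁻¹ hf
  | one => exact ⟨1, by simp, by simp, by simp, by simp⟩
  | mul a a' _ _ iha iha' =>
    obtain ⟨b, hb⟩ := iha
    obtain ⟨b', hb'⟩ := iha'
    exact ⟨b' * b, hb.mul (fun _ he _ hf => conjSqClosure_commute hcomm he hf) hb'⟩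

theorem isIdempotentElem_iff_mem_conjSqClosure {x : N} (hx : x ^ 3 = x)
    (hgen : Submonoid.closure ({x} ∪ {a : N | IsUnit a}) = ⊤)
    (hcomm : ∀ g : Nˣ, Commute (x ^ 2) (unitConj g (x ^ 2)))
    (hxx : ∀ g : Nˣ, x * unitConj g (x ^ 2) * x ∈ conjSqClosure x) {a : N} :
    IsIdempotentElem a ↔ a ∈ conjSqClosure x := by
  refine ⟨fun ha => ?_, isIdempotentElem_of_mem_conjSqClosure hx hcomm⟩
  obtain ⟨b, hb⟩ := exists_isNormalizingInverse hx hgen hcomm hxx a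
  have hab : a * b ∈ conjSqClosure x := by simpa using hb.conj_left 1 (one_mem _)
  have hba : b * a ∈ conjSqClosure x := by simpa using hb.conj_right 1 (one_mem _)
  have hbE : b ∈ conjSqClosure x := by
    have h : b = b * a * (a * b) := by
      conv_lhs => rw [← hb.mul_mul_right, ← ha.eq]
      simp only [mul_assoc]
    rw [h]
    exact mul_mem hba hab
  have hbb := isIdempotentElem_of_mem_conjSqClosure hx hcomm hbE
  have h : a = a * b * (b * a) := by
    conv_lhs => rw [← hb.mul_mul_left, ← hbb.eq]
    simp only [mul_assoc]
  rw [h]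
  exact mul_mem hab hba

theorem isInverseMonoid_of_conj_sq {x : N} (hx : x ^ 3 = x)
    (hgen : Submonoid.closure ({x} ∪ {a : N | IsUnit a}) = ⊤)
    (hcomm : ∀ g : Nˣ, Commute (x ^ 2) (unitConj g (x ^ 2)))
    (hxx : ∀ g : Nˣ, x * unitConj g (x ^ 2) * x ∈ conjSqClosure x) :
    IsInverseMonoid N := by
  refine ⟨fun a => ?_, fun e f he hf => ?_⟩
  · obtain ⟨b, hb⟩ := exists_isNormalizingInverse hx hgen hcomm hxx a
    exact ⟨b, hb.mul_mul_left, hb.mul_mul_right⟩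
  · rw [isIdempotentElem_iff_mem_conjSqClosure hx hgen hcomm hxx] at he hf
    exact conjSqClosure_commute hcomm he hf

/-- If `T` generates the units, the products of an idempotent and a unit form the submonoid
generated by `x²` and `T`. -/
theorem setOf_idempotent_mul_unit_eq_closure {x : N} {T : Set N}
    (hidem : ∀ a : N, IsIdempotentElem a ↔ a ∈ conjSqClosure x)
    (hT : ∀ a ∈ T, IsUnit a) (hunit : ∀ a : N, IsUnit a → a ∈ Submonoid.closure T) :
    {a : N | ∃ e g : N, IsIdempotentElem e ∧ IsUnit g ∧ a = e * g} =
      (Submonoid.closure ({x ^ 2} ∪ T) : Set N) := by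
  have hle : Submonoid.closure T ≤ Submonoid.closure ({x ^ 2} ∪ T) :=
    Submonoid.closure_mono Set.subset_union_right
  ext a
  constructor
  · rintro ⟨e, g, he, hg, rfl⟩
    refine mul_mem ?_ (hle (hunit g hg))
    rw [hidem] at he
    induction he using conjSqClosure_induction with
    | one => exact one_mem _
    | mul a b _ _ iha ihb => exact mul_mem iha ihb
    | conj g =>
      exact mul_mem (mul_mem (hle (hunit _ g.isUnit)) (Submonoid.subset_closure (Or.inl rfl)))
        (hle (hunit _ g⁻¹.isUnit))
  · intro ha
    induction ha using Submonoid.closure_induction with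
    | mem a ha =>
      rcases ha with rfl | ha
      · exact ⟨x ^ 2, 1, (hidem _).2 (sq_mem_conjSqClosure x), isUnit_one, (mul_one _).symm⟩
      · exact ⟨1, a, IsIdempotentElem.one, hT a ha, (one_mul a).symm⟩
    | one => exact ⟨1, 1, IsIdempotentElem.one, isUnit_one, (one_mul 1).symm⟩
    | mul a b _ _ iha ihb =>
      obtain ⟨e, _, he, ⟨u, rfl⟩, rfl⟩ := iha
      obtain ⟨f, _, hf, ⟨v, rfl⟩, rfl⟩ := ihb
      rw [hidem] at he hf
      refine ⟨e * unitConj u f, u * v, ?_, u.isUnit.mul v.isUnit, ?_⟩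
      · rw [hidem]
        exact mul_mem he (unitConj_mem_conjSqClosure u hf)
      · simp [unitConj, mul_assoc]

end InverseCriterion

section Reflections

variable {G : Type*} [Group G]

/-- The subgroup generated by the `sᵢ` with `k ≤ i < n`. -/
def tailSubgroup (n : ℕ) (s : ℕ → G) (k : ℕ) : Subgroup G :=
  Subgroup.closure {g | ∃ i, k ≤ i ∧ i < n ∧ g = s i}

/-- The relations (R1) of the symmetric group, in braid form. -/
structure IsBraidSystem (n : ℕ) (s : ℕ → G) : Prop where
  sq : ∀ i, s i * s i = 1
  braid : ∀ i, 1 ≤ i → i + 1 < n → s i * s (i + 1) * s i = s (i + 1) * s i * s (i + 1)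
  comm : ∀ i j, 1 ≤ i → i + 2 ≤ j → j < n → s i * s j = s j * s i

variable {n : ℕ} {s : ℕ → G}

theorem mem_tailSubgroup {k i : ℕ} (hk : k ≤ i) (hi : i < n) : s i ∈ tailSubgroup n s k :=
  Subgroup.subset_closure ⟨i, hk, hi, rfl⟩

theorem tailSubgroup_anti {k l : ℕ} (h : k ≤ l) : tailSubgroup n s l ≤ tailSubgroup n s k :=
  Subgroup.closure_mono fun _ ⟨i, hi, hin, hg⟩ => ⟨i, h.trans hi, hin, hg⟩

theorem IsBraidSystem.commute_of_mem_tail (hs : IsBraidSystem n s) {i k : ℕ} (hi : 1 ≤ i)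
    (hk : i + 2 ≤ k) {g : G} (hg : g ∈ tailSubgroup n s k) : s i * g = g * s i := by
  have h : tailSubgroup n s k ≤ Subgroup.centralizer {s i} := by
    refine (Subgroup.closure_le _).2 ?_
    rintro _ ⟨j, hj, hjn, rfl⟩
    rw [SetLike.mem_coe, Subgroup.mem_centralizer_singleton_iff]
    exact (hs.comm i j hi (hk.trans hj) hjn).symm
  exact (Subgroup.mem_centralizer_singleton_iff.1 (h hg)).symm

/-- Double coset decomposition of a tail subgroup with respect to the next one. -/
theorem IsBraidSystem.tail_cases (hs : IsBraidSystem n s) {k : ℕ} (hk : 1 ≤ k) {g : G}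
    (hg : g ∈ tailSubgroup n s k) :
    g ∈ tailSubgroup n s (k + 1) ∨
      k < n ∧ ∃ a ∈ tailSubgroup n s (k + 1), ∃ b ∈ tailSubgroup n s (k + 1), g = a * s k * b := by
  induction hm : n - k generalizing k g with
  | zero =>
    left
    have h : tailSubgroup n s k ≤ tailSubgroup n s (k + 1) :=
      Subgroup.closure_mono fun _ ⟨i, hi, hin, _⟩ => by omega
    exact h hg
  | succ m ih =>
    have hkn : k < n := by omega
    suffices hclosed : ∀ i, k ≤ i → i < n → ∀ g, (g ∈ tailSubgroup n s (k + 1) ∨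
        ∃ a ∈ tailSubgroup n s (k + 1), ∃ b ∈ tailSubgroup n s (k + 1), g = a * s k * b) →
        (s i * g ∈ tailSubgroup n s (k + 1) ∨
        ∃ a ∈ tailSubgroup n s (k + 1), ∃ b ∈ tailSubgroup n s (k + 1),
          s i * g = a * s k * b) by
      have hall : g ∈ tailSubgroup n s (k + 1) ∨
          ∃ a ∈ tailSubgroup n s (k + 1), ∃ b ∈ tailSubgroup n s (k + 1), g = a * s k * b := by
        induction hg using Subgroup.closure_induction_left with
        | one => exact Or.inl (one_mem _)
        | mul_left t ht g _ ihg =>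
          obtain ⟨i, hi, hin, rfl⟩ := ht
          exact hclosed i hi hin g ihg
        | inv_mul_cancel t ht g _ ihg =>
          obtain ⟨i, hi, hin, rfl⟩ := ht
          rw [inv_eq_of_mul_eq_one_left (hs.sq i)]
          exact hclosed i hi hin g ihg
      exact hall.imp_right fun h => ⟨hkn, h⟩
    intro i hi hin g hg
    rcases hi.lt_or_eq with hi | rfl
    · have hsi := mem_tailSubgroup (s := s) (show k + 1 ≤ i from hi) hin
      rcases hg with hg | ⟨a, ha, b, hb, rfl⟩
      · exact Or.inl (mul_mem hsi hg)
      · exact Or.inr ⟨s i * a, mul_mem hsi ha, b, hb, by simp only [mul_assoc]⟩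
    · rcases hg with hg | ⟨a, ha, b, hb, rfl⟩
      · exact Or.inr ⟨1, one_mem _, g, hg, by simp⟩
      · rcases ih (by omega) ha (by omega) with ha' | ⟨hk', c, hc, d, hd, rfl⟩
        · left
          have hc := hs.commute_of_mem_tail hk le_rfl ha'
          have h : s k * (a * s k * b) = a * b := by
            rw [← mul_assoc, ← mul_assoc, hc, mul_assoc a, hs.sq, mul_one]
          rw [h]
          exact mul_mem ha hb
        · right
          have hc' := hs.commute_of_mem_tail hk le_rfl hc
          have hd' := hs.commute_of_mem_tail hk le_rfl hd
          have hsk := mem_tailSubgroup (s := s) (le_refl (k + 1)) hk'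
          have hle := tailSubgroup_anti (n := n) (s := s) (Nat.le_succ (k + 1))
          refine ⟨c * s (k + 1), mul_mem (hle hc) hsk, s (k + 1) * (d * b),
            mul_mem hsk (mul_mem (hle hd) hb), ?_⟩
          calc s k * (c * s (k + 1) * d * s k * b)
              = (s k * c) * s (k + 1) * (d * s k) * b := by simp only [mul_assoc]
            _ = c * (s k * s (k + 1) * s k) * d * b := by
              rw [hc', ← hd']; simp only [mul_assoc]
            _ = c * s (k + 1) * s k * (s (k + 1) * (d * b)) := by
              rw [hs.braid k hk hk']; simp only [mul_assoc]

end Reflections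

section ConjClassification

variable {N : Type*} [Monoid N] {n : ℕ} {s : ℕ → Nˣ} {e : N}

theorem unitConj_tail_eq_self {k : ℕ} (h : ∀ i, k ≤ i → i < n → unitConj (s i) e = e)
    {g : Nˣ} (hg : g ∈ tailSubgroup n s k) : unitConj g e = e :=
  unitConj_eq_self_of_mem_closure (by rintro _ ⟨i, hi, hin, rfl⟩; exact h i hi hin) hg

/-- If `s₁` and all `sᵢ` with `i ≥ 3` fix `e`, then a property of conjugates of `e` which is
invariant under conjugation by `s₄, s₅, …` need only be checked on seven of them. -/
theorem IsBraidSystem.unitConj_cases (hs : IsBraidSystem n s) (hn : 4 ≤ n)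
    (he1 : unitConj (s 1) e = e) (he : ∀ i, 3 ≤ i → i < n → unitConj (s i) e = e)
    {P : N → Prop} (hP : ∀ a ∈ tailSubgroup n s 4, ∀ f, P f → P (unitConj a f))
    (h12 : P e) (h13 : P (unitConj (s 2) e)) (h14 : P (unitConj (s 3 * s 2) e))
    (h23 : P (unitConj (s 1 * s 2) e)) (h24 : P (unitConj (s 3 * (s 1 * s 2)) e))
    (h34 : P (unitConj (s 2 * s 3 * (s 1 * s 2)) e))
    (h45 : 4 < n → P (unitConj (s 3 * s 4 * (s 2 * s 3 * (s 1 * s 2))) e))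
    {g : Nˣ} (hg : g ∈ tailSubgroup n s 1) : P (unitConj g e) := by
  have anti {k l : ℕ} (h : k ≤ l) {a : Nˣ} (ha : a ∈ tailSubgroup n s l) :
    a ∈ tailSubgroup n s k := tailSubgroup_anti h ha
  have he3 {a : Nˣ} (ha : a ∈ tailSubgroup n s 3) : unitConj a e = e :=
    unitConj_tail_eq_self he ha
  have comm {i k : ℕ} (hi : 1 ≤ i) (hk : i + 2 ≤ k) {a : Nˣ} (ha : a ∈ tailSubgroup n s k)
      (f : N) : unitConj (s i) (unitConj a f) = unitConj a (unitConj (s i) f) := by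
    rw [← mul_unitConj, ← mul_unitConj, hs.commute_of_mem_tail hi hk ha]
  simp only [mul_unitConj] at h14 h23 h24 h34 h45
  set e23 := unitConj (s 1) (unitConj (s 2) e) with he23
  set e34 := unitConj (s 2) (unitConj (s 3) e23) with he34
  have e23_two : unitConj (s 2) e23 = e23 := by
    rw [he23, ← mul_unitConj, ← mul_unitConj, ← hs.braid 1 le_rfl (by omega),
      mul_unitConj, he1, mul_unitConj]
  have e23_tail {a : Nˣ} (ha : a ∈ tailSubgroup n s 4) : unitConj a e23 = e23 := by
    rw [he23, ← comm le_rfl (by omega) ha, ← comm (by omega) le_rfl ha, he3 (anti (by omega) ha)]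
  have e34_three : unitConj (s 3) e34 = e34 := by
    rw [he34, ← mul_unitConj, ← mul_unitConj, ← hs.braid 2 (by omega) (by omega),
      mul_unitConj, e23_two, mul_unitConj]
  have e34_tail {a : Nˣ} (ha : a ∈ tailSubgroup n s 5) : unitConj a e34 = e34 := by
    rw [he34, ← comm (by omega) (by omega) ha, ← comm (by omega) le_rfl ha,
      e23_tail (anti (by omega) ha)]
  have tail_e23 {a : Nˣ} (ha : a ∈ tailSubgroup n s 3) : P (unitConj a e23) := by
    rcases hs.tail_cases (by omega) ha with ha | ⟨-, b, hb, c, hc, rfl⟩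
    · exact hP a ha _ h23
    · rw [mul_unitConj, mul_unitConj, e23_tail hc]
      exact hP b hb _ h24
  have tail_e34 {a : Nˣ} (ha : a ∈ tailSubgroup n s 3) : P (unitConj a e34) := by
    rcases hs.tail_cases (by omega) ha with ha | ⟨-, b, hb, c, hc, rfl⟩
    · exact hP a ha _ h34
    · rcases hs.tail_cases (by omega) hc with hc | ⟨h4, c, hc', d, hd, rfl⟩
      · rw [mul_unitConj, mul_unitConj, e34_tail hc, e34_three]
        exact hP b hb _ h34
      · rw [mul_unitConj, mul_unitConj, mul_unitConj, mul_unitConj, e34_tail hd,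
          comm (by omega) le_rfl hc']
        exact hP b hb _ (hP c (anti (by omega) hc') _ (h45 h4))
  have two_e23 {a : Nˣ} (ha : a ∈ tailSubgroup n s 2) : P (unitConj a e23) := by
    rcases hs.tail_cases (by omega) ha with ha | ⟨-, b, hb, c, hc, rfl⟩
    · exact tail_e23 ha
    · rcases hs.tail_cases (by omega) hc with hc | ⟨-, c, hc', d, hd, rfl⟩
      · rw [mul_unitConj, mul_unitConj, e23_tail hc, e23_two]
        exact tail_e23 hb
      · rw [mul_unitConj, mul_unitConj, mul_unitConj, mul_unitConj, e23_tail hd,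
          comm (by omega) le_rfl hc', ← mul_unitConj]
        exact tail_e34 (mul_mem hb (anti (by omega) hc'))
  have two_e {a : Nˣ} (ha : a ∈ tailSubgroup n s 2) : P (unitConj a e) := by
    rcases hs.tail_cases (by omega) ha with ha | ⟨-, b, hb, c, hc, rfl⟩
    · rwa [he3 ha]
    · rw [mul_unitConj, mul_unitConj, he3 hc]
      rcases hs.tail_cases (by omega) hb with hb | ⟨-, b, hb', d, hd, rfl⟩
      · exact hP b hb _ h13
      · rw [mul_unitConj, mul_unitConj, ← comm (by omega) le_rfl hd, he3 (anti (by omega) hd)]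
        exact hP b hb' _ h14
  rcases hs.tail_cases le_rfl hg with hg | ⟨-, a, ha, b, hb, rfl⟩
  · exact two_e hg
  · rcases hs.tail_cases (by omega) hb with hb | ⟨-, b, hb', c, hc, rfl⟩
    · rw [mul_unitConj, mul_unitConj, he3 hb, he1]
      exact two_e ha
    · rw [mul_unitConj, mul_unitConj, mul_unitConj, mul_unitConj, he3 hc,
        comm le_rfl le_rfl hb', ← mul_unitConj]
      exact two_e23 (mul_mem ha (anti (by omega) hb'))

end ConjClassification

section DualSymmetric

variable {N : Type*} [Monoid N]

/-- Units `s₁, …, s_{n-1}` and an element `x` satisfying the defining relations of `Mₙ`, with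
(R6) only required for `i = 3`. -/
structure IsDualSymmetricSystem (n : ℕ) (x : N) (s : ℕ → Nˣ) : Prop extends
    IsBraidSystem n s where
  x_pow : x ^ 3 = x
  x_s1 : x * s 1 = x
  s1_x : s 1 * x = x
  x_s2_x_s2 : x * s 2 * x * s 2 = x * s 2 * x
  s2_x_s2_x : s 2 * x * s 2 * x = x * s 2 * x
  x_s2_sq : x * s 2 * x ^ 2 = x * s 2 * x
  sq_s2_x : x ^ 2 * s 2 * x = x * s 2 * x
  sq_commute : Commute (x ^ 2) (unitConj (s 2 * s 3 * (s 1 * s 2)) (x ^ 2))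
  sq_mul_conj : x ^ 2 * unitConj (s 2 * s 3 * (s 1 * s 2)) (x ^ 2) = x * s 2 * s 3 * s 2 * x
  x_s3_x : x * s 3 * x = s 3 * x * s 3
  x_comm : ∀ i, 4 ≤ i → i < n → x * s i = s i * x

namespace IsDualSymmetricSystem

variable {n : ℕ} {x : N} {s : ℕ → Nˣ}

theorem s_mul_s (h : IsDualSymmetricSystem n x s) (i : ℕ) : (s i : N) * s i = 1 := by
  rw [← Units.val_mul, h.sq, Units.val_one]

theorem s_mul_s_assoc (h : IsDualSymmetricSystem n x s) (i : ℕ) (a : N) :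
    (s i : N) * (s i * a) = a := by
  rw [← mul_assoc, h.s_mul_s, one_mul]

theorem unitConj_s (h : IsDualSymmetricSystem n x s) (i : ℕ) (a : N) :
    unitConj (s i) a = s i * a * s i := by
  rw [unitConj, inv_eq_of_mul_eq_one_left (h.sq i)]

theorem mul_sq (h : IsDualSymmetricSystem n x s) : x * x ^ 2 = x := by
  rw [← pow_succ', h.x_pow]

theorem sq_mul_sq (h : IsDualSymmetricSystem n x s) : x ^ 2 * x ^ 2 = x ^ 2 := by
  rw [← pow_add, pow_succ x 3, h.x_pow, _root_.sq]

theorem unitConj_one_sq (h : IsDualSymmetricSystem n x s) : unitConj (s 1) (x ^ 2) = x ^ 2 := by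
  rw [h.unitConj_s, _root_.sq, ← mul_assoc, h.s1_x, mul_assoc, h.x_s1]

theorem unitConj_three_sq (h : IsDualSymmetricSystem n x s) :
    unitConj (s 3) (x ^ 2) = x ^ 2 := by
  set f := unitConj (s 3) (x ^ 2) with hf
  have hfx : f = x * f * x := by
    calc f = s 3 * x * s 3 * (s 3 * x * s 3) := by
          rw [hf, h.unitConj_s]; simp only [_root_.sq, mul_assoc, h.s_mul_s_assoc]
      _ = x * f * x := by
          rw [← h.x_s3_x, hf, h.unitConj_s]; simp only [_root_.sq, mul_assoc]
  have hefe : x ^ 2 * f * x ^ 2 = f := by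
    calc x ^ 2 * f * x ^ 2 = x * (x * f * x) * x := by simp only [_root_.sq, mul_assoc]
      _ = f := by rw [← hfx, ← hfx]
  have hff : unitConj (s 3) f = x ^ 2 := by
    rw [hf, ← mul_unitConj, h.sq, one_unitConj]
  have hfef : f * x ^ 2 * f = x ^ 2 := by
    have key := congrArg (unitConj (s 3)) hefe
    rwa [unitConj_mul, unitConj_mul, hff, ← hf] at key
  have hfi : f * f = f := by rw [hf, ← unitConj_mul, h.sq_mul_sq]
  calc f = f * x ^ 2 := by
        conv_rhs => rw [← hefe, mul_assoc _ (x ^ 2), h.sq_mul_sq, hefe]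
    _ = x ^ 2 := by
        conv_lhs => rw [← hfef, mul_assoc, ← mul_assoc, hfi, ← mul_assoc, hfef]

theorem unitConj_x (h : IsDualSymmetricSystem n x s) {i : ℕ} (hi : 4 ≤ i) (hin : i < n) :
    unitConj (s i) x = x :=
  unitConj_eq_self_iff.2 (h.x_comm i hi hin).symm

theorem unitConj_sq (h : IsDualSymmetricSystem n x s) {i : ℕ} (hi : 3 ≤ i) (hin : i < n) :
    unitConj (s i) (x ^ 2) = x ^ 2 := by
  rcases hi.eq_or_lt with rfl | hi
  · exact h.unitConj_three_sq
  · rw [_root_.sq, unitConj_mul, h.unitConj_x hi hin]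

theorem sq_s2_sq (h : IsDualSymmetricSystem n x s) : x ^ 2 * s 2 * x ^ 2 = x * s 2 * x := by
  calc x ^ 2 * s 2 * x ^ 2 = x * (x * s 2 * x ^ 2) := by simp only [_root_.sq, mul_assoc]
    _ = x ^ 2 * s 2 * x := by rw [h.x_s2_sq]; simp only [_root_.sq, mul_assoc]
    _ = x * s 2 * x := h.sq_s2_x

theorem sq_mul_unitConj_two (h : IsDualSymmetricSystem n x s) :
    x ^ 2 * unitConj (s 2) (x ^ 2) = x * s 2 * x := by
  rw [h.unitConj_s, ← mul_assoc, ← mul_assoc, h.sq_s2_sq, h.x_s2_x_s2]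

theorem unitConj_two_mul_sq (h : IsDualSymmetricSystem n x s) :
    unitConj (s 2) (x ^ 2) * x ^ 2 = x * s 2 * x := by
  calc unitConj (s 2) (x ^ 2) * x ^ 2 = s 2 * (x ^ 2 * s 2 * x ^ 2) := by
        rw [h.unitConj_s]; simp only [mul_assoc]
    _ = s 2 * (s 2 * x * s 2 * x) := by rw [h.sq_s2_sq, h.s2_x_s2_x]
    _ = x * s 2 * x := by simp only [mul_assoc, h.s_mul_s_assoc]

theorem x_s2_x_mem (h : IsDualSymmetricSystem n x s) : x * s 2 * x ∈ conjSqClosure x := by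
  rw [← h.sq_mul_unitConj_two]
  exact mul_mem (sq_mem_conjSqClosure x) (unitConj_sq_mem_conjSqClosure x _)

theorem mul_unitConj_two_mem (h : IsDualSymmetricSystem n x s) :
    x * unitConj (s 2) (x ^ 2) * x ∈ conjSqClosure x := by
  have key : x * unitConj (s 2) (x ^ 2) * x = x * s 2 * x * (x * s 2 * x) := by
    rw [h.unitConj_s]; simp only [_root_.sq, mul_assoc]
  rw [key]
  exact mul_mem h.x_s2_x_mem h.x_s2_x_mem

theorem x_s2_s3_s2_x_mem (h : IsDualSymmetricSystem n x s) :
    x * s 2 * s 3 * s 2 * x ∈ conjSqClosure x := by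
  rw [← h.sq_mul_conj]
  exact mul_mem (sq_mem_conjSqClosure x) (unitConj_sq_mem_conjSqClosure x _)

theorem braid_two (h : IsDualSymmetricSystem n x s) (hn : 4 ≤ n) :
    (s 2 : N) * s 3 * s 2 = s 3 * s 2 * s 3 := by
  exact_mod_cast h.braid 2 (by omega) (by omega)

theorem mul_unitConj_three_two_mem (h : IsDualSymmetricSystem n x s) (hn : 4 ≤ n) :
    x * unitConj (s 3 * s 2) (x ^ 2) * x ∈ conjSqClosure x := by
  have key : x * unitConj (s 3 * s 2) (x ^ 2) * x =
      x * s 2 * s 3 * s 2 * x * (x * s 2 * s 3 * s 2 * x) := by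
    rw [← h.unitConj_three_sq, ← mul_unitConj, ← h.braid 2 (by omega) (by omega), mul_unitConj,
      mul_unitConj, h.unitConj_s, h.unitConj_s, h.unitConj_s]
    simp only [_root_.sq, mul_assoc]
  rw [key]
  exact mul_mem h.x_s2_s3_s2_x_mem h.x_s2_s3_s2_x_mem

theorem mul_conj_mul_mem (h : IsDualSymmetricSystem n x s) (hn : 4 ≤ n) :
    x * unitConj (s 2 * s 3 * (s 1 * s 2)) (x ^ 2) * x ∈ conjSqClosure x := by
  have h3 : (s 3 : N) * x ^ 2 = x ^ 2 * s 3 := unitConj_eq_self_iff.1 h.unitConj_three_sq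
  have key : x * unitConj (s 2 * s 3 * (s 1 * s 2)) (x ^ 2) * x =
      unitConj (s 3) (x * s 2 * x) := by
    set f := unitConj (s 2 * s 3 * (s 1 * s 2)) (x ^ 2) with hf
    calc x * f * x = x * (x ^ 2 * f) * x := by rw [← mul_assoc, h.mul_sq]
      _ = x ^ 2 * (s 2 * s 3 * s 2) * x ^ 2 := by
          rw [h.sq_mul_conj]; simp only [_root_.sq, mul_assoc]
      _ = (x ^ 2 * s 3) * s 2 * (s 3 * x ^ 2) := by
          rw [h.braid_two hn]; simp only [mul_assoc]
      _ = (s 3 * x ^ 2) * s 2 * (x ^ 2 * s 3) := by rw [h3]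
      _ = s 3 * (x ^ 2 * s 2 * x ^ 2) * s 3 := by simp only [mul_assoc]
      _ = unitConj (s 3) (x * s 2 * x) := by rw [h.sq_s2_sq, h.unitConj_s]
  rw [key]
  exact unitConj_mem_conjSqClosure _ h.x_s2_x_mem

theorem unitConj_three_four_transposition (h : IsDualSymmetricSystem n x s) (hn : 4 < n) :
    unitConj (s 3 * s 4) ((s 2 : N) * s 3 * s 2) = unitConj (s 4) ((s 2 : N) * s 3 * s 2) := by
  have h24 : (s 2 : N) * s 4 = s 4 * s 2 := by
    exact_mod_cast h.comm 2 4 (by omega) le_rfl hn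
  have h34 : (s 3 : N) * s 4 * s 3 = s 4 * s 3 * s 4 := by
    exact_mod_cast h.braid 3 (by omega) hn
  rw [h.braid_two hn.le, mul_unitConj, unitConj_eq_self_iff, h.unitConj_s]
  calc (s 3 : N) * (s 4 * (s 3 * s 2 * s 3) * s 4) = (s 3 * s 4 * s 3) * s 2 * s 3 * s 4 := by
        simp only [mul_assoc]
    _ = s 4 * s 3 * (s 4 * s 2) * s 3 * s 4 := by rw [h34]; simp only [mul_assoc]
    _ = s 4 * s 3 * s 2 * (s 4 * s 3 * s 4) := by rw [← h24]; simp only [mul_assoc]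
    _ = s 4 * (s 3 * s 2 * s 3) * s 4 * s 3 := by rw [← h34]; simp only [mul_assoc]

theorem mul_unitConj_three_four_mem (h : IsDualSymmetricSystem n x s) (hn : 4 < n) :
    x * unitConj (s 3 * s 4 * (s 2 * s 3 * (s 1 * s 2))) (x ^ 2) * x ∈ conjSqClosure x := by
  set q := unitConj (s 4) ((s 2 : N) * s 3 * s 2) with hq
  have hq3 : unitConj (s 3) q = q := by
    rw [hq, ← mul_unitConj, h.unitConj_three_four_transposition hn]
  set f := unitConj (s 3 * s 4 * (s 2 * s 3 * (s 1 * s 2))) (x ^ 2) with hf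
  have hef : x ^ 2 * f = s 3 * x * s 3 * q * (s 3 * x * s 3) := by
    calc x ^ 2 * f
        = unitConj (s 3) (unitConj (s 4) (x ^ 2 * unitConj (s 2 * s 3 * (s 1 * s 2)) (x ^ 2))) := by
          rw [unitConj_mul, unitConj_mul, h.unitConj_sq (by omega) hn, h.unitConj_three_sq, hf,
            mul_unitConj (s 3 * s 4), mul_unitConj (s 3)]
      _ = unitConj (s 3) (unitConj (s 4) (x * (s 2 * s 3 * s 2) * x)) := by
          rw [h.sq_mul_conj]; simp only [mul_assoc]
      _ = unitConj (s 3) (x * q * x) := by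
          rw [unitConj_mul (s 4), unitConj_mul (s 4), h.unitConj_x le_rfl hn]
      _ = s 3 * x * s 3 * q * (s 3 * x * s 3) := by
          rw [unitConj_mul, unitConj_mul, hq3, h.unitConj_s]
  have key : x * f * x = x ^ 2 * f := by
    calc x * f * x = x * (x ^ 2 * f) * x := by rw [← mul_assoc, h.mul_sq]
      _ = x * (s 3 * x * s 3) * q * (s 3 * x * s 3 * x) := by rw [hef]; simp only [mul_assoc]
      _ = (x * s 3 * x) * (s 3 * q * s 3) * (x * s 3 * x) := by simp only [mul_assoc]
      _ = s 3 * x * s 3 * q * (s 3 * x * s 3) := by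
          rw [← h.unitConj_s 3 q, hq3, h.x_s3_x]
      _ = x ^ 2 * f := hef.symm
  rw [key]
  exact mul_mem (sq_mem_conjSqClosure x) (unitConj_sq_mem_conjSqClosure x _)

/-- `x²` commutes with its conjugates, and `x` conjugates them into `conjSqClosure x`. -/
theorem commute_and_mul_mul_mem (h : IsDualSymmetricSystem n x s) (hn : 4 ≤ n) {g : Nˣ}
    (hg : g ∈ tailSubgroup n s 1) :
    Commute (x ^ 2) (unitConj g (x ^ 2)) ∧ x * unitConj g (x ^ 2) * x ∈ conjSqClosure x := by
  have h13 : Commute (x ^ 2) (unitConj (s 2) (x ^ 2)) :=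
    h.sq_mul_unitConj_two.trans h.unitConj_two_mul_sq.symm
  have h14 : Commute (x ^ 2) (unitConj (s 3 * s 2) (x ^ 2)) := by
    rw [mul_unitConj]
    exact h13.unitConj_right h.unitConj_three_sq
  have conj_one {f : N} (hf : Commute (x ^ 2) f ∧ x * f * x ∈ conjSqClosure x) :
      Commute (x ^ 2) (unitConj (s 1) f) ∧ x * unitConj (s 1) f * x ∈ conjSqClosure x := by
    refine ⟨hf.1.unitConj_right h.unitConj_one_sq, ?_⟩
    have key : x * unitConj (s 1) f * x = x * s 1 * f * (s 1 * x) := by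
      rw [h.unitConj_s]; simp only [mul_assoc]
    rw [key, h.x_s1, h.s1_x]
    exact hf.2
  refine h.unitConj_cases hn h.unitConj_one_sq (fun i hi hin => h.unitConj_sq hi hin)
    (P := fun f => Commute (x ^ 2) f ∧ x * f * x ∈ conjSqClosure x) ?_
    ⟨Commute.refl _, ?_⟩ ⟨h13, h.mul_unitConj_two_mem⟩ ⟨h14, h.mul_unitConj_three_two_mem hn⟩ ?_ ?_
    ⟨h.sq_commute, h.mul_conj_mul_mem hn⟩
    (fun hn' => ⟨?_, h.mul_unitConj_three_four_mem hn'⟩) hg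
  · rintro a ha f ⟨hf, hxf⟩
    have hax : unitConj a x = x :=
      unitConj_tail_eq_self (fun i hi hin => h.unitConj_x hi hin) ha
    refine ⟨hf.unitConj_right (by rw [_root_.sq, unitConj_mul, hax]), ?_⟩
    have key := unitConj_mem_conjSqClosure a hxf
    rwa [unitConj_mul, unitConj_mul, hax] at key
  · rw [h.mul_sq, ← _root_.sq]
    exact sq_mem_conjSqClosure x
  · rw [mul_unitConj]
    exact conj_one ⟨h13, h.mul_unitConj_two_mem⟩
  · rw [← mul_assoc, ← h.comm 1 3 le_rfl le_rfl (by omega), mul_assoc, mul_unitConj]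
    exact conj_one ⟨h14, h.mul_unitConj_three_two_mem hn⟩
  · rw [mul_unitConj, mul_unitConj]
    exact (h.sq_commute.unitConj_right (h.unitConj_sq (by omega) hn')).unitConj_right
      h.unitConj_three_sq

theorem eq_one_of_mul_eq_one (h : IsDualSymmetricSystem n x s) (hn : 4 ≤ n) {b : N}
    (hb : x * b = 1) : x = 1 := by
  have hxx : x * x = 1 := by
    calc x * x = x ^ 3 * b := by
          rw [pow_succ, _root_.sq, mul_assoc _ x b, hb, mul_one]
      _ = 1 := by rw [h.x_pow, hb]
  have h1 : s 1 = 1 := by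
    ext
    calc (s 1 : N) = s 1 * (x * x) := by rw [hxx, mul_one]
      _ = 1 := by rw [← mul_assoc, h.s1_x, hxx]
  have h2 : s 2 = 1 := by
    have key := h.braid 1 le_rfl (by omega)
    simpa [h1, h.sq] using key
  have key := h.x_s2_sq
  simpa [h2, _root_.sq, hxx] using key

theorem mem_closure_of_isUnit (h : IsDualSymmetricSystem n x s) (hn : 4 ≤ n)
    (hgen : Submonoid.closure ({x} ∪ {b : N | ∃ i, 1 ≤ i ∧ i < n ∧ b = s i}) = ⊤)
    {a : N} (ha : IsUnit a) :
    a ∈ Submonoid.closure {b : N | ∃ i, 1 ≤ i ∧ i < n ∧ b = s i} := by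
  set T := {b : N | ∃ i, 1 ≤ i ∧ i < n ∧ b = s i} with hT
  have hcases : a ∈ Submonoid.closure T ∨ ∃ t : Nˣ, ∃ b, a = t * x * b := by
    have hmem : a ∈ Submonoid.closure ({x} ∪ T) := hgen ▸ Submonoid.mem_top a
    clear ha
    induction hmem using Submonoid.closure_induction_left with
    | one => exact Or.inl (one_mem _)
    | mul_left y hy a _ ih =>
      rcases hy with rfl | hy
      · exact Or.inr ⟨1, a, by simp⟩
      · rcases ih with ih | ⟨t, b, rfl⟩
        · exact Or.inl (mul_mem (Submonoid.subset_closure hy) ih)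
        · obtain ⟨i, -, -, rfl⟩ := hy
          exact Or.inr ⟨s i * t, b, by simp [mul_assoc]⟩
  rcases hcases with hmem | ⟨t, b, rfl⟩
  · exact hmem
  · obtain ⟨u, hu⟩ := ha
    have hb : x * (b * (↑u⁻¹ * t)) = 1 := by
      calc x * (b * (↑u⁻¹ * t)) = ↑t⁻¹ * (t * x * b) * ↑u⁻¹ * t := by simp [mul_assoc]
        _ = 1 := by rw [← hu]; simp [mul_assoc]
    have hx := h.eq_one_of_mul_eq_one hn hb
    have htop : Submonoid.closure T = ⊤ := by
      rw [← hgen, hx, Submonoid.closure_union]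
      simp
    rw [htop]
    exact Submonoid.mem_top _

theorem mem_tailSubgroup_one (h : IsDualSymmetricSystem n x s) (hn : 4 ≤ n)
    (hgen : Submonoid.closure ({x} ∪ {b : N | ∃ i, 1 ≤ i ∧ i < n ∧ b = s i}) = ⊤) (g : Nˣ) :
    g ∈ tailSubgroup n s 1 := by
  have hle : Submonoid.closure {b : N | ∃ i, 1 ≤ i ∧ i < n ∧ b = s i} ≤
      (tailSubgroup n s 1).toSubmonoid.map (Units.coeHom N) := by
    refine Submonoid.closure_le.2 ?_
    rintro _ ⟨i, hi, hin, rfl⟩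
    exact ⟨s i, mem_tailSubgroup hi hin, rfl⟩
  obtain ⟨g', hg', heq⟩ := hle (h.mem_closure_of_isUnit hn hgen g.isUnit)
  rwa [← Units.ext heq]

end IsDualSymmetricSystem

end DualSymmetric

section Presentation

variable {n : ℕ}

theorem mk_eq_mk_of_MRel {a b : FreeMonoid (Fin n)} (h : MRel n a b) :
    (Mcon n).mk' a = (Mcon n).mk' b :=
  (Con.eq _).2 (ConGen.Rel.of _ _ h)

theorem sm_mul_sm_pow {i j : ℕ} (hi : 1 ≤ i) (hij : i ≤ j) (hj : j < n) :
    (sm n i * sm n j) ^ mExp i j = 1 := by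
  have h := mk_eq_mk_of_MRel (MRel.r1 (n := n) hi hij (by omega))
  rwa [map_pow, map_mul, map_one] at h

theorem sm_mul_self {i : ℕ} (hi : 1 ≤ i) : sm n i * sm n i = 1 := by
  by_cases hin : i < n
  · simpa [mExp] using sm_mul_sm_pow hi le_rfl hin
  · simp [sm, sw, hin]

/-- The generator `sᵢ` of `Mₙ` as a unit (junk value `1` for `i = 0`). -/
def smUnit (n i : ℕ) : (M n)ˣ :=
  if h : 1 ≤ i then ⟨sm n i, sm n i, sm_mul_self h, sm_mul_self h⟩ else 1

theorem coe_smUnit {i : ℕ} (hi : 1 ≤ i) : (smUnit n i : M n) = sm n i := by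
  simp [smUnit, hi]

theorem smUnit_mul_self (i : ℕ) : smUnit n i * smUnit n i = 1 := by
  ext
  by_cases hi : 1 ≤ i
  · simpa [coe_smUnit hi] using sm_mul_self hi
  · simp [smUnit, hi]

theorem smUnit_mul_pow {i j : ℕ} (hi : 1 ≤ i) (hij : i ≤ j) (hj : j < n) :
    (smUnit n i * smUnit n j) ^ mExp i j = 1 := by
  ext
  simpa [coe_smUnit hi, coe_smUnit (hi.trans hij)] using sm_mul_sm_pow hi hij hj

theorem smUnit_inv (i : ℕ) : (smUnit n i)⁻¹ = smUnit n i :=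
  inv_eq_of_mul_eq_one_left (smUnit_mul_self i)

theorem isBraidSystem_smUnit (n : ℕ) : IsBraidSystem n (smUnit n) where
  sq := smUnit_mul_self
  braid i hi hin := by
    have h := smUnit_mul_pow hi (Nat.le_succ i) hin
    have hm : mExp i (i + 1) = 3 := by simp [mExp]
    rw [hm, pow_succ, pow_two, ← eq_inv_iff_mul_eq_one, mul_inv_rev, smUnit_inv, smUnit_inv] at h
    calc smUnit n i * smUnit n (i + 1) * smUnit n i
        = smUnit n i * smUnit n (i + 1) * (smUnit n i * smUnit n (i + 1)) * smUnit n (i + 1) := by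
          simp only [mul_assoc, smUnit_mul_self, mul_one]
      _ = smUnit n (i + 1) * smUnit n i * smUnit n (i + 1) := by rw [h]
  comm i j hi hij hj := by
    have h := smUnit_mul_pow hi (by omega) hj
    have hm : mExp i j = 2 := by
      rw [mExp, if_neg (by omega), if_neg (by omega)]
    rwa [hm, pow_two, ← eq_inv_iff_mul_eq_one, mul_inv_rev, smUnit_inv, smUnit_inv] at h

theorem unitConj_σm (hn : 4 ≤ n) (a : M n) :
    unitConj (smUnit n 2 * smUnit n 3 * (smUnit n 1 * smUnit n 2)) a = σm n * a * σm n := by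
  have hinv : (smUnit n 2 * smUnit n 3 * (smUnit n 1 * smUnit n 2))⁻¹ =
      smUnit n 2 * smUnit n 3 * (smUnit n 1 * smUnit n 2) := by
    simp only [mul_inv_rev, smUnit_inv]
    rw [mul_assoc, ← mul_assoc (smUnit n 1),
      (isBraidSystem_smUnit n).comm 1 3 le_rfl le_rfl (by omega)]
    simp only [mul_assoc]
  have hσ : ((smUnit n 2 * smUnit n 3 * (smUnit n 1 * smUnit n 2) : (M n)ˣ) : M n) = σm n := by
    rw [← mul_assoc, Units.val_mul, Units.val_mul, Units.val_mul, coe_smUnit (by omega),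
      coe_smUnit (by omega), coe_smUnit le_rfl]
    rfl
  rw [unitConj, hinv, hσ]

theorem isDualSymmetricSystem_M (hn : 4 ≤ n) : IsDualSymmetricSystem n (xm n) (smUnit n) where
  toIsBraidSystem := isBraidSystem_smUnit n
  x_pow := mk_eq_mk_of_MRel MRel.r2
  x_s1 := by rw [coe_smUnit le_rfl]; exact mk_eq_mk_of_MRel MRel.r3a
  s1_x := by rw [coe_smUnit le_rfl]; exact mk_eq_mk_of_MRel MRel.r3b
  x_s2_x_s2 := by rw [coe_smUnit (by omega)]; exact (mk_eq_mk_of_MRel MRel.r4a).symm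
  s2_x_s2_x := by rw [coe_smUnit (by omega)]; exact (mk_eq_mk_of_MRel MRel.r4b).symm
  x_s2_sq := by rw [coe_smUnit (by omega)]; exact (mk_eq_mk_of_MRel MRel.r4c).symm
  sq_s2_x := by rw [coe_smUnit (by omega)]; exact (mk_eq_mk_of_MRel MRel.r4d).symm
  sq_commute := by
    rw [unitConj_σm hn, commute_iff_eq, ← mul_assoc, ← mul_assoc]
    exact mk_eq_mk_of_MRel (MRel.r5a hn)
  sq_mul_conj := by
    rw [unitConj_σm hn, ← mul_assoc, ← mul_assoc, coe_smUnit (by omega), coe_smUnit (by omega)]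
    exact mk_eq_mk_of_MRel (MRel.r5b hn)
  x_s3_x := by
    rw [coe_smUnit (by omega)]
    exact mk_eq_mk_of_MRel (MRel.r6 (i := 3) le_rfl (by omega))
  x_comm i hi hin := by
    rw [coe_smUnit (by omega)]
    exact mk_eq_mk_of_MRel (MRel.r7 hi (by omega))

theorem setOf_smUnit (n : ℕ) :
    {b : M n | ∃ i, 1 ≤ i ∧ i < n ∧ b = smUnit n i} =
      {b : M n | ∃ i : ℕ, 1 ≤ i ∧ i ≤ n - 1 ∧ b = sm n i} := by
  ext b
  refine exists_congr fun i => and_congr_right fun hi => ?_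
  rw [coe_smUnit hi]
  exact and_congr_left fun _ => by omega

theorem closure_generators_M (hn : 1 ≤ n) :
    Submonoid.closure ({xm n} ∪ {b : M n | ∃ i, 1 ≤ i ∧ i < n ∧ b = smUnit n i}) = ⊤ := by
  rw [eq_top_iff]
  rintro a -
  obtain ⟨w, rfl⟩ := Con.mk'_surjective a
  induction w using FreeMonoid.recOn with
  | one => exact one_mem _
  | of_mul i w ih =>
    rw [map_mul]
    refine mul_mem (Submonoid.subset_closure ?_) ih
    rcases Nat.eq_zero_or_pos i with hi | hi
    · left
      have h : i = ⟨0, hn⟩ := Fin.ext hi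
      rw [Set.mem_singleton_iff, xm, xw, dif_pos (show 0 < n from hn), h]
    · right
      exact ⟨i, hi, i.2, by simp [coe_smUnit hi, sm, sw]⟩

end Presentation

/-- For `n ≥ 4`, the monoid `Mₙ` is an inverse monoid; its set of
idempotents equals the submonoid generated by `{g⁻¹ x² g : g a unit of Mₙ}`; and its
factorizable part `E(Mₙ)G(Mₙ)` equals the submonoid generated by
`{x², s₁, …, s_{n-1}}`. -/
theorem stmt11 (n : ℕ) (hn : 4 ≤ n) :
    IsInverseMonoid (M n) ∧
    {a : M n | IsIdempotentElem a} =
      (Submonoid.closure {a : M n | ∃ g : (M n)ˣ, a = ↑g⁻¹ * xm n ^ 2 * ↑g} : Set (M n)) ∧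
    {a : M n | ∃ e g : M n, IsIdempotentElem e ∧ IsUnit g ∧ a = e * g} =
      (Submonoid.closure
        ({xm n ^ 2} ∪ {b : M n | ∃ i : ℕ, 1 ≤ i ∧ i ≤ n - 1 ∧ b = sm n i}) : Set (M n)) := by
  have h := isDualSymmetricSystem_M hn
  have hgen := closure_generators_M (n := n) (by omega)
  have hunits := fun g => h.commute_and_mul_mul_mem hn (h.mem_tailSubgroup_one hn hgen g)
  have hcomm := fun g => (hunits g).1
  have hxx := fun g => (hunits g).2
  have hgen' : Submonoid.closure ({xm n} ∪ {a : M n | IsUnit a}) = ⊤ := by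
    refine top_unique (hgen.ge.trans (Submonoid.closure_mono (Set.union_subset_union_right _ ?_)))
    rintro _ ⟨i, -, -, rfl⟩
    exact (smUnit n i).isUnit
  have hidem : ∀ a : M n, IsIdempotentElem a ↔ a ∈ conjSqClosure (xm n) := fun a =>
    isIdempotentElem_iff_mem_conjSqClosure h.x_pow hgen' hcomm hxx
  refine ⟨isInverseMonoid_of_conj_sq h.x_pow hgen' hcomm hxx, Set.ext hidem, ?_⟩
  rw [← setOf_smUnit]
  refine setOf_idempotent_mul_unit_eq_closure hidem ?_
    fun a ha => h.mem_closure_of_isUnit hn hgen ha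
  rintro _ ⟨i, -, -, rfl⟩
  exact (smUnit n i).isUnit
end
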